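/- arXiv:0811.2591 — 2 statements merged into one kernel-verified Lean document; each statement's English description precedes it below -/
import Mathlib

section
/- Let H be an N×N hermitian Wigner matrix satisfying condition C1, let κ > 0 and fix E ∈ [−2+κ, 2−κ]. Let ν, β be positive numbers with ν + 4β < 1/2, and let η > 0 with 1 ≤ Nη ≤ C N^β. Let 𝒩 be the number of eigenvalues of H in I_η = [E − η/2, E + η/2]. Then (with all constants depending on κ): for any 2 ≤ M ≤ C N^β/(Nη), P( 𝒩/(Nη) ≥ M ) ≤ (C/M)^{ν M N η}; and for any 1 ≤ p ≤ C N^{β/2}, E[ (𝒩/(Nη))^p ] ≤ C^p (1 + p/(Nη))^p. -/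
open MeasureTheory ProbabilityTheory
open scoped ENNReal NNReal

noncomputable section

/-- The density of the Wigner semicircle law. -/
def rhoSC (x : ℝ) : ℝ := if |x| ≤ 2 then Real.sqrt (4 - x ^ 2) / (2 * Real.pi) else 0

/-- The Stieltjes transform of the Wigner semicircle law. -/
def mSC (z : ℂ) : ℂ := ∫ x : ℝ, (rhoSC x : ℂ) / ((x : ℂ) - z)

/-- The Stieltjes transform of the empirical eigenvalue distribution of a matrix:
`m(z) = N⁻¹ Tr (H - z)⁻¹`. -/
def stTrans {N : ℕ} (A : Matrix (Fin N) (Fin N) ℂ) (z : ℂ) : ℂ :=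
  (Matrix.trace (A - z • (1 : Matrix (Fin N) (Fin N) ℂ))⁻¹) / (N : ℂ)

open scoped Classical in
/-- The number of eigenvalues (with multiplicity) of a Hermitian matrix lying in a set `I`. -/
def eigCount {N : ℕ} {A : Matrix (Fin N) (Fin N) ℂ} (hA : A.IsHermitian) (I : Set ℝ) : ℕ :=
  (Finset.univ.filter fun i => hA.eigenvalues i ∈ I).card

/-- `ν` has a strictly positive density `h` on `ℝ² ≃ ℂ` which is either a product of two copies
of a one-variable function or radially symmetric. -/
def WignerDensityOf (ν : Measure ℂ) (h : ℝ → ℝ → ℝ) : Prop :=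
  (∀ x y, 0 < h x y) ∧
  ν = (volume : Measure ℂ).withDensity (fun z => ENNReal.ofReal (h z.re z.im)) ∧
  ((∃ hs : ℝ → ℝ, ∀ x y, h x y = hs x * hs y) ∨
   (∃ hs : ℝ → ℝ, ∀ x y, h x y = hs (x ^ 2 + y ^ 2)))

/-- Condition C1, with explicit constants: Gaussian moments of the off-diagonal law `ν`
and of the diagonal law `ν'` are bounded by `D` resp. `D'`. -/
def CondC1 (ν : Measure ℂ) (ν' : Measure ℝ) (δ₀ D D' : ℝ) : Prop :=
  0 < δ₀ ∧
  (∫⁻ z, ENNReal.ofReal (Real.exp (δ₀ * ‖z‖ ^ 2)) ∂ν) ≤ ENNReal.ofReal D ∧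
  (∫⁻ x, ENNReal.ofReal (Real.exp (δ₀ * x ^ 2)) ∂ν') ≤ ENNReal.ofReal D'

/-- `H` is an `N × N` hermitian Wigner ensemble on the probability space `(Ω, P)`:
the entries above the diagonal are i.i.d. with law `N^{-1/2} ν` where `ν` has mean zero,
variance one and a density as in `WignerDensityOf`; the diagonal entries are real i.i.d.
with law `N^{-1/2} ν'`, `ν'` of mean zero; and all these entries are independent. -/
structure IsWignerMatrix {Ω : Type} [MeasurableSpace Ω] (P : Measure Ω) (N : ℕ)
    (H : Ω → Matrix (Fin N) (Fin N) ℂ) (ν : Measure ℂ) (ν' : Measure ℝ) : Prop where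
  herm : ∀ ω, (H ω).IsHermitian
  prob : IsProbabilityMeasure P
  probν : IsProbabilityMeasure ν
  probν' : IsProbabilityMeasure ν'
  density : ∃ h, WignerDensityOf ν h
  mean : (∫ z, z ∂ν) = 0
  var : (∫ z, ‖z‖ ^ 2 ∂ν) = 1
  mean' : (∫ x, x ∂ν') = 0
  offdiag : ∀ i j : Fin N, i < j →
    P.map (fun ω => (Real.sqrt N : ℂ) * H ω i j) = ν
  diag : ∀ i : Fin N, P.map (fun ω => Real.sqrt N * (H ω i i).re) = ν'
  diag_real : ∀ ω i, (H ω i i).im = 0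
  indep : iIndepFun
    (fun (p : {p : Fin N × Fin N // p.1 ≤ p.2}) (ω : Ω) => H ω p.1.1 p.1.2) P
/-- The Fourier transform on `ℝ²` of a real function of two variables. -/
def fourier2 (f : ℝ → ℝ → ℝ) (t s : ℝ) : ℂ :=
  ∫ x : ℝ, ∫ y : ℝ, Complex.exp (-Complex.I * (t * x + s * y)) * (f x y : ℂ)

/-- The Laplacian of a function of two real variables. -/
def laplacian2 (g : ℝ → ℝ → ℝ) (x y : ℝ) : ℝ :=
  deriv (deriv (fun t => g t y)) x + deriv (deriv (fun t => g x t)) y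

/-- Condition C2 with exponent `a` and constants `w`, `w'`: decay of the Fourier transforms
of the density `h` and of `h · Δ(-log h)`. -/
def CondC2 (h : ℝ → ℝ → ℝ) (a : ℕ) (w w' : ℝ) : Prop :=
  0 < w ∧ 0 < w' ∧
  (∀ t s : ℝ, ‖fourier2 h t s‖ ≤ 1 / (1 + w * (t ^ 2 + s ^ 2)) ^ a) ∧
  (∀ t s : ℝ, ‖fourier2
      (fun x y => h x y * laplacian2 (fun u v => -Real.log (h u v)) x y) t s‖
    ≤ 1 / (1 + w' * (t ^ 2 + s ^ 2)) ^ a)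

/-- Either the real and imaginary parts under `ν` are i.i.d., or `ν` is rotationally
symmetric. -/
def ComplexSymm (ν : Measure ℂ) : Prop :=
  (∃ μ₀ : Measure ℝ,
    ν = Measure.map (fun p : ℝ × ℝ => (p.1 : ℂ) + p.2 * Complex.I) (μ₀.prod μ₀)) ∨
  (∀ θ : ℝ, Measure.map (fun z => Complex.exp (θ * Complex.I) * z) ν = ν)

/-! ### Nets -/

lemma aux_card_sep {F : Type*} [NormedAddCommGroup F] [NormedSpace ℝ F] [FiniteDimensional ℝ F]
    (e : ℝ) (he : 0 < e) (s : Finset F) (hs : ∀ c ∈ s, ‖c‖ ≤ 1)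
    (h : ∀ c ∈ s, ∀ d ∈ s, c ≠ d → e ≤ ‖c - d‖) :
    (s.card : ℝ) ≤ (1 + 2 / e) ^ Module.finrank ℝ F := by
  borelize F
  let μ : Measure F := Measure.addHaar
  have hd : (0 : ℝ) < e / 2 := by positivity
  have hr : (0 : ℝ) < 1 + e / 2 := by positivity
  have hdisj : Set.Pairwise (s : Set F) (Function.onFun Disjoint fun c => Metric.ball (c : F) (e / 2)) := by
    rintro c hc d hd hcd
    apply Metric.ball_disjoint_ball
    rw [dist_eq_norm]
    have := h c hc d hd hcd
    linarith
  have hsub : (⋃ c ∈ s, Metric.ball (c : F) (e / 2)) ⊆ Metric.ball (0 : F) (1 + e / 2) := by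
    refine Set.iUnion₂_subset fun x hx => ?_
    apply Metric.ball_subset_ball'
    rw [dist_zero_right]
    linarith [hs x hx]
  have I : (s.card : ℝ≥0∞) * ENNReal.ofReal ((e / 2) ^ Module.finrank ℝ F) * μ (Metric.ball 0 1) ≤
      ENNReal.ofReal ((1 + e / 2) ^ Module.finrank ℝ F) * μ (Metric.ball 0 1) :=
    calc
      _ = μ (⋃ c ∈ s, Metric.ball (c : F) (e / 2)) := by
        rw [measure_biUnion_finset hdisj fun c _ => measurableSet_ball]
        simp only [μ.addHaar_ball_of_pos _ hd]
        simp only [Finset.sum_const, nsmul_eq_mul, mul_assoc]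
      _ ≤ μ (Metric.ball (0 : F) (1 + e / 2)) := measure_mono hsub
      _ = _ := by simp only [μ.addHaar_ball_of_pos _ hr]
  have J := (ENNReal.mul_le_mul_iff_left (Metric.measure_ball_pos μ _ zero_lt_one).ne'
    measure_ball_lt_top.ne).1 I
  have K := ENNReal.toReal_le_of_le_ofReal (pow_nonneg hr.le _) J
  rw [ENNReal.toReal_mul, ENNReal.toReal_ofReal (by positivity)] at K
  simp only [ENNReal.toReal_natCast] at K
  have h1 : (1 + 2 / e) = (1 + e / 2) / (e / 2) := by field_simp; ring
  rw [h1, div_pow, le_div_iff₀ (by positivity)]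
  exact K

/-- nets of the unit sphere -/
lemma aux_net {F : Type*} [NormedAddCommGroup F] [NormedSpace ℝ F] [FiniteDimensional ℝ F]
    (e : ℝ) (he : 0 < e) :
    ∃ s : Finset F, (∀ c ∈ s, ‖c‖ = 1) ∧ (∀ x : F, ‖x‖ = 1 → ∃ c ∈ s, ‖x - c‖ ≤ e) ∧
      (s.card : ℝ) ≤ (1 + 2 / e) ^ Module.finrank ℝ F := by
  classical
  let Q : ℕ → Prop := fun n => ∃ s : Finset F, (∀ c ∈ s, ‖c‖ = 1) ∧
    (∀ c ∈ s, ∀ d ∈ s, c ≠ d → e ≤ ‖c - d‖) ∧ s.card = n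
  have hQ0 : Q 0 := ⟨∅, by simp, by simp, by simp⟩
  obtain ⟨B, hB⟩ := exists_nat_ge ((1 + 2 / e) ^ Module.finrank ℝ F)
  have hbd : ∀ n, Q n → n ≤ B := by
    rintro n ⟨s, hs1, hs2, rfl⟩
    have := aux_card_sep e he s (fun c hc => (hs1 c hc).le) hs2
    exact_mod_cast this.trans hB
  obtain ⟨s, hs1, hs2, hs3⟩ := Nat.findGreatest_spec (P := Q) (Nat.zero_le B) hQ0
  refine ⟨s, hs1, fun x hx => ?_, aux_card_sep e he s (fun c hc => (hs1 c hc).le) hs2⟩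
  by_contra! hc
  have hxs : x ∉ s := fun hxs => by
    have := hc x hxs
    simp at this; linarith
  have hQ : Q (Nat.findGreatest Q B + 1) := by
    refine ⟨insert x s, ?_, ?_, ?_⟩
    · intro c hcs
      rcases Finset.mem_insert.1 hcs with rfl | h
      · exact hx
      · exact hs1 c h
    · intro c hcs d hds hcd
      rcases Finset.mem_insert.1 hcs with rfl | h <;> rcases Finset.mem_insert.1 hds with rfl | h'
      · exact absurd rfl hcd
      · exact (hc d h').le
      · rw [norm_sub_rev]; exact (hc c h).le
      · exact hs2 c h d h' hcd
    · rw [Finset.card_insert_of_notMem hxs, hs3]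
  have := Nat.le_findGreatest (hbd _ hQ) hQ
  omega

/-! ### Moments of a subgaussian law -/

/-- exponential square moment, as an integral -/
structure SG {Ω : Type*} [MeasurableSpace Ω] (P : Measure Ω) (δ D : ℝ) (b : Ω → ℂ) : Prop where
  meas : Measurable b
  int : Integrable (fun ω => Real.exp (δ * ‖b ω‖ ^ 2)) P
  le : ∫ ω, Real.exp (δ * ‖b ω‖ ^ 2) ∂P ≤ D
  mean : ∫ ω, b ω ∂P = 0

lemma SG.pow4_le {δ : ℝ} (hδ : 0 < δ) (z : ℂ) :
    ‖z‖ ^ 4 ≤ 2 / δ ^ 2 * Real.exp (δ * ‖z‖ ^ 2) := by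
  have h := Real.quadratic_le_exp_of_nonneg (x := δ * ‖z‖ ^ 2) (by positivity)
  have h2 : (δ * ‖z‖ ^ 2) ^ 2 / 2 ≤ Real.exp (δ * ‖z‖ ^ 2) := by
    have : 0 ≤ δ * ‖z‖ ^ 2 := by positivity
    linarith
  calc ‖z‖ ^ 4 = 2 / δ ^ 2 * ((δ * ‖z‖ ^ 2) ^ 2 / 2) := by field_simp
    _ ≤ _ := by gcongr

lemma SG.int4 {Ω : Type*} [MeasurableSpace Ω] {P : Measure Ω} {δ D : ℝ}
    {b : Ω → ℂ} (hb : SG P δ D b) (hδ : 0 < δ) :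
    Integrable (fun ω => ‖b ω‖ ^ 4) P := by
  refine (hb.int.const_mul (2 / δ ^ 2)).mono' (hb.meas.norm.pow_const 4).aestronglyMeasurable ?_
  refine Filter.Eventually.of_forall fun ω => ?_
  rw [Real.norm_of_nonneg (by positivity)]
  exact SG.pow4_le hδ _

lemma SG.le4 {Ω : Type*} [MeasurableSpace Ω] {P : Measure Ω} {δ D : ℝ}
    {b : Ω → ℂ} (hb : SG P δ D b) (hδ : 0 < δ) :
    ∫ ω, ‖b ω‖ ^ 4 ∂P ≤ 2 * D / δ ^ 2 := by
  calc ∫ ω, ‖b ω‖ ^ 4 ∂P ≤ ∫ ω, 2 / δ ^ 2 * Real.exp (δ * ‖b ω‖ ^ 2) ∂P :=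
        integral_mono (hb.int4 hδ) (hb.int.const_mul _) (fun ω => SG.pow4_le hδ _)
    _ = 2 / δ ^ 2 * ∫ ω, Real.exp (δ * ‖b ω‖ ^ 2) ∂P := integral_const_mul _ _
    _ ≤ 2 / δ ^ 2 * D := by gcongr; exact hb.le
    _ = _ := by ring

lemma SG.memLp4 {Ω : Type*} [MeasurableSpace Ω] {P : Measure Ω} {δ D : ℝ}
    {b : Ω → ℂ} (hb : SG P δ D b) (hδ : 0 < δ) :
    MemLp b 4 P := by
  rw [← integrable_norm_rpow_iff hb.meas.aestronglyMeasurable (by norm_num) (by norm_num)]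
  have := hb.int4 hδ
  refine this.congr (Filter.Eventually.of_forall fun ω => ?_)
  simp only [ENNReal.toReal_ofNat]
  norm_cast

lemma SG.memLp2 {Ω : Type*} [MeasurableSpace Ω] {P : Measure Ω} [IsProbabilityMeasure P]
    {δ D : ℝ} {b : Ω → ℂ} (hb : SG P δ D b) (hδ : 0 < δ) :
    MemLp b 2 P := (hb.memLp4 hδ).mono_exponent (by norm_num)

lemma SG.integrable {Ω : Type*} [MeasurableSpace Ω] {P : Measure Ω} [IsProbabilityMeasure P]
    {δ D : ℝ} {b : Ω → ℂ} (hb : SG P δ D b) (hδ : 0 < δ) :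
    Integrable b P := (hb.memLp4 hδ).integrable (by norm_num)

instance holder442 : ENNReal.HolderTriple 4 4 2 where
  inv_add_inv_eq_inv := by
    have h4 : (4 : ℝ≥0∞) = 2 * 2 := by norm_num
    rw [h4, ENNReal.mul_inv (by simp) (by simp), ← two_mul, ← mul_assoc,
      ENNReal.mul_inv_cancel (by simp) (by simp), one_mul]

/-- orthogonality -/
lemma var_sum {Ω : Type*} [MeasurableSpace Ω] {P : Measure Ω} [IsProbabilityMeasure P]
    {δ D : ℝ} (hδ : 0 < δ) {ι : Type*} {b : ι → Ω → ℂ} (hb : ∀ i, SG P δ D (b i))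
    (hind : iIndepFun b P) (F : Finset ι) (hvar : ∀ i ∈ F, ∫ ω, ‖b i ω‖ ^ 2 ∂P = 1) (α : ι → ℂ) :
    ∫ ω, ‖∑ l ∈ F, α l * b l ω‖ ^ 2 ∂P = ∑ l ∈ F, ‖α l‖ ^ 2 := by
  classical
  have hstar : ∀ i, MemLp (fun ω => (starRingEnd ℂ) (b i ω)) 2 P := fun i => ((hb i).memLp2 hδ).star
  have hcov : ∀ l ∈ F, ∀ m, ∫ ω, b l ω * (starRingEnd ℂ) (b m ω) ∂P = if l = m then 1 else 0 := by
    intro l hl m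
    split_ifs with h
    · subst h
      have : ∀ ω, b l ω * (starRingEnd ℂ) (b l ω) = ((‖b l ω‖ ^ 2 : ℝ) : ℂ) := fun ω => by
        rw [Complex.mul_conj, Complex.normSq_eq_norm_sq]
      simp_rw [this]
      rw [integral_complex_ofReal, hvar l hl]; simp
    · have h1 : IndepFun (b l) (fun ω => (starRingEnd ℂ) (b m ω)) P :=
        (hind.indepFun h).comp measurable_id Complex.continuous_conj.measurable
      have := h1.integral_fun_mul_eq_mul_integral ((hb l).meas.aestronglyMeasurable)
        (Complex.continuous_conj.measurable.comp (hb m).meas).aestronglyMeasurable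
      rw [this, (hb l).mean, zero_mul]
  have hint : ∀ l m, Integrable (fun ω => b l ω * (starRingEnd ℂ) (b m ω)) P := fun l m =>
    ((hb l).memLp2 hδ).integrable_mul (hstar m)
  have key : ∫ ω, ((‖∑ l ∈ F, α l * b l ω‖ ^ 2 : ℝ) : ℂ) ∂P = ∑ l ∈ F, ((‖α l‖ ^ 2 : ℝ) : ℂ) := by
    have h1 : ∀ ω, ((‖∑ l ∈ F, α l * b l ω‖ ^ 2 : ℝ) : ℂ) =
        ∑ l ∈ F, ∑ m ∈ F, (α l * (starRingEnd ℂ) (α m)) * (b l ω * (starRingEnd ℂ) (b m ω)) := by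
      intro ω
      rw [← Complex.normSq_eq_norm_sq, ← Complex.mul_conj, map_sum, Finset.sum_mul_sum]
      refine Finset.sum_congr rfl fun l _ => Finset.sum_congr rfl fun m _ => ?_
      rw [map_mul]; ring
    simp_rw [h1]
    rw [integral_finsetSum _ fun l _ => integrable_finsetSum _ fun m _ => (hint l m).const_mul _]
    refine Finset.sum_congr rfl fun l hl => ?_
    rw [integral_finsetSum _ fun m _ => (hint l m).const_mul _]
    simp_rw [integral_const_mul, hcov l hl]
    simp only [mul_ite, mul_one, mul_zero, Finset.sum_ite_eq, hl, if_true]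
    rw [Complex.mul_conj, Complex.normSq_eq_norm_sq]
  rw [integral_complex_ofReal] at key
  exact_mod_cast key

/-- variance of the quadratic form -/
lemma quad_var {Ω : Type*} [MeasurableSpace Ω] {P : Measure Ω} [IsProbabilityMeasure P]
    {δ D : ℝ} (hδ : 0 < δ) {ι : Type*} {b : ι → Ω → ℂ} (hb : ∀ i, SG P δ D (b i))
    (hind : iIndepFun b P)
    {V : Type*} [NormedAddCommGroup V] [InnerProductSpace ℂ V] (c : ι → V) (F : Finset ι)
    (hvar : ∀ i ∈ F, ∫ ω, ‖b i ω‖ ^ 2 ∂P = 1) :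
    MemLp (fun ω => ‖∑ l ∈ F, b l ω • c l‖ ^ 2 - ∑ l ∈ F, ‖c l‖ ^ 2) 2 P ∧
    ∫ ω, (‖∑ l ∈ F, b l ω • c l‖ ^ 2 - ∑ l ∈ F, ‖c l‖ ^ 2) ^ 2 ∂P ≤
      (4 * D / δ ^ 2 + 4) * ∑ l ∈ F, ∑ m ∈ F, ‖inner ℂ (c l) (c m)‖ ^ 2 := by
  classical
  induction F using Finset.induction_on with
  | empty => simp
  | insert n F hn ih =>
    have hvn := hvar n (Finset.mem_insert_self _ _)
    have hvF : ∀ i ∈ F, ∫ ω, ‖b i ω‖ ^ 2 ∂P = 1 := fun i hi => hvar i (Finset.mem_insert_of_mem hi)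
    obtain ⟨ihL, ihI⟩ := ih hvF
    set Z : Ω → ℝ := fun ω => ‖∑ l ∈ F, b l ω • c l‖ ^ 2 - ∑ l ∈ F, ‖c l‖ ^ 2 with hZ
    set ρ : Ω → ℂ := fun ω => ∑ l ∈ F, inner ℂ (c n) (c l) * b l ω with hρ
    set U : Ω → ℝ := fun ω => ‖c n‖ ^ 2 * (‖b n ω‖ ^ 2 - 1) with hU
    set W : Ω → ℝ := fun ω => 2 * (b n ω * (starRingEnd ℂ) (ρ ω)).re with hW
    have hexp : ∀ ω, ‖∑ l ∈ insert n F, b l ω • c l‖ ^ 2 - ∑ l ∈ insert n F, ‖c l‖ ^ 2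
        = Z ω + (U ω + W ω) := by
      intro ω
      rw [Finset.sum_insert hn, Finset.sum_insert hn, @norm_add_sq ℂ, norm_smul, inner_smul_left,
        inner_sum]
      have : RCLike.re ((starRingEnd ℂ) (b n ω) * ∑ l ∈ F, inner ℂ (c n) (b l ω • c l)) =
          (b n ω * (starRingEnd ℂ) (ρ ω)).re := by
        have h1 : (∑ l ∈ F, inner ℂ (c n) (b l ω • c l)) = ρ ω := by
          simp only [hρ, inner_smul_right]
          exact Finset.sum_congr rfl fun l _ => mul_comm _ _
        rw [h1]
        simp
      rw [this]
      simp only [hZ, hU, hW]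
      ring
    have hρL : MemLp ρ 4 P := memLp_finsetSum _ fun l _ => ((hb l).memLp4 hδ).const_mul _
    have hρL' : MemLp (fun ω => (starRingEnd ℂ) (ρ ω)) 4 P := hρL.star
    have hbρ : MemLp (fun ω => b n ω * (starRingEnd ℂ) (ρ ω)) 2 P :=
      hρL'.mul (r := 2) ((hb n).memLp4 hδ)
    have hWL : MemLp W 2 P := hbρ.re.const_mul 2
    have hb2 : MemLp (fun ω => ‖b n ω‖ ^ 2) 2 P := by
      have := ((hb n).memLp4 hδ).norm.mul (r := 2) ((hb n).memLp4 hδ).norm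
      refine this.congr_norm ?_ ?_
      · exact ((hb n).meas.norm.pow_const 2).aestronglyMeasurable
      · exact Filter.Eventually.of_forall fun ω => by simp [sq]
    have hUL : MemLp U 2 P := (hb2.sub (memLp_const 1)).const_mul _
    have hL : MemLp (fun ω => Z ω + (U ω + W ω)) 2 P := ihL.add (hUL.add hWL)
    simp_rw [hexp]
    refine ⟨hL, ?_⟩
    -- independence
    have hindF : IndepFun (fun ω (i : F) => b i ω) (b n) P := by
      have h := hind.indepFun_finset F {n} (by simpa using hn) (fun i => (hb i).meas)
      exact h.comp (φ := id) (ψ := fun v : ({n} : Finset ι) → ℂ => v ⟨n, by simp⟩) measurable_id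
        (measurable_pi_apply _)
    have hcross : ∀ (g : (F → ℂ) → ℂ) (k : ℂ → ℂ), Measurable g → Measurable k →
        ∫ ω, g (fun i : F => b i ω) * k (b n ω) ∂P =
          (∫ ω, g (fun i : F => b i ω) ∂P) * ∫ ω, k (b n ω) ∂P := by
      intro g k hg hk
      have h := hindF.comp hg hk
      exact h.integral_fun_mul_eq_mul_integral
        (hg.comp (measurable_pi_lambda _ fun i => (hb i).meas)).aestronglyMeasurable
        (hk.comp (hb n).meas).aestronglyMeasurable
    let ρ' : (F → ℂ) → ℂ := fun v => ∑ l : F, inner ℂ (c n) (c l) * v l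
    have hρ' : ∀ ω, ρ ω = ρ' (fun i => b i ω) := fun ω => by
      simp only [hρ, ρ']
      rw [← Finset.sum_coe_sort]
    let Z' : (F → ℂ) → ℝ := fun v => ‖∑ l : F, v l • c l‖ ^ 2 - ∑ l ∈ F, ‖c l‖ ^ 2
    have hZ' : ∀ ω, Z ω = Z' (fun i => b i ω) := fun ω => by
      simp only [hZ, Z']
      rw [← Finset.sum_coe_sort F (fun l => b l ω • c l)]
    have hρ'm : Measurable ρ' := by
      refine Continuous.measurable ?_
      fun_prop
    have hZ'm : Measurable Z' := by
      refine Continuous.measurable ?_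
      fun_prop
    have hZU : ∫ ω, Z ω * U ω ∂P = 0 := by
      have h := hcross (fun v => (Z' v : ℂ)) (fun z => ((‖c n‖ ^ 2 * (‖z‖ ^ 2 - 1) : ℝ) : ℂ))
        (by fun_prop) (by fun_prop)
      have h2 : ∫ ω, ((‖c n‖ ^ 2 * (‖b n ω‖ ^ 2 - 1) : ℝ) : ℂ) ∂P = 0 := by
        rw [integral_complex_ofReal, integral_const_mul, integral_sub (hb2.integrable (by norm_num))
          (integrable_const _), hvn]
        simp
      rw [h2, mul_zero] at h
      have h3 : ∫ ω, ((Z ω * U ω : ℝ) : ℂ) ∂P = 0 := by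
        rw [← h]
        refine integral_congr_ae (Filter.Eventually.of_forall fun ω => ?_)
        simp only [hZ' ω, hU]; push_cast; ring
      rw [integral_complex_ofReal] at h3
      exact_mod_cast h3
    have hZW : ∫ ω, Z ω * W ω ∂P = 0 := by
      have h := hcross (fun v => (Z' v : ℂ) * (starRingEnd ℂ) (ρ' v)) (fun z => z)
        ((Complex.measurable_ofReal.comp hZ'm).mul (Complex.continuous_conj.measurable.comp hρ'm))
          measurable_id
      rw [(hb n).mean, mul_zero] at h
      have hi : Integrable (fun ω => (Z ω : ℂ) * (b n ω * (starRingEnd ℂ) (ρ ω))) P :=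
        ihL.ofReal.integrable_mul hbρ
      have h3 : ∫ ω, (Z ω : ℂ) * (b n ω * (starRingEnd ℂ) (ρ ω)) ∂P = 0 := by
        rw [← h]
        refine integral_congr_ae (Filter.Eventually.of_forall fun ω => ?_)
        simp only [hZ' ω, hρ' ω]; ring
      have h4 : ∫ ω, Z ω * W ω ∂P = 2 * ∫ ω, ((Z ω : ℂ) * (b n ω * (starRingEnd ℂ) (ρ ω))).re ∂P := by
        rw [← integral_const_mul]
        refine integral_congr_ae (Filter.Eventually.of_forall fun ω => ?_)
        simp only [hW, Complex.re_ofReal_mul]; ring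
      have h5 := integral_re hi
      simp only [RCLike.re_to_complex] at h5
      rw [h4, h5, h3]; simp
    have hU2 : ∫ ω, U ω ^ 2 ∂P ≤ ‖c n‖ ^ 4 * (2 * D / δ ^ 2) := by
      calc ∫ ω, U ω ^ 2 ∂P ≤ ∫ ω, ‖c n‖ ^ 4 * (‖b n ω‖ ^ 4 - 2 * ‖b n ω‖ ^ 2 + 1) ∂P := by
            refine le_of_eq (integral_congr_ae (Filter.Eventually.of_forall fun ω => ?_))
            simp only [hU]; ring
        _ = ‖c n‖ ^ 4 * ((∫ ω, ‖b n ω‖ ^ 4 ∂P) - 1) := by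
            rw [integral_const_mul, integral_add, integral_sub ((hb n).int4 hδ), integral_const_mul,
              hvn]
            · simp; left; ring
            · exact (hb2.integrable (by norm_num)).const_mul 2
            · exact ((hb n).int4 hδ).sub ((hb2.integrable (by norm_num)).const_mul 2)
            · exact integrable_const _
        _ ≤ _ := by
            gcongr
            linarith [(hb n).le4 hδ]
    have hW2 : ∫ ω, W ω ^ 2 ∂P ≤ 4 * ∑ l ∈ F, ‖inner ℂ (c n) (c l)‖ ^ 2 := by
      have h := hcross (fun v => ((‖ρ' v‖ ^ 2 : ℝ) : ℂ)) (fun z => ((‖z‖ ^ 2 : ℝ) : ℂ))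
        (by fun_prop) (by fun_prop)
      rw [integral_complex_ofReal, integral_complex_ofReal, hvn] at h
      have h3 : ∫ ω, ‖b n ω * (starRingEnd ℂ) (ρ ω)‖ ^ 2 ∂P = ∑ l ∈ F, ‖inner ℂ (c n) (c l)‖ ^ 2 := by
        rw [← var_sum hδ hb hind F hvF (fun l => inner ℂ (c n) (c l))]
        have h4 : ∫ ω, ((‖b n ω * (starRingEnd ℂ) (ρ ω)‖ ^ 2 : ℝ) : ℂ) ∂P =
            ((∫ ω, ‖ρ ω‖ ^ 2 ∂P : ℝ) : ℂ) := by
          simp only [hρ' ]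
          rw [mul_comm] at h
          simp only [Complex.ofReal_one, one_mul] at h
          rw [← h]
          refine integral_congr_ae (Filter.Eventually.of_forall fun ω => ?_)
          simp only [norm_mul, RCLike.norm_conj]; push_cast; ring
        rw [integral_complex_ofReal] at h4
        exact_mod_cast h4
      rw [← h3, ← integral_const_mul]
      refine integral_mono hWL.integrable_sq ?_ fun ω => ?_
      · exact (hbρ.integrable_norm_pow (by norm_num)).const_mul 4
      · simp only [hW]
        have := Complex.abs_re_le_norm (b n ω * (starRingEnd ℂ) (ρ ω))
        have h6 := sq_le_sq' (by linarith [abs_nonneg (b n ω * (starRingEnd ℂ) (ρ ω)).re, norm_nonneg (b n ω * (starRingEnd ℂ) (ρ ω))]) this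
        rw [sq_abs] at h6
        nlinarith
    have hUW : ∫ ω, (U ω + W ω) ^ 2 ∂P ≤ 2 * (∫ ω, U ω ^ 2 ∂P) + 2 * ∫ ω, W ω ^ 2 ∂P := by
      rw [← integral_const_mul, ← integral_const_mul, ← integral_add (hUL.integrable_sq.const_mul 2)
        (hWL.integrable_sq.const_mul 2)]
      refine integral_mono (hUL.add hWL).integrable_sq ((hUL.integrable_sq.const_mul 2).add
        (hWL.integrable_sq.const_mul 2)) fun ω => ?_
      nlinarith [sq_nonneg (U ω - W ω)]
    have hZUi : Integrable (fun ω => Z ω * U ω) P := ihL.integrable_mul hUL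
    have hZWi : Integrable (fun ω => Z ω * W ω) P := ihL.integrable_mul hWL
    have htot : ∫ ω, (Z ω + (U ω + W ω)) ^ 2 ∂P =
        ∫ ω, Z ω ^ 2 ∂P + ∫ ω, (U ω + W ω) ^ 2 ∂P := by
      have : ∀ ω, (Z ω + (U ω + W ω)) ^ 2 =
          (Z ω ^ 2 + (U ω + W ω) ^ 2) + (2 * (Z ω * U ω) + 2 * (Z ω * W ω)) := fun ω => by ring
      simp_rw [this]
      have hUWi : Integrable (fun ω => (U ω + W ω) ^ 2) P := (hUL.add hWL).integrable_sq
      rw [integral_add, integral_add ihL.integrable_sq hUWi,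
        integral_add (hZUi.const_mul 2) (hZWi.const_mul 2), integral_const_mul, integral_const_mul,
        hZU, hZW]
      · simp
      · exact ihL.integrable_sq.add hUWi
      · exact (hZUi.const_mul 2).add (hZWi.const_mul 2)
    have hsum : ∑ l ∈ insert n F, ∑ m ∈ insert n F, ‖inner ℂ (c l) (c m)‖ ^ 2 =
        ∑ l ∈ F, ∑ m ∈ F, ‖inner ℂ (c l) (c m)‖ ^ 2 + ‖c n‖ ^ 4 +
          2 * ∑ l ∈ F, ‖inner ℂ (c n) (c l)‖ ^ 2 := by
      rw [Finset.sum_insert hn, Finset.sum_insert hn]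
      simp_rw [Finset.sum_insert hn, Finset.sum_add_distrib]
      have h1 : ‖inner ℂ (c n) (c n)‖ = ‖c n‖ ^ 2 := by
        rw [inner_self_eq_norm_sq_to_K]; simp
      have h2 : ∑ l ∈ F, ‖inner ℂ (c l) (c n)‖ ^ 2 = ∑ l ∈ F, ‖inner ℂ (c n) (c l)‖ ^ 2 :=
        Finset.sum_congr rfl fun l _ => by rw [norm_inner_symm]
      rw [h1, h2]; ring
    rw [htot, hsum]
    have hD : 0 ≤ 2 * D / δ ^ 2 :=
      le_trans (integral_nonneg fun ω => by positivity) ((hb n).le4 hδ)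
    have hs : 0 ≤ ∑ l ∈ F, ‖inner ℂ (c n) (c l)‖ ^ 2 := Finset.sum_nonneg fun l _ => by positivity
    have h4 : 0 ≤ ‖c n‖ ^ 4 := by positivity
    have e1 : 4 * D / δ ^ 2 = 2 * (2 * D / δ ^ 2) := by ring
    rw [e1] at ihI ⊢
    nlinarith [mul_nonneg hD hs]

open scoped Classical in
/-- merge two configurations -/
def mrg {T : Type*} (𝒜 : Set T) (x x' : T → ℂ) : T → ℂ := fun t => if t ∈ 𝒜 then x t else x' t

lemma mrg_meas {T : Type*} (𝒜 : Set T) :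
    Measurable (fun q : (T → ℂ) × (T → ℂ) => mrg 𝒜 q.1 q.2) := by
  refine measurable_pi_lambda _ fun t => ?_
  unfold mrg
  by_cases h : t ∈ 𝒜 <;> simp only [h, if_true, if_false] <;> fun_prop

lemma mrg_map {T : Type*} [Fintype T] (𝒜 : Set T) (m : T → Measure ℂ)
    [∀ t, IsProbabilityMeasure (m t)] :
    ((Measure.pi m).prod (Measure.pi m)).map (fun q => mrg 𝒜 q.1 q.2) = Measure.pi m := by
  classical
  refine (Measure.pi_eq fun s hs => ?_).symm
  rw [Measure.map_apply (mrg_meas 𝒜) (MeasurableSet.univ_pi hs)]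
  have : (fun q : (T → ℂ) × (T → ℂ) => mrg 𝒜 q.1 q.2) ⁻¹' (Set.univ.pi s) =
      (Set.univ.pi fun t => if t ∈ 𝒜 then s t else Set.univ) ×ˢ
      (Set.univ.pi fun t => if t ∈ 𝒜 then Set.univ else s t) := by
    ext q
    simp only [Set.mem_preimage, Set.mem_pi, Set.mem_univ, true_implies, Set.mem_prod, mrg]
    constructor
    · intro h
      refine ⟨fun t => ?_, fun t => ?_⟩
      · have := h t
        split_ifs with h1
        · simpa [h1] using this
        · trivial
      · have := h t
        split_ifs with h1
        · trivial
        · simpa [h1] using this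
    · rintro ⟨h1, h2⟩ t
      have a := h1 t
      have b := h2 t
      by_cases h : t ∈ 𝒜
      · simpa [h] using a
      · simpa [h] using b
  rw [this, Measure.prod_prod, Measure.pi_pi, Measure.pi_pi, ← Finset.prod_mul_distrib]
  refine Finset.prod_congr rfl fun t _ => ?_
  by_cases h : t ∈ 𝒜 <;> simp [h]

lemma resample {T : Type*} [Fintype T] (𝒜 : Set T) (m : T → Measure ℂ)
    [∀ t, IsProbabilityMeasure (m t)] (B F : Set (T → ℂ)) (hB : MeasurableSet B)
    (hF : MeasurableSet F) (hdep : ∀ x x', (∀ t ∈ 𝒜, x t = x' t) → x ∈ B → x' ∈ B) (c : ℝ≥0∞)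
    (hc : ∀ x ∈ B, Measure.pi m {x' | mrg 𝒜 x x' ∈ F} ≤ c) :
    Measure.pi m (B ∩ F) ≤ c * Measure.pi m B := by
  conv_lhs => rw [← mrg_map 𝒜 m]
  rw [Measure.map_apply (mrg_meas 𝒜) (hB.inter hF),
    Measure.prod_apply (mrg_meas 𝒜 (hB.inter hF))]
  calc _ ≤ ∫⁻ x, B.indicator (fun _ => c) x ∂(Measure.pi m) := by
        refine lintegral_mono fun x => ?_
        by_cases hx : x ∈ B
        · rw [Set.indicator_of_mem hx]
          refine le_trans (measure_mono ?_) (hc x hx)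
          intro x' h
          exact h.2
        · rw [Set.indicator_of_notMem hx]
          refine le_of_eq ?_
          convert measure_empty (μ := Measure.pi m)
          ext x'
          simp only [Set.mem_preimage, Set.mem_inter_iff, Set.mem_empty_iff_false, iff_false, not_and]
          intro h
          exact absurd (hdep _ _ (fun t ht => by simp [mrg, ht]) h) hx
    _ = _ := by rw [lintegral_indicator hB]; simp

lemma lintegral_mul_dep {T : Type*} [Fintype T] (𝒜 : Set T) (m : T → Measure ℂ)
    [∀ t, IsProbabilityMeasure (m t)] (f g : (T → ℂ) → ℝ≥0∞) (hf : Measurable f)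
    (hg : Measurable g) (hfd : ∀ x x', (∀ t ∈ 𝒜, x t = x' t) → f x = f x')
    (hgd : ∀ x x', (∀ t ∉ 𝒜, x t = x' t) → g x = g x') :
    ∫⁻ x, f x * g x ∂(Measure.pi m) = (∫⁻ x, f x ∂(Measure.pi m)) * ∫⁻ x, g x ∂(Measure.pi m) := by
  conv_lhs => rw [← mrg_map 𝒜 m]
  rw [lintegral_map (f := fun x => f x * g x) (hf.mul hg) (mrg_meas 𝒜), ← lintegral_prod_mul hf.aemeasurable hg.aemeasurable]
  refine lintegral_congr fun q => ?_
  rw [hfd (mrg 𝒜 q.1 q.2) q.1 fun t ht => by simp [mrg, ht],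
    hgd (mrg 𝒜 q.1 q.2) q.2 fun t ht => by simp [mrg, ht]]

/-- Chebyshev: projections of a random vector on an `r`-dimensional space. -/
lemma proj_small {Ω : Type*} [MeasurableSpace Ω] {P : Measure Ω} [IsProbabilityMeasure P]
    {δ D : ℝ} (hδ : 0 < δ) {ι : Type*} {b : ι → Ω → ℂ} (hb : ∀ i, SG P δ D (b i))
    (hind : iIndepFun b P) (F : Finset ι) (hvar : ∀ i ∈ F, ∫ ω, ‖b i ω‖ ^ 2 ∂P = 1)
    (r : ℕ) (hr : 0 < r) (w : Fin r → ι → ℂ)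
    (hw : ∀ a c, ∑ i ∈ F, w a i * (starRingEnd ℂ) (w c i) = if a = c then 1 else 0) :
    P {ω | ∑ a, ‖∑ i ∈ F, (starRingEnd ℂ) (w a i) * b i ω‖ ^ 2 ≤ r / 2} ≤
      ENNReal.ofReal (4 * (4 * D / δ ^ 2 + 4) / r) := by
  classical
  let c : ι → EuclideanSpace ℂ (Fin r) := fun i => WithLp.toLp 2 fun a => (starRingEnd ℂ) (w a i)
  obtain ⟨hL, hI⟩ := quad_var hδ hb hind c F hvar
  have e1 : ∀ ω, ‖∑ l ∈ F, b l ω • c l‖ ^ 2 =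
      ∑ a, ‖∑ i ∈ F, (starRingEnd ℂ) (w a i) * b i ω‖ ^ 2 := by
    intro ω
    rw [EuclideanSpace.norm_sq_eq]
    refine Finset.sum_congr rfl fun a _ => ?_
    congr 2
    simp [c, mul_comm]
  have e2 : ∑ l ∈ F, ‖c l‖ ^ 2 = r := by
    simp_rw [EuclideanSpace.norm_sq_eq, c]
    rw [Finset.sum_comm]
    have : ∀ a, ∑ i ∈ F, ‖(starRingEnd ℂ) (w a i)‖ ^ 2 = 1 := by
      intro a
      have := hw a a
      simp only [Complex.mul_conj, Complex.normSq_eq_norm_sq, if_true] at this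
      simp only [RCLike.norm_conj]
      exact_mod_cast this
    rw [Finset.sum_congr rfl fun a _ => this a]; simp
  have e3 : ∑ l ∈ F, ∑ m ∈ F, ‖inner ℂ (c l) (c m)‖ ^ 2 = r := by
    have h1 : ∀ l m, ((‖inner ℂ (c l) (c m)‖ ^ 2 : ℝ) : ℂ) = ∑ a, ∑ a',
        (w a l * (starRingEnd ℂ) (w a' l)) * (w a' m * (starRingEnd ℂ) (w a m)) := by
      intro l m
      rw [← Complex.normSq_eq_norm_sq, ← Complex.mul_conj]
      simp only [c, PiLp.inner_apply, RCLike.inner_apply, map_sum, map_mul, Complex.conj_conj]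
      rw [Finset.sum_mul_sum]
      refine Finset.sum_congr rfl fun a _ => Finset.sum_congr rfl fun a' _ => ?_
      ring
    have h2 : ((∑ l ∈ F, ∑ m ∈ F, ‖inner ℂ (c l) (c m)‖ ^ 2 : ℝ) : ℂ) = (r : ℝ) := by
      push_cast at h1 ⊢
      simp_rw [h1]
      have : ∀ l ∈ F, ∑ m ∈ F, ∑ a, ∑ a',
          (w a l * (starRingEnd ℂ) (w a' l)) * (w a' m * (starRingEnd ℂ) (w a m)) =
          ∑ a, (w a l * (starRingEnd ℂ) (w a l)) := by
        intro l hl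
        rw [Finset.sum_comm]
        refine Finset.sum_congr rfl fun a _ => ?_
        rw [Finset.sum_comm]
        simp_rw [← Finset.mul_sum, hw]
        simp
      rw [Finset.sum_congr rfl this, Finset.sum_comm]
      simp [hw]
    exact_mod_cast h2
  simp_rw [e1] at hL hI
  rw [e2, e3] at hI
  rw [e2] at hL
  set Z : Ω → ℝ := fun ω => ∑ a, ‖∑ i ∈ F, (starRingEnd ℂ) (w a i) * b i ω‖ ^ 2 - r with hZ
  have hr' : (0 : ℝ) < r := by exact_mod_cast hr
  have hM := mul_meas_ge_le_integral_of_nonneg (μ := P) (f := fun ω => Z ω ^ 2)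
    (Filter.Eventually.of_forall fun ω => sq_nonneg _) hL.integrable_sq ((r : ℝ) ^ 2 / 4)
  have hsub : {ω | ∑ a, ‖∑ i ∈ F, (starRingEnd ℂ) (w a i) * b i ω‖ ^ 2 ≤ r / 2} ⊆
      {ω | (r : ℝ) ^ 2 / 4 ≤ Z ω ^ 2} := by
    intro ω h
    simp only [Set.mem_ofPred_eq] at h ⊢
    have : Z ω ≤ - (r / 2) := by simp only [hZ]; linarith
    nlinarith
  refine le_trans (measure_mono hsub) ?_
  rw [← ENNReal.ofReal_toReal (measure_ne_top P {ω | (r : ℝ) ^ 2 / 4 ≤ Z ω ^ 2})]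
  refine ENNReal.ofReal_le_ofReal ?_
  rw [le_div_iff₀ hr']
  have h5 := hM.trans hI
  change (r : ℝ) ^ 2 / 4 * (P {ω | (r : ℝ) ^ 2 / 4 ≤ Z ω ^ 2}).toReal ≤ _ at h5
  have h6 : (P {ω | (r : ℝ) ^ 2 / 4 ≤ Z ω ^ 2}).toReal * r * r ≤ 4 * (4 * D / δ ^ 2 + 4) * r := by
    nlinarith
  exact le_of_mul_le_mul_right h6 hr'

/-- index set of independent entries -/
abbrev TI (N : ℕ) : Type := {p : Fin N × Fin N // p.1 ≤ p.2}

/-- the position -/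
def tidx {N : ℕ} (i j : Fin N) : TI N :=
  if h : i ≤ j then ⟨(i, j), h⟩ else ⟨(j, i), (not_le.mp h).le⟩

/-- the entry map -/
def ephi {N : ℕ} (i j : Fin N) (z : ℂ) : ℂ :=
  if i < j then z else if j < i then (starRingEnd ℂ) z else (z.re : ℂ)

/-- matrix entries from coordinates -/
def ent {N : ℕ} (x : TI N → ℂ) (i j : Fin N) : ℂ := ephi i j (x (tidx i j))

lemma tidx_comm {N : ℕ} (i j : Fin N) : tidx i j = tidx j i := by
  unfold tidx
  rcases lt_trichotomy i j with h | h | h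
  · simp [h.le, h]
  · subst h; rfl
  · simp [h.le, h.not_ge]

lemma tidx_eq {N : ℕ} {i j k l : Fin N} (h : tidx i j = tidx k l) :
    (i = k ∧ j = l) ∨ (i = l ∧ j = k) := by
  unfold tidx at h
  split_ifs at h <;> simp only [Subtype.mk.injEq, Prod.mk.injEq] at h <;> tauto

lemma tidx_val {N : ℕ} (i j : Fin N) :
    ((tidx i j).1.1 = i ∧ (tidx i j).1.2 = j) ∨ ((tidx i j).1.1 = j ∧ (tidx i j).1.2 = i) := by
  unfold tidx
  split_ifs <;> simp

lemma ephi_cont {N : ℕ} (i j : Fin N) : Continuous (ephi i j) := by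
  unfold ephi
  split_ifs
  · exact continuous_id
  · exact Complex.continuous_conj
  · exact Complex.continuous_ofReal.comp Complex.continuous_re

lemma ephi_norm_le {N : ℕ} (i j : Fin N) (z : ℂ) : ‖ephi i j z‖ ≤ ‖z‖ := by
  unfold ephi
  split_ifs
  · exact le_rfl
  · simp
  · rw [Complex.norm_real]; exact Complex.abs_re_le_norm z

lemma ephi_norm_eq {N : ℕ} {i j : Fin N} (h : i ≠ j) (z : ℂ) : ‖ephi i j z‖ = ‖z‖ := by
  unfold ephi
  split_ifs with h1 h2
  · rfl
  · simp
  · exact absurd (le_antisymm (not_lt.mp h2) (not_lt.mp h1)) h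

lemma ent_conj {N : ℕ} (x : TI N → ℂ) (i j : Fin N) :
    (starRingEnd ℂ) (ent x i j) = ent x j i := by
  unfold ent
  rw [tidx_comm j i]
  unfold ephi
  rcases lt_trichotomy i j with h | h | h
  · simp [h, h.not_gt]
  · subst h; simp
  · simp [h, h.not_gt]

lemma ent_cont {N : ℕ} (i j : Fin N) : Continuous (fun x : TI N → ℂ => ent x i j) :=
  (ephi_cont i j).comp (continuous_apply _)

/-- assumptions on the coordinate laws -/
structure GoodM {N : ℕ} (m : TI N → Measure ℂ) (δ D : ℝ) : Prop where
  prob : ∀ t, IsProbabilityMeasure (m t)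
  int : ∀ t, Integrable (fun z => Real.exp (δ * ‖z‖ ^ 2)) (m t)
  le : ∀ t, ∫ z, Real.exp (δ * ‖z‖ ^ 2) ∂(m t) ≤ D
  mean : ∀ t, ∫ z, z ∂(m t) = 0
  var : ∀ t, t.1.1 ≠ t.1.2 → ∫ z, ‖z‖ ^ 2 ∂(m t) = 1

lemma GoodM.sg {N : ℕ} {m : TI N → Measure ℂ} {δ D : ℝ} (hm : GoodM m δ D) (hδ : 0 < δ)
    (i j : Fin N) : SG (Measure.pi m) δ D (fun x => ent x i j) := by
  have := hm.prob
  have hmp := measurePreserving_eval m (tidx i j)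
  have hid : SG (m (tidx i j)) δ D (fun z => z) :=
    ⟨measurable_id, hm.int _, hm.le _, hm.mean _⟩
  have hle : ∀ z, Real.exp (δ * ‖ephi i j z‖ ^ 2) ≤ Real.exp (δ * ‖z‖ ^ 2) := fun z => by
    have := ephi_norm_le i j z
    gcongr
  have hmeas : Measurable (ephi i j) := (ephi_cont i j).measurable
  have hint : Integrable (fun z => Real.exp (δ * ‖ephi i j z‖ ^ 2)) (m (tidx i j)) := by
    refine (hm.int _).mono' ?_ (Filter.Eventually.of_forall fun z => ?_)
    · exact (by fun_prop : Measurable fun z => Real.exp (δ * ‖ephi i j z‖ ^ 2)).aestronglyMeasurable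
    · rw [Real.norm_of_nonneg (Real.exp_nonneg _)]; exact hle z
  refine ⟨(ent_cont i j).measurable, ?_, ?_, ?_⟩
  · exact hmp.integrable_comp_of_integrable hint
  · have := integral_map (μ := Measure.pi m) hmp.measurable.aemeasurable
      (f := fun z => Real.exp (δ * ‖ephi i j z‖ ^ 2)) (by rw [hmp.map_eq]; exact hint.1)
    rw [hmp.map_eq] at this
    refine le_trans (le_of_eq this.symm) ?_
    exact le_trans (integral_mono hint (hm.int _) hle) (hm.le _)
  · have := integral_map (μ := Measure.pi m) hmp.measurable.aemeasurable
      (f := fun z => ephi i j z) hmeas.aestronglyMeasurable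
    rw [hmp.map_eq] at this
    refine this.symm.trans ?_
    have h0 := hm.mean (tidx i j)
    have hI := hid.integrable hδ
    unfold ephi
    split_ifs
    · exact h0
    · rw [integral_conj, h0]; simp
    · rw [integral_complex_ofReal]
      have := integral_re hI
      simp only [RCLike.re_to_complex] at this
      rw [this, h0]; simp

lemma GoodM.var' {N : ℕ} {m : TI N → Measure ℂ} {δ D : ℝ} (hm : GoodM m δ D)
    {i j : Fin N} (hij : i ≠ j) : ∫ x, ‖ent x i j‖ ^ 2 ∂(Measure.pi m) = 1 := by
  have := hm.prob
  have hmp := measurePreserving_eval m (tidx i j)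
  have := integral_map (μ := Measure.pi m) hmp.measurable.aemeasurable
      (f := fun z => ‖ephi i j z‖ ^ 2)
      (((ephi_cont i j).measurable.norm.pow_const 2).aestronglyMeasurable)
  rw [hmp.map_eq] at this
  refine this.symm.trans ?_
  simp_rw [ephi_norm_eq hij]
  refine hm.var _ ?_
  rcases tidx_val i j with h | h <;> rw [h.1, h.2]
  · exact hij
  · exact hij.symm

lemma GoodM.indep {N : ℕ} {m : TI N → Measure ℂ} {δ D : ℝ} (hm : GoodM m δ D)
    {ι : Type*} (f g : ι → Fin N) (hinj : Function.Injective fun a => tidx (f a) (g a)) :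
    iIndepFun (fun a x => ent x (f a) (g a)) (Measure.pi m) := by
  have := hm.prob
  have h : iIndepFun (fun (t : TI N) (x : TI N → ℂ) => x t) (Measure.pi m) :=
    iIndepFun_pi (X := fun _ z => z) (fun _ => aemeasurable_id)
  have h2 := h.precomp hinj
  exact h2.comp (fun a z => ephi (f a) (g a) z) (fun a => (ephi_cont _ _).measurable)

lemma GoodM.indep_col {N : ℕ} {m : TI N → Measure ℂ} {δ D : ℝ} (hm : GoodM m δ D) (k : Fin N) :
    iIndepFun (fun i x => ent x i k) (Measure.pi m) := by
  refine hm.indep (fun i => i) (fun _ => k) fun i j h => ?_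
  rcases tidx_eq h with h | h
  · exact h.1
  · exact h.1.trans h.2

lemma GoodM.indep_row {N : ℕ} {m : TI N → Measure ℂ} {δ D : ℝ} (hm : GoodM m δ D) (k : Fin N) :
    iIndepFun (fun i x => ent x k i) (Measure.pi m) := by
  refine hm.indep (fun _ => k) (fun i => i) fun i j h => ?_
  rcases tidx_eq h with h | h
  · exact h.2
  · exact h.2.trans h.1

/-- the shifted matrix -/
def Amat {N : ℕ} (E : ℝ) (x : TI N → ℂ) (i j : Fin N) : ℂ :=
  ent x i j / (Real.sqrt N : ℂ) - if i = j then (E : ℂ) else 0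

lemma Amat_conj {N : ℕ} (E : ℝ) (x : TI N → ℂ) (i j : Fin N) :
    (starRingEnd ℂ) (Amat E x i j) = Amat E x j i := by
  unfold Amat
  rw [map_sub, map_div₀, ent_conj]
  by_cases h : i = j
  · simp [h]
  · simp [h, Ne.symm h]

lemma Amat_cont {N : ℕ} (E : ℝ) (i j : Fin N) : Continuous (fun x : TI N → ℂ => Amat E x i j) := by
  unfold Amat
  exact ((ent_cont i j).div_const _).sub continuous_const

lemma cs_sum {ι : Type*} (S : Finset ι) (a b : ι → ℂ) :
    ‖∑ i ∈ S, a i * b i‖ ^ 2 ≤ (∑ i ∈ S, ‖a i‖ ^ 2) * ∑ i ∈ S, ‖b i‖ ^ 2 := by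
  refine le_trans ?_ (Finset.sum_mul_sq_le_sq_mul_sq S (fun i => ‖a i‖) (fun i => ‖b i‖))
  gcongr
  refine (norm_sum_le _ _).trans (le_of_eq ?_)
  simp

/-- orthonormal system (rows) -/
def ON {N K : ℕ} (w : Fin K → Fin N → ℂ) : Prop :=
  ∀ a c, ∑ i, w a i * (starRingEnd ℂ) (w c i) = if a = c then 1 else 0

lemma ON.comb {N K : ℕ} {w : Fin K → Fin N → ℂ} (hw : ON w) (c d : Fin K → ℂ) :
    ∑ i, (∑ a, c a * w a i) * (starRingEnd ℂ) (∑ a, d a * w a i) =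
      ∑ a, c a * (starRingEnd ℂ) (d a) := by
  have : ∀ i, (∑ a, c a * w a i) * (starRingEnd ℂ) (∑ a, d a * w a i) =
      ∑ a, ∑ b, (c a * (starRingEnd ℂ) (d b)) * (w a i * (starRingEnd ℂ) (w b i)) := by
    intro i
    rw [map_sum, Finset.sum_mul_sum]
    refine Finset.sum_congr rfl fun a _ => Finset.sum_congr rfl fun b _ => ?_
    rw [map_mul]; ring
  simp_rw [this]
  rw [Finset.sum_comm]
  refine Finset.sum_congr rfl fun a _ => ?_
  rw [Finset.sum_comm]
  simp_rw [← Finset.mul_sum, hw a]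
  simp

lemma ON.norm_comb {N K : ℕ} {w : Fin K → Fin N → ℂ} (hw : ON w) (c : Fin K → ℂ) :
    ∑ i, ‖∑ a, c a * w a i‖ ^ 2 = ∑ a, ‖c a‖ ^ 2 := by
  have := hw.comb c c
  simp only [Complex.mul_conj, Complex.normSq_eq_norm_sq] at this
  exact_mod_cast this

lemma ON.norm_row {N K : ℕ} {w : Fin K → Fin N → ℂ} (hw : ON w) (a : Fin K) :
    ∑ i, ‖w a i‖ ^ 2 = 1 := by
  have := hw a a
  simp only [Complex.mul_conj, Complex.normSq_eq_norm_sq, if_true] at this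
  exact_mod_cast this

/-- witness of many approximate eigenvectors -/
def BadW {N K : ℕ} (A : Fin N → Fin N → ℂ) (τ : ℝ) (S : Finset (Fin N)) (w : Fin K → Fin N → ℂ) :
    Prop :=
  ON w ∧ (∀ a, ∀ i ∉ S, w a i = 0) ∧
    ∀ c : Fin K → ℂ, ∑ i ∈ S, ‖∑ j, A i j * ∑ a, c a * w a j‖ ^ 2 ≤ τ ^ 2 * ∑ a, ‖c a‖ ^ 2

/-- witness of an approximate eigenvector -/
def SmallW {N : ℕ} (A : Fin N → Fin N → ℂ) (τ θ : ℝ) (S : Finset (Fin N)) (k : Fin N)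
    (u : Fin N → ℂ) : Prop :=
  ∑ i, ‖u i‖ ^ 2 = 1 ∧ (∀ i ∉ S, u i = 0) ∧ θ ≤ ‖u k‖ ^ 2 ∧
    ∑ i ∈ S.erase k, ‖∑ j, A i j * u j‖ ^ 2 ≤ τ ^ 2

lemma det_bound {N r : ℕ} {A : Fin N → Fin N → ℂ} (hA : ∀ i j, (starRingEnd ℂ) (A i j) = A j i)
    {τ θ : ℝ} (hθ : 0 < θ) {S : Finset (Fin N)} {k : Fin N}
    {w : Fin r → Fin N → ℂ} (hw : BadW A τ (S.erase k) w) {u : Fin N → ℂ}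
    (hu : SmallW A τ θ S k u) :
    ∑ a, ‖∑ i, (starRingEnd ℂ) (w a i) * A i k‖ ^ 2 ≤ 4 * τ ^ 2 / θ := by
  obtain ⟨hON, hsupp, hBw⟩ := hw
  obtain ⟨hu1, husupp, huk, hAu⟩ := hu
  set t : Fin r → ℂ := fun a => ∑ i, (starRingEnd ℂ) (w a i) * A i k with ht
  set s2 : ℝ := ∑ a, ‖t a‖ ^ 2 with hs2
  set q : Fin N → ℂ := fun i => ∑ a, t a * w a i with hq
  have hs0 : 0 ≤ s2 := Finset.sum_nonneg fun a _ => by positivity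
  have hqsupp : ∀ i ∉ S.erase k, q i = 0 := fun i hi => by
    simp only [hq]
    exact Finset.sum_eq_zero fun a _ => by rw [hsupp a i hi, mul_zero]
  have hqn : ∑ i, ‖q i‖ ^ 2 = s2 := hON.norm_comb t
  have hqa : ∑ i, (starRingEnd ℂ) (q i) * A i k = s2 := by
    simp only [hq, map_sum, map_mul, Finset.sum_mul]
    rw [Finset.sum_comm]
    have : ∀ a, ∑ i, (starRingEnd ℂ) (t a) * (starRingEnd ℂ) (w a i) * A i k = (‖t a‖ ^ 2 : ℝ) := by
      intro a
      simp_rw [mul_assoc]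
      rw [← Finset.mul_sum]
      change (starRingEnd ℂ) (t a) * t a = _
      rw [mul_comm, Complex.mul_conj, Complex.normSq_eq_norm_sq]
    simp_rw [this]
    simp [hs2]
  have hsumS : ∀ f : Fin N → ℂ, ∑ i, (starRingEnd ℂ) (q i) * f i =
      ∑ i ∈ S.erase k, (starRingEnd ℂ) (q i) * f i := fun f => by
    refine (Finset.sum_subset (Finset.subset_univ _) fun i _ hi => ?_).symm
    rw [hqsupp i hi]; simp
  have hqn' : ∑ i ∈ S.erase k, ‖(starRingEnd ℂ) (q i)‖ ^ 2 ≤ s2 := by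
    rw [← hqn]
    simp only [RCLike.norm_conj]
    exact Finset.sum_le_sum_of_subset_of_nonneg (Finset.subset_univ _) fun i _ _ => by positivity
  -- I1
  have h1 : ‖∑ i, (starRingEnd ℂ) (q i) * ∑ j, A i j * u j‖ ^ 2 ≤ s2 * τ ^ 2 := by
    rw [hsumS]
    refine (cs_sum _ _ _).trans ?_
    gcongr
  -- I2
  set u' : Fin N → ℂ := fun j => if j = k then 0 else u j with hu'
  have hu'n : ∑ i ∈ S.erase k, ‖u' i‖ ^ 2 ≤ 1 := by
    rw [← hu1]
    refine (Finset.sum_le_sum_of_subset_of_nonneg (Finset.subset_univ _) fun i _ _ => by positivity).trans ?_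
    refine Finset.sum_le_sum fun i _ => ?_
    simp only [hu']
    split_ifs
    · simp
    · exact le_rfl
  have h2 : ‖∑ i, (starRingEnd ℂ) (q i) * ∑ j, A i j * u' j‖ ^ 2 ≤ s2 * τ ^ 2 := by
    have e : ∑ i, (starRingEnd ℂ) (q i) * ∑ j, A i j * u' j =
        ∑ j ∈ S.erase k, (starRingEnd ℂ) (∑ i, A j i * q i) * u' j := by
      have e1 : ∑ i, (starRingEnd ℂ) (q i) * ∑ j, A i j * u' j =
        ∑ j, (starRingEnd ℂ) (∑ i, A j i * q i) * u' j := by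
        simp_rw [Finset.mul_sum, map_sum, Finset.sum_mul, map_mul, hA]
        rw [Finset.sum_comm]
        refine Finset.sum_congr rfl fun i _ => Finset.sum_congr rfl fun j _ => ?_
        ring
      rw [e1]
      refine (Finset.sum_subset (Finset.subset_univ _) fun i _ hi => ?_).symm
      have : u' i = 0 := by
        simp only [hu']
        split_ifs with h
        · rfl
        · exact husupp i fun h' => hi (Finset.mem_erase.mpr ⟨h, h'⟩)
      rw [this, mul_zero]
    rw [e]
    refine (cs_sum _ _ _).trans ?_
    simp only [RCLike.norm_conj]
    have hB := hBw t
    calc _ ≤ (τ ^ 2 * s2) * 1 := by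
          gcongr
      _ = _ := by ring
  -- decomposition
  have hdec : ∑ i, (starRingEnd ℂ) (q i) * ∑ j, A i j * u j =
      ∑ i, (starRingEnd ℂ) (q i) * ∑ j, A i j * u' j + u k * s2 := by
    rw [← hqa, Finset.mul_sum, ← Finset.sum_add_distrib]
    refine Finset.sum_congr rfl fun i _ => ?_
    have : ∑ j, A i j * u j = ∑ j, A i j * u' j + A i k * u k := by
      have e : ∀ j, A i j * u j = A i j * u' j + if j = k then A i j * u j else 0 := fun j => by
        simp only [hu']; split_ifs <;> simp
      rw [Finset.sum_congr rfl fun j _ => e j, Finset.sum_add_distrib]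
      simp
    rw [this]; ring
  set X := ∑ i, (starRingEnd ℂ) (q i) * ∑ j, A i j * u j
  set Y := ∑ i, (starRingEnd ℂ) (q i) * ∑ j, A i j * u' j
  have hXY : ‖u k * s2‖ ≤ ‖X‖ + ‖Y‖ := by
    have : u k * s2 = X - Y := by rw [hdec]; ring
    rw [this]; exact norm_sub_le _ _
  have hsq : ‖u k * (s2 : ℂ)‖ ^ 2 ≤ 4 * (s2 * τ ^ 2) := by
    have := pow_le_pow_left₀ (norm_nonneg _) hXY 2
    nlinarith [sq_nonneg (‖X‖ - ‖Y‖)]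
  rw [norm_mul, mul_pow, Complex.norm_real, Real.norm_of_nonneg hs0] at hsq
  rw [le_div_iff₀ hθ]
  rcases hs0.eq_or_lt with h | h
  · rw [← h]; simp; positivity
  · have h3 : θ * s2 ^ 2 ≤ 4 * (s2 * τ ^ 2) := le_trans (by gcongr) hsq
    nlinarith

/-- events -/
def Bad {N : ℕ} (E τ : ℝ) (S : Finset (Fin N)) (K : ℕ) : Set (TI N → ℂ) :=
  {x | ∃ w : Fin K → Fin N → ℂ, BadW (Amat E x) τ S w}

/-- events -/
def SmallE {N : ℕ} (E τ θ : ℝ) (S : Finset (Fin N)) (k : Fin N) : Set (TI N → ℂ) :=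
  {x | ∃ u : Fin N → ℂ, SmallW (Amat E x) τ θ S k u}

lemma closed_proj {X Y : Type*} [TopologicalSpace X] [TopologicalSpace Y] {R : Set (X × Y)}
    (hR : IsClosed R) {C : Set Y} (hC : IsCompact C) (h : ∀ q ∈ R, q.2 ∈ C) :
    IsClosed {x | ∃ y, (x, y) ∈ R} := by
  have : CompactSpace C := isCompact_iff_compactSpace.mp hC
  have h1 : IsClosed ((fun q : X × C => ((q.1, (q.2 : Y)) : X × Y)) ⁻¹' R) :=
    hR.preimage (by fun_prop)
  have h2 := isClosedMap_fst_of_compactSpace _ h1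
  convert h2 using 1
  ext x
  simp only [Set.mem_ofPred_eq, Set.mem_image, Set.mem_preimage, Prod.exists]
  constructor
  · rintro ⟨y, hy⟩
    exact ⟨x, ⟨y, h _ hy⟩, hy, rfl⟩
  · rintro ⟨x', y, hy, rfl⟩
    exact ⟨y, hy⟩

lemma Bad_closed {N : ℕ} (E τ : ℝ) (S : Finset (Fin N)) (K : ℕ) : IsClosed (Bad E τ S K) := by
  refine closed_proj (R := {q : (TI N → ℂ) × (Fin K → Fin N → ℂ) | BadW (Amat E q.1) τ S q.2})
    (C := Metric.closedBall 0 1) ?_ (isCompact_closedBall _ _) ?_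
  · have hA : ∀ i j, Continuous fun q : (TI N → ℂ) × (Fin K → Fin N → ℂ) => Amat E q.1 i j :=
      fun i j => (Amat_cont E i j).comp continuous_fst
    have hwc : ∀ a i, Continuous fun q : (TI N → ℂ) × (Fin K → Fin N → ℂ) => q.2 a i :=
      fun a i => by fun_prop
    simp only [BadW, ON, Set.ofPred_and, Set.ofPred_forall]
    refine IsClosed.inter ?_ (IsClosed.inter ?_ ?_)
    · refine isClosed_iInter fun a => isClosed_iInter fun c => isClosed_eq ?_ continuous_const
      fun_prop
    · refine isClosed_iInter fun a => isClosed_iInter fun c => isClosed_iInter fun _ =>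
        isClosed_eq (hwc _ _) continuous_const
    · refine isClosed_iInter fun c => isClosed_le ?_ continuous_const
      fun_prop
  · rintro ⟨x, w⟩ h
    rw [mem_closedBall_zero_iff]
    refine (pi_norm_le_iff_of_nonneg zero_le_one).mpr fun a =>
      (pi_norm_le_iff_of_nonneg zero_le_one).mpr fun i => ?_
    have h1 := h.1.norm_row a
    have h2 := Finset.single_le_sum (f := fun i => ‖w a i‖ ^ 2) (fun i _ => by positivity)
      (Finset.mem_univ i)
    simp only [h1] at h2
    exact (sq_le_one_iff₀ (norm_nonneg _)).mp h2

lemma Small_closed {N : ℕ} (E τ θ : ℝ) (S : Finset (Fin N)) (k : Fin N) :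
    IsClosed (SmallE E τ θ S k) := by
  refine closed_proj (R := {q : (TI N → ℂ) × (Fin N → ℂ) | SmallW (Amat E q.1) τ θ S k q.2})
    (C := Metric.closedBall 0 1) ?_ (isCompact_closedBall _ _) ?_
  · have hA : ∀ i j, Continuous fun q : (TI N → ℂ) × (Fin N → ℂ) => Amat E q.1 i j :=
      fun i j => (Amat_cont E i j).comp continuous_fst
    have hwc : ∀ i, Continuous fun q : (TI N → ℂ) × (Fin N → ℂ) => q.2 i :=
      fun i => by fun_prop
    simp only [SmallW, Set.ofPred_and, Set.ofPred_forall]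
    refine IsClosed.inter ?_ (IsClosed.inter ?_ (IsClosed.inter ?_ ?_))
    · exact isClosed_eq (by fun_prop) continuous_const
    · exact isClosed_iInter fun c => isClosed_iInter fun _ =>
        isClosed_eq (hwc _) continuous_const
    · exact isClosed_le continuous_const (by fun_prop)
    · refine isClosed_le ?_ continuous_const
      fun_prop
  · rintro ⟨x, w⟩ h
    rw [mem_closedBall_zero_iff]
    refine (pi_norm_le_iff_of_nonneg zero_le_one).mpr fun i => ?_
    have h1 := h.1
    have h2 := Finset.single_le_sum (f := fun i => ‖w i‖ ^ 2) (fun i _ => by positivity)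
      (Finset.mem_univ i)
    simp only [h1] at h2
    exact (sq_le_one_iff₀ (norm_nonneg _)).mp h2

lemma exists_on_ker {l r : ℕ} (hl : l = r + 1) (v : Fin l → ℂ) :
    ∃ c : Fin r → Fin l → ℂ, ON c ∧ ∀ b, ∑ a, c b a * v a = 0 := by
  let f : EuclideanSpace ℂ (Fin l) →ₗ[ℂ] ℂ :=
    { toFun := fun c => ∑ a, c a * v a
      map_add' := fun c d => by simp [add_mul, Finset.sum_add_distrib]
      map_smul' := fun s c => by simp [mul_assoc, Finset.mul_sum] }
  have h1 := LinearMap.finrank_range_add_finrank_ker f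
  have h2 : Module.finrank ℂ (LinearMap.range f) ≤ 1 := by
    have := Submodule.finrank_le (LinearMap.range f)
    simpa using this
  have h3 : r ≤ Module.finrank ℂ (LinearMap.ker f) := by
    rw [finrank_euclideanSpace_fin] at h1
    omega
  let B := stdOrthonormalBasis ℂ (LinearMap.ker f)
  refine ⟨fun b => (B (Fin.castLE h3 b) : EuclideanSpace ℂ (Fin l)).ofLp, ?_, ?_⟩
  · intro a c
    have h := (orthonormal_iff_ite.mp B.orthonormal) (Fin.castLE h3 c) (Fin.castLE h3 a)
    rw [Submodule.coe_inner, PiLp.inner_apply] at h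
    simp only [RCLike.inner_apply] at h
    rw [h]
    simp only [Fin.castLE_inj]
    by_cases hh : a = c
    · simp [hh]
    · simp [hh, Ne.symm hh]
  · intro b
    exact (B (Fin.castLE h3 b)).2

lemma bad_erase {N r : ℕ} {A : Fin N → Fin N → ℂ} {τ : ℝ} {S : Finset (Fin N)}
    {w : Fin (r + 1) → Fin N → ℂ} (hw : BadW A τ S w) (k : Fin N) :
    ∃ w' : Fin r → Fin N → ℂ, BadW A τ (S.erase k) w' := by
  obtain ⟨c, hc, hck⟩ := exists_on_ker rfl (fun a => w a k)
  obtain ⟨hON, hsupp, hB⟩ := hw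
  refine ⟨fun b i => ∑ a, c b a * w a i, ?_, ?_, ?_⟩
  · intro a b
    rw [hON.comb]
    exact hc a b
  · intro b i hi
    by_cases h : i = k
    · rw [h]; exact hck b
    · have : i ∉ S := fun h' => hi (Finset.mem_erase.mpr ⟨h, h'⟩)
      exact Finset.sum_eq_zero fun a _ => by rw [hsupp a i this, mul_zero]
  · intro d
    have e : ∀ j, ∑ b, d b * ∑ a, c b a * w a j = ∑ a, (∑ b, d b * c b a) * w a j := by
      intro j
      simp_rw [Finset.mul_sum, Finset.sum_mul]
      rw [Finset.sum_comm]
      refine Finset.sum_congr rfl fun i _ => Finset.sum_congr rfl fun j _ => ?_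
      ring
    simp_rw [e]
    have h := hB (fun a => ∑ b, d b * c b a)
    rw [hc.norm_comb] at h
    refine le_trans ?_ h
    exact Finset.sum_le_sum_of_subset_of_nonneg (Finset.erase_subset _ _) fun i _ _ => by positivity

lemma bad_small {N l : ℕ} {A : Fin N → Fin N → ℂ} {τ : ℝ} {S : Finset (Fin N)}
    {w : Fin l → Fin N → ℂ} (hw : BadW A τ S w) (k : Fin N) {θ : ℝ} (hθ : 0 < θ)
    (h : θ ≤ ∑ a, ‖w a k‖ ^ 2) : ∃ u, SmallW A τ θ S k u := by
  obtain ⟨hON, hsupp, hB⟩ := hw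
  set p : ℝ := ∑ a, ‖w a k‖ ^ 2 with hp
  have hp0 : 0 < p := hθ.trans_le h
  set c : Fin l → ℂ := fun a => (starRingEnd ℂ) (w a k) / (Real.sqrt p : ℂ) with hc
  have hcn : ∑ a, ‖c a‖ ^ 2 = 1 := by
    simp only [hc, norm_div, RCLike.norm_conj, Complex.norm_real, div_pow,
      Real.norm_of_nonneg (Real.sqrt_nonneg p), Real.sq_sqrt hp0.le]
    rw [← Finset.sum_div, div_self hp0.ne']
  refine ⟨fun i => ∑ a, c a * w a i, ?_, ?_, ?_, ?_⟩
  · rw [hON.norm_comb, hcn]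
  · intro i hi
    exact Finset.sum_eq_zero fun a _ => by rw [hsupp a i hi, mul_zero]
  · have : ∑ a, c a * w a k = (Real.sqrt p : ℂ) := by
      have e : ∀ a, c a * w a k = ((‖w a k‖ ^ 2 : ℝ) : ℂ) / (Real.sqrt p : ℂ) := fun a => by
        simp only [hc]
        rw [div_mul_eq_mul_div, mul_comm, Complex.mul_conj, Complex.normSq_eq_norm_sq]
      simp_rw [e]
      rw [← Finset.sum_div, ← Complex.ofReal_sum, ← hp, ← Complex.ofReal_div, Real.div_sqrt]
    beta_reduce
    rw [this, Complex.norm_real, Real.norm_of_nonneg (Real.sqrt_nonneg p), Real.sq_sqrt hp0.le]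
    exact h
  · have h := hB c
    rw [hcn, mul_one] at h
    refine le_trans ?_ h
    exact Finset.sum_le_sum_of_subset_of_nonneg (Finset.erase_subset _ _) fun i _ _ => by positivity

lemma bad_dep {N r : ℕ} {E τ : ℝ} {S : Finset (Fin N)} {x x' : TI N → ℂ}
    (h : ∀ i ∈ S, ∀ j ∈ S, x (tidx i j) = x' (tidx i j)) {w : Fin r → Fin N → ℂ}
    (hw : BadW (Amat E x) τ S w) : BadW (Amat E x') τ S w := by
  obtain ⟨hON, hsupp, hB⟩ := hw
  refine ⟨hON, hsupp, fun c => ?_⟩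
  refine le_trans (le_of_eq ?_) (hB c)
  refine Finset.sum_congr rfl fun i hi => ?_
  congr 2
  refine Finset.sum_congr rfl fun j _ => ?_
  by_cases hj : j ∈ S
  · unfold Amat ent
    rw [h i hi j hj]
  · have : ∑ a, c a * w a j = 0 := Finset.sum_eq_zero fun a _ => by rw [hsupp a j hj, mul_zero]
    rw [this, mul_zero, mul_zero]

/-- one elimination step -/
lemma step_k {N r : ℕ} (hr : 0 < r) {m : TI N → Measure ℂ} {δ D : ℝ} (hm : GoodM m δ D)
    (hδ : 0 < δ) {E τ θ : ℝ} (hθ : 0 < θ) {S : Finset (Fin N)} {k : Fin N}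
    (hN : 0 < N) (hcond : 4 * N * τ ^ 2 / θ ≤ r / 2) :
    Measure.pi m (Bad E τ (S.erase k) r ∩ SmallE E τ θ S k) ≤
      ENNReal.ofReal (4 * (4 * D / δ ^ 2 + 4) / r) * Measure.pi m (Bad E τ (S.erase k) r) := by
  have := hm.prob
  refine resample {t : TI N | t.1.1 ≠ k ∧ t.1.2 ≠ k} m _ _ (Bad_closed _ _ _ _).measurableSet
    (Small_closed _ _ _ _ _).measurableSet ?_ _ ?_
  · rintro x x' h ⟨w, hw⟩
    refine ⟨w, bad_dep (fun i hi j hj => h _ ?_) hw⟩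
    have hi := (Finset.mem_erase.mp hi).1
    have hj := (Finset.mem_erase.mp hj).1
    rcases tidx_val i j with h | h
    · simp only [Set.mem_ofPred_eq, h.1, h.2]; exact ⟨hi, hj⟩
    · simp only [Set.mem_ofPred_eq, h.1, h.2]; exact ⟨hj, hi⟩
  · rintro x ⟨w, hw⟩
    have hwk : ∀ a, w a k = 0 := fun a => hw.2.1 a k (by simp)
    have hp := proj_small hδ (fun i => hm.sg hδ i k) (hm.indep_col k) (Finset.univ.erase k)
      (fun i hi => hm.var' (Finset.mem_erase.mp hi).1) r hr w (fun a c => by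
        rw [← hw.1 a c]
        exact Finset.sum_erase _ (by rw [hwk, zero_mul]))
    refine le_trans (measure_mono ?_) hp
    rintro x' ⟨u, hu⟩
    have hw' : BadW (Amat E (mrg {t : TI N | t.1.1 ≠ k ∧ t.1.2 ≠ k} x x')) τ (S.erase k) w := by
      refine bad_dep (fun i hi j hj => ?_) hw
      have hi := (Finset.mem_erase.mp hi).1
      have hj := (Finset.mem_erase.mp hj).1
      have : tidx i j ∈ {t : TI N | t.1.1 ≠ k ∧ t.1.2 ≠ k} := by
        rcases tidx_val i j with h | h
        · simp only [Set.mem_ofPred_eq, h.1, h.2]; exact ⟨hi, hj⟩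
        · simp only [Set.mem_ofPred_eq, h.1, h.2]; exact ⟨hj, hi⟩
      unfold mrg
      rw [if_pos this]
    have hd := det_bound (Amat_conj E _) hθ hw' hu
    have hN' : (0 : ℝ) < N := by exact_mod_cast hN
    have e : ∀ a, ‖∑ i, (starRingEnd ℂ) (w a i) *
        Amat E (mrg {t : TI N | t.1.1 ≠ k ∧ t.1.2 ≠ k} x x') i k‖ ^ 2 =
        ‖∑ i ∈ Finset.univ.erase k, (starRingEnd ℂ) (w a i) * ent x' i k‖ ^ 2 / N := by
      intro a
      have e1 : ∑ i, (starRingEnd ℂ) (w a i) *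
        Amat E (mrg {t : TI N | t.1.1 ≠ k ∧ t.1.2 ≠ k} x x') i k =
        (∑ i ∈ Finset.univ.erase k, (starRingEnd ℂ) (w a i) * ent x' i k) / (Real.sqrt N : ℂ) := by
        rw [← Finset.sum_erase Finset.univ (a := k), Finset.sum_div]
        · refine Finset.sum_congr rfl fun i hi => ?_
          have hi := (Finset.mem_erase.mp hi).1
          have : tidx i k ∉ {t : TI N | t.1.1 ≠ k ∧ t.1.2 ≠ k} := by
            rcases tidx_val i k with h | h
            · simp [h.1, h.2]
            · simp [h.1, h.2]
          unfold Amat ent mrg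
          rw [if_neg this, if_neg hi]
          ring
        · rw [hwk]; simp
      rw [e1, norm_div, div_pow, Complex.norm_real, Real.norm_of_nonneg (Real.sqrt_nonneg _),
        Real.sq_sqrt hN'.le]
    simp_rw [e] at hd
    rw [← Finset.sum_div, div_le_iff₀ hN'] at hd
    simp only [Set.mem_ofPred_eq]
    refine hd.trans (le_trans (le_of_eq ?_) hcond)
    ring

/-- compressible approximate eigenvectors -/
def CompE {N : ℕ} (E τ ρ g : ℝ) (S : Finset (Fin N)) : Set (TI N → ℂ) :=
  {x | ∃ (u : Fin N → ℂ) (G : Finset (Fin N)), ∑ i, ‖u i‖ ^ 2 = 1 ∧ (G.card : ℝ) < g ∧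
    ∑ i ∈ Gᶜ, ‖u i‖ ^ 2 ≤ ρ ^ 2 ∧ ∑ i ∈ S, ‖∑ j, Amat E x i j * u j‖ ^ 2 ≤ τ ^ 2}

open scoped Classical in
lemma markov_step {N r : ℕ} (hr : 0 < r) {m : TI N → Measure ℂ} {δ D : ℝ} (hm : GoodM m δ D)
    (hδ : 0 < δ) {E τ θ : ℝ} (hθ : 0 < θ) {S : Finset (Fin N)}
    (hN : 0 < N) (hcond : 4 * N * τ ^ 2 / θ ≤ r / 2) (Q : Set (TI N → ℂ)) {g : ℝ} (hg : 0 < g)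
    (hQ : ∀ x, ∀ w : Fin (r + 1) → Fin N → ℂ, BadW (Amat E x) τ S w → x ∉ Q →
      g ≤ ((S.filter fun k => θ ≤ ∑ a, ‖w a k‖ ^ 2).card : ℝ)) (B : ℝ≥0∞)
    (hB : ∀ k ∈ S, Measure.pi m (Bad E τ (S.erase k) r) ≤ B) :
    Measure.pi m (Bad E τ S (r + 1)) ≤ Measure.pi m Q +
      ENNReal.ofReal (N * (4 * (4 * D / δ ^ 2 + 4) / r) / g) * B := by
  have := hm.prob
  set Ek : Fin N → Set (TI N → ℂ) := fun k => Bad E τ (S.erase k) r ∩ SmallE E τ θ S k with hEk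
  have hEm : ∀ k, MeasurableSet (Ek k) := fun k =>
    (Bad_closed _ _ _ _).measurableSet.inter (Small_closed _ _ _ _ _).measurableSet
  set Φ : (TI N → ℂ) → ℝ≥0∞ := fun x => ∑ k ∈ S, (Ek k).indicator 1 x with hΦ
  have hΦm : Measurable Φ := Finset.measurable_sum _ fun k _ =>
    measurable_one.indicator (hEm k)
  have hsub : Bad E τ S (r + 1) ⊆ Q ∪ {x | ENNReal.ofReal g ≤ Φ x} := by
    rintro x ⟨w, hw⟩
    by_cases hx : x ∈ Q
    · exact Or.inl hx
    · refine Or.inr ?_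
      have h := hQ x w hw hx
      simp only [Set.mem_ofPred_eq]
      calc ENNReal.ofReal g ≤ ENNReal.ofReal ((S.filter fun k => θ ≤ ∑ a, ‖w a k‖ ^ 2).card : ℝ) :=
            ENNReal.ofReal_le_ofReal h
        _ = ∑ k ∈ S.filter fun k => θ ≤ ∑ a, ‖w a k‖ ^ 2, 1 := by simp
        _ ≤ ∑ k ∈ S.filter fun k => θ ≤ ∑ a, ‖w a k‖ ^ 2, (Ek k).indicator 1 x := by
            refine Finset.sum_le_sum fun k hk => ?_
            have hk2 := (Finset.mem_filter.mp hk).2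
            rw [Set.indicator_of_mem]
            · rfl
            · exact ⟨bad_erase hw k, bad_small hw k hθ hk2⟩
        _ ≤ Φ x := Finset.sum_le_sum_of_subset (Finset.filter_subset _ _)
  refine (measure_mono hsub).trans ((measure_union_le _ _).trans ?_)
  gcongr
  have hg' : ENNReal.ofReal g ≠ 0 := by simpa using hg
  refine (meas_ge_le_lintegral_div hΦm.aemeasurable hg' ENNReal.ofReal_ne_top).trans ?_
  have h1 : ∫⁻ x, Φ x ∂(Measure.pi m) ≤
      N * (ENNReal.ofReal (4 * (4 * D / δ ^ 2 + 4) / r) * B) := by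
    simp only [hΦ]
    rw [lintegral_finsetSum _ fun k _ => measurable_one.indicator (hEm k)]
    simp_rw [fun k => lintegral_indicator_one (μ := Measure.pi m) (hEm k)]
    calc _ ≤ ∑ k ∈ S, (ENNReal.ofReal (4 * (4 * D / δ ^ 2 + 4) / r) * B) := by
          refine Finset.sum_le_sum fun k hk => ?_
          refine (step_k hr hm hδ hθ hN hcond).trans ?_
          gcongr
          exact hB k hk
      _ ≤ _ := by
          rw [Finset.sum_const, nsmul_eq_mul]
          gcongr
          simpa using Finset.card_le_univ S
  refine (ENNReal.div_le_div_right h1 _).trans (le_of_eq ?_)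
  rw [ENNReal.ofReal_div_of_pos hg, ENNReal.ofReal_mul (by positivity), ENNReal.ofReal_natCast]
  generalize ENNReal.ofReal (4 * (4 * D / δ ^ 2 + 4) / r) = c
  rw [div_eq_mul_inv, div_eq_mul_inv]
  ring

open scoped Classical in
/-- regime 2 counting -/
lemma good_count2 {N l : ℕ} (hN : 0 < N) {A : Fin N → Fin N → ℂ} {τ : ℝ} {S : Finset (Fin N)}
    {w : Fin l → Fin N → ℂ} (hw : BadW A τ S w) :
    (l : ℝ) / 2 ≤ ((S.filter fun k => (l : ℝ) / (2 * N) ≤ ∑ a, ‖w a k‖ ^ 2).card : ℝ) := by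
  obtain ⟨hON, hsupp, -⟩ := hw
  set p : Fin N → ℝ := fun k => ∑ a, ‖w a k‖ ^ 2 with hp
  have hp0 : ∀ k, 0 ≤ p k := fun k => Finset.sum_nonneg fun a _ => by positivity
  have htot : ∑ k, p k = l := by
    simp only [hp]
    rw [Finset.sum_comm, Finset.sum_congr rfl fun a _ => hON.norm_row a]; simp
  have hp1 : ∀ k, p k ≤ 1 := by
    intro k
    have h := hON.norm_comb (fun a => (starRingEnd ℂ) (w a k))
    simp only [RCLike.norm_conj] at h
    have h2 := Finset.single_le_sum (f := fun i => ‖∑ a, (starRingEnd ℂ) (w a k) * w a i‖ ^ 2)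
      (fun i _ => by positivity) (Finset.mem_univ k)
    rw [h] at h2
    have h3 : ∑ a, (starRingEnd ℂ) (w a k) * w a k = (p k : ℂ) := by
      simp only [hp]; push_cast
      refine Finset.sum_congr rfl fun a _ => ?_
      rw [mul_comm, Complex.mul_conj, Complex.normSq_eq_norm_sq]; simp
    simp only [h3, Complex.norm_real, Real.norm_of_nonneg (hp0 k)] at h2
    change p k ^ 2 ≤ p k at h2
    by_contra hc
    push Not at hc
    nlinarith
  have htotS : ∑ k ∈ S, p k = l := by
    rw [← htot]
    refine Finset.sum_subset (Finset.subset_univ _) fun k _ hk => ?_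
    simp only [hp]
    exact Finset.sum_eq_zero fun a _ => by rw [hsupp a k hk]; simp
  have hN' : (0 : ℝ) < N := by exact_mod_cast hN
  have hsplit := Finset.sum_filter_add_sum_filter_not S (fun k => (l : ℝ) / (2 * N) ≤ p k) p
  have h1 : ∑ k ∈ S.filter fun k => (l : ℝ) / (2 * N) ≤ p k, p k ≤
      ((S.filter fun k => (l : ℝ) / (2 * N) ≤ p k).card : ℝ) := by
    calc _ ≤ ∑ k ∈ S.filter fun k => (l : ℝ) / (2 * N) ≤ p k, (1 : ℝ) :=
          Finset.sum_le_sum fun k _ => hp1 k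
      _ = _ := by simp
  have h2 : ∑ k ∈ S.filter fun k => ¬ (l : ℝ) / (2 * N) ≤ p k, p k ≤ l / 2 := by
    calc _ ≤ ∑ k ∈ S.filter fun k => ¬ (l : ℝ) / (2 * N) ≤ p k, (l : ℝ) / (2 * N) :=
          Finset.sum_le_sum fun k hk => (not_le.mp (Finset.mem_filter.mp hk).2).le
      _ ≤ ∑ k : Fin N, (l : ℝ) / (2 * N) :=
          Finset.sum_le_sum_of_subset_of_nonneg (Finset.subset_univ _) fun k _ _ => by positivity
      _ = l / 2 := by simp; field_simp
  linarith

open scoped Classical in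
/-- regime 1 counting -/
lemma good_count1 {N l : ℕ} (hl : 0 < l) (hN : 0 < N) {E τ : ℝ} {x : TI N → ℂ}
    {S : Finset (Fin N)} {w : Fin l → Fin N → ℂ} (hw : BadW (Amat E x) τ S w) {ρ g : ℝ}
    (hx : x ∉ CompE E τ ρ g S) :
    g ≤ ((S.filter fun k => ρ ^ 2 * l / N ≤ ∑ a, ‖w a k‖ ^ 2).card : ℝ) := by
  by_contra hc
  push Not at hc
  apply hx
  obtain ⟨hON, hsupp, hB⟩ := hw
  set G := S.filter fun k => ρ ^ 2 * l / N ≤ ∑ a, ‖w a k‖ ^ 2 with hG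
  have hN' : (0 : ℝ) < N := by exact_mod_cast hN
  have h1 : ∑ k ∈ Gᶜ, ∑ a, ‖w a k‖ ^ 2 ≤ ρ ^ 2 * l := by
    calc _ ≤ ∑ k ∈ Gᶜ, ρ ^ 2 * l / N := by
          refine Finset.sum_le_sum fun k hk => ?_
          by_cases hkS : k ∈ S
          · have : k ∉ G := by simpa using hk
            rw [hG, Finset.mem_filter, not_and] at this
            exact (not_le.mp (this hkS)).le
          · rw [Finset.sum_eq_zero fun a _ => by rw [hsupp a k hkS]; simp]
            positivity
      _ ≤ ∑ k : Fin N, ρ ^ 2 * l / N :=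
          Finset.sum_le_sum_of_subset_of_nonneg (Finset.subset_univ _) fun k _ _ => by positivity
      _ = ρ ^ 2 * l := by simp; field_simp
  rw [Finset.sum_comm] at h1
  have h2 : ∃ a ∈ (Finset.univ : Finset (Fin l)), ∑ k ∈ Gᶜ, ‖w a k‖ ^ 2 ≤ ρ ^ 2 := by
    refine Finset.exists_le_of_sum_le (f := fun a => ∑ k ∈ Gᶜ, ‖w a k‖ ^ 2) (g := fun _ => ρ ^ 2)
      ⟨⟨0, hl⟩, Finset.mem_univ _⟩ ?_
    refine h1.trans (le_of_eq ?_)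
    simp [mul_comm]
  obtain ⟨a, -, ha⟩ := h2
  refine ⟨w a, G, hON.norm_row a, hc, ha, ?_⟩
  have h := hB (Pi.single a 1)
  have e : ∀ j, ∑ b, (Pi.single a 1 : Fin l → ℂ) b * w b j = w a j := fun j => by
    rw [Finset.sum_eq_single a]
    · simp
    · intro b _ hb; simp [hb]
    · simp
  simp_rw [e] at h
  refine h.trans (le_of_eq ?_)
  rw [Finset.sum_eq_single a]
  · simp
  · intro b _ hb; simp [hb]
  · simp

/-- iterate the elimination -/
lemma rec_bound {N : ℕ} {m : TI N → Measure ℂ} [∀ t, IsProbabilityMeasure (m t)]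
    {E τ : ℝ} (K r0 : ℕ) (hr0 : r0 ≤ K) (ε f : ℝ≥0∞)
    (hf : f ≤ 1)
    (hstep : ∀ (S : Finset (Fin N)) (r : ℕ) (B : ℝ≥0∞), r0 ≤ r → r + 1 ≤ K →
      N ≤ S.card + K → (∀ k ∈ S, Measure.pi m (Bad E τ (S.erase k) r) ≤ B) →
      Measure.pi m (Bad E τ S (r + 1)) ≤ ε + f * B) :
    Measure.pi m (Bad E τ (Finset.univ : Finset (Fin N)) K) ≤ f ^ (K - r0) + (K - r0 : ℕ) * ε := by
  have key : ∀ n : ℕ, r0 + n ≤ K → ∀ S : Finset (Fin N), N + r0 + n ≤ S.card + K →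
      Measure.pi m (Bad E τ S (r0 + n)) ≤ f ^ n + n * ε := by
    intro n
    induction n with
    | zero => intro _ S _; simpa using prob_le_one
    | succ n ih =>
      intro hn S hS
      have h := hstep S (r0 + n) (f ^ n + n * ε) (by omega) (by omega) (by omega) (fun k hk => by
        refine ih (by omega) _ ?_
        have := Finset.card_erase_of_mem hk
        have h0 : 0 < S.card := Finset.card_pos.mpr ⟨k, hk⟩
        omega)
      refine h.trans ?_
      calc ε + f * (f ^ n + n * ε) = f ^ (n + 1) + (ε + f * (n * ε)) := by ring
        _ ≤ f ^ (n + 1) + (ε + 1 * (n * ε)) := by gcongr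
        _ = _ := by push_cast; ring
  have := key (K - r0) (by omega) Finset.univ (by simp; omega)
  rwa [show r0 + (K - r0) = K by omega] at this

lemma exp_le_add_exp_sq' (y : ℝ) : Real.exp y ≤ y + Real.exp (y ^ 2) := by
  have h0 := Real.add_one_le_exp (y ^ 2)
  rcases le_or_gt |y| 1 with h | h
  · have := Real.abs_exp_sub_one_sub_id_le h
    have := le_abs_self (Real.exp y - 1 - y)
    linarith
  · rcases le_or_gt 0 y with hy | hy
    · rw [abs_of_nonneg hy] at h
      have : Real.exp y ≤ Real.exp (y ^ 2) := Real.exp_le_exp.mpr (by nlinarith)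
      linarith
    · rw [abs_of_neg hy] at h
      have : Real.exp y ≤ 1 := Real.exp_le_one_iff.mpr hy.le
      nlinarith

lemma SG.one_le {Ω : Type*} [MeasurableSpace Ω] {P : Measure Ω} [IsProbabilityMeasure P]
    {δ D : ℝ} {b : Ω → ℂ} (hb : SG P δ D b) (hδ : 0 < δ) : 1 ≤ D := by
  refine le_trans ?_ hb.le
  calc (1 : ℝ) = ∫ _ω, (1 : ℝ) ∂P := by simp
    _ ≤ _ := integral_mono (integrable_const _) hb.int fun ω => Real.one_le_exp (by positivity)

lemma SG.mgf_le {Ω : Type*} [MeasurableSpace Ω] {P : Measure Ω} [IsProbabilityMeasure P]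
    {δ D : ℝ} {b : Ω → ℂ} (hb : SG P δ D b) (hδ : 0 < δ) (α : ℂ) :
    Integrable (fun ω => Real.exp (α * b ω).re) P ∧
    ∫ ω, Real.exp (α * b ω).re ∂P ≤ Real.exp ((D + 1) / δ * ‖α‖ ^ 2) := by
  have hD := hb.one_le hδ
  have hbm := hb.meas
  have habs : ∀ ω, |(α * b ω).re| ≤ ‖α‖ * ‖b ω‖ := fun ω => by
    rw [← norm_mul]; exact Complex.abs_re_le_norm _
  have hgen : ∀ ω, Real.exp (α * b ω).re ≤
      Real.exp (‖α‖ ^ 2 / δ) * Real.exp (δ * ‖b ω‖ ^ 2) := fun ω => by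
    rw [← Real.exp_add]
    refine Real.exp_le_exp.mpr ((le_abs_self _).trans ((habs ω).trans ?_))
    have : ‖α‖ ^ 2 / δ + δ * ‖b ω‖ ^ 2 - ‖α‖ * ‖b ω‖ =
      (1 / δ) * ((‖α‖ - δ * ‖b ω‖ / 2) ^ 2 + 3 / 4 * (δ * ‖b ω‖) ^ 2) := by field_simp; ring
    have h2 : 0 ≤ (1 / δ) * ((‖α‖ - δ * ‖b ω‖ / 2) ^ 2 + 3 / 4 * (δ * ‖b ω‖) ^ 2) := by positivity
    linarith
  have hint : Integrable (fun ω => Real.exp (α * b ω).re) P := by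
    refine (hb.int.const_mul (Real.exp (‖α‖ ^ 2 / δ))).mono' ?_ ?_
    · exact (by fun_prop : Measurable fun ω => Real.exp (α * b ω).re).aestronglyMeasurable
    · refine Filter.Eventually.of_forall fun ω => ?_
      rw [Real.norm_of_nonneg (Real.exp_nonneg _)]; exact hgen ω
  refine ⟨hint, ?_⟩
  rcases le_or_gt (‖α‖ ^ 2) δ with h | h
  · have hI : Integrable (fun ω => (α * b ω).re) P := ((hb.integrable hδ).const_mul α).re
    have hz : ∫ ω, (α * b ω).re ∂P = 0 := by
      have := integral_re ((hb.integrable hδ).const_mul α)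
      simp only [RCLike.re_to_complex] at this
      rw [this, integral_const_mul, hb.mean]; simp
    have hpt : ∀ ω, Real.exp (α * b ω).re ≤
        (α * b ω).re + (1 + ‖α‖ ^ 2 / δ * (Real.exp (δ * ‖b ω‖ ^ 2) - 1)) := fun ω => by
      refine (exp_le_add_exp_sq' _).trans ?_
      gcongr
      have h1 : (α * b ω).re ^ 2 ≤ ‖α‖ ^ 2 * ‖b ω‖ ^ 2 := by
        rw [← mul_pow, ← sq_abs (α * b ω).re]
        exact pow_le_pow_left₀ (abs_nonneg _) (habs ω) 2
      have ha0 : 0 ≤ 1 - ‖α‖ ^ 2 / δ := by rw [sub_nonneg, div_le_one hδ]; exact h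
      have hb0 : 0 ≤ ‖α‖ ^ 2 / δ := by positivity
      have h2 := (convexOn_exp).2 (Set.mem_univ (0 : ℝ)) (Set.mem_univ (δ * ‖b ω‖ ^ 2))
        ha0 hb0 (by ring)
      simp only [smul_eq_mul, mul_zero, zero_add, Real.exp_zero, mul_one] at h2
      have e : ‖α‖ ^ 2 / δ * (δ * ‖b ω‖ ^ 2) = ‖α‖ ^ 2 * ‖b ω‖ ^ 2 := by field_simp
      rw [e] at h2
      refine (Real.exp_le_exp.mpr h1).trans (h2.trans (le_of_eq ?_))
      ring
    have hI3 : Integrable (fun ω => Real.exp (δ * ‖b ω‖ ^ 2) - 1) P :=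
      hb.int.sub (integrable_const _)
    have hI2 : Integrable (fun ω => 1 + ‖α‖ ^ 2 / δ * (Real.exp (δ * ‖b ω‖ ^ 2) - 1)) P :=
      (integrable_const _).add (hI3.const_mul _)
    calc _ ≤ ∫ ω, ((α * b ω).re + (1 + ‖α‖ ^ 2 / δ * (Real.exp (δ * ‖b ω‖ ^ 2) - 1))) ∂P :=
          integral_mono hint (hI.add hI2) hpt
      _ = 1 + ‖α‖ ^ 2 / δ * ((∫ ω, Real.exp (δ * ‖b ω‖ ^ 2) ∂P) - 1) := by
          rw [integral_add hI hI2, hz, integral_add (integrable_const _)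
            (hI3.const_mul _), integral_const_mul,
            integral_sub hb.int (integrable_const _)]
          simp
      _ ≤ 1 + ‖α‖ ^ 2 / δ * (D + 1) := by
          gcongr
          linarith [hb.le]
      _ ≤ _ := by
          have := Real.add_one_le_exp ((D + 1) / δ * ‖α‖ ^ 2)
          refine le_trans (le_of_eq ?_) this
          ring
  · calc _ ≤ ∫ ω, Real.exp (‖α‖ ^ 2 / δ) * Real.exp (δ * ‖b ω‖ ^ 2) ∂P :=
          integral_mono hint (hb.int.const_mul _) hgen
      _ ≤ Real.exp (‖α‖ ^ 2 / δ) * D := by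
          rw [integral_const_mul]
          gcongr
          exact hb.le
      _ ≤ Real.exp (‖α‖ ^ 2 / δ) * Real.exp (D * (‖α‖ ^ 2 / δ)) := by
          gcongr
          have h1 : 1 ≤ ‖α‖ ^ 2 / δ := by rw [le_div_iff₀ hδ]; linarith
          have := Real.add_one_le_exp (D * (‖α‖ ^ 2 / δ))
          nlinarith
      _ = _ := by rw [← Real.exp_add]; congr 1; ring

/-- Chernoff for linear forms -/
lemma lin_tail {Ω : Type*} [MeasurableSpace Ω] {P : Measure Ω} [IsProbabilityMeasure P]
    {δ D : ℝ} (hδ : 0 < δ) (hD : 1 ≤ D) {ι : Type*} [Fintype ι] {b : ι → Ω → ℂ}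
    (hb : ∀ i, SG P δ D (b i))
    (hind : iIndepFun b P) (α : ι → ℂ) (hα : ∑ i, ‖α i‖ ^ 2 ≤ 1) (s : ℝ) (hs : 0 ≤ s) :
    P {ω | s ≤ (∑ i, α i * b i ω).re} ≤
      ENNReal.ofReal (Real.exp (- (δ / (4 * (D + 1))) * s ^ 2)) := by
  classical
  set X : ι → Ω → ℝ := fun i ω => (α i * b i ω).re with hX
  have hXm : ∀ i, Measurable (X i) := fun i => by
    have := (hb i).meas
    fun_prop
  have hXi : iIndepFun X P := hind.comp (fun i z => (α i * z).re) fun i => by fun_prop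
  set t : ℝ := s * δ / (2 * (D + 1)) with ht
  have ht0 : 0 ≤ t := by positivity
  have hm1 : ∀ i, Integrable (fun ω => Real.exp (t * X i ω)) P ∧
      mgf (X i) P t ≤ Real.exp ((D + 1) / δ * t ^ 2 * ‖α i‖ ^ 2) := fun i => by
    have h := (hb i).mgf_le hδ (t * α i)
    have e : ∀ ω, ((t : ℂ) * α i * b i ω).re = t * X i ω := fun ω => by
      rw [mul_assoc, Complex.re_ofReal_mul]
    simp_rw [e] at h
    refine ⟨h.1, h.2.trans (le_of_eq ?_)⟩
    congr 1
    rw [norm_mul, Complex.norm_real, Real.norm_of_nonneg ht0]; ring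
  have hint := hXi.integrable_exp_mul_sum hXm (s := Finset.univ) (t := t) (fun i _ => (hm1 i).1)
  have hch := measure_ge_le_exp_mul_mgf (μ := P) (X := ∑ i, X i) s ht0 hint
  rw [hXi.mgf_sum hXm] at hch
  have e2 : {ω | s ≤ (∑ i, α i * b i ω).re} = {ω | s ≤ (∑ i, X i) ω} := by
    ext ω; simp [hX]
  rw [e2, ← ENNReal.ofReal_toReal (measure_ne_top P _)]
  refine ENNReal.ofReal_le_ofReal (hch.trans ?_)
  calc _ ≤ Real.exp (-t * s) * ∏ i, Real.exp ((D + 1) / δ * t ^ 2 * ‖α i‖ ^ 2) := by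
        gcongr with i
        · exact fun i _ => mgf_nonneg
        · exact (hm1 i).2
    _ = Real.exp (-t * s + (D + 1) / δ * t ^ 2 * ∑ i, ‖α i‖ ^ 2) := by
        rw [← Real.exp_sum, ← Real.exp_add, Finset.mul_sum]
    _ ≤ Real.exp (-t * s + (D + 1) / δ * t ^ 2 * 1) := by gcongr
    _ = _ := by
        congr 1
        rw [ht]; field_simp; ring

lemma opnorm_of_net {F : Type*} [NormedAddCommGroup F] [InnerProductSpace ℂ F]
    (T : F →L[ℂ] F) (s : Finset F) (hs1 : ∀ c ∈ s, ‖c‖ = 1)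
    (hs : ∀ x, ‖x‖ = 1 → ∃ c ∈ s, ‖x - c‖ ≤ 1 / 4) (B : ℝ) (hB0 : 0 ≤ B)
    (hB : ∀ y ∈ s, ∀ z ∈ s, (inner ℂ y (T z)).re ≤ B) : ‖T‖ ≤ 2 * B := by
  have key : ∀ z, ‖z‖ = 1 → ‖T z‖ ≤ B + ‖T‖ / 2 := by
    intro z hz
    by_cases h0 : T z = 0
    · rw [h0, norm_zero]; positivity
    have hn : 0 < ‖T z‖ := norm_pos_iff.mpr h0
    set y : F := ((‖T z‖⁻¹ : ℝ) : ℂ) • T z with hy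
    have hy1 : ‖y‖ = 1 := by
      rw [hy, norm_smul, Complex.norm_real, Real.norm_of_nonneg (by positivity),
        inv_mul_cancel₀ hn.ne']
    have hyT : (inner ℂ y (T z)).re = ‖T z‖ := by
      rw [hy, inner_smul_left, Complex.conj_ofReal, Complex.re_ofReal_mul]
      have : (inner ℂ (T z) (T z)).re = ‖T z‖ ^ 2 := inner_self_eq_norm_sq (𝕜 := ℂ) (T z)
      rw [this]; field_simp
    obtain ⟨y', hy's, hyy⟩ := hs y hy1
    obtain ⟨z', hz's, hzz⟩ := hs z hz
    have e : inner ℂ y (T z) = inner ℂ y' (T z') + inner ℂ y' (T (z - z')) + inner ℂ (y - y') (T z) := by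
      rw [map_sub, inner_sub_right, inner_sub_left]; ring
    have b1 : (inner ℂ y' (T (z - z'))).re ≤ ‖T‖ / 4 := by
      refine (Complex.re_le_norm _).trans ((norm_inner_le_norm _ _).trans ?_)
      rw [hs1 y' hy's, one_mul]
      refine (T.le_opNorm _).trans ?_
      nlinarith [norm_nonneg T]
    have b2 : (inner ℂ (y - y') (T z)).re ≤ ‖T‖ / 4 := by
      refine (Complex.re_le_norm _).trans ((norm_inner_le_norm _ _).trans ?_)
      have := T.le_opNorm z
      rw [hz, mul_one] at this
      nlinarith [norm_nonneg T, norm_nonneg (y - y'), norm_nonneg (T z)]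
    rw [← hyT, e, Complex.add_re, Complex.add_re]
    have := hB y' hy's z' hz's
    linarith
  have h2 : ‖T‖ ≤ B + ‖T‖ / 2 := by
    refine T.opNorm_le_bound (by positivity) fun z => ?_
    by_cases hz : z = 0
    · simp [hz]
    have hn : 0 < ‖z‖ := norm_pos_iff.mpr hz
    have h1 := key (((‖z‖⁻¹ : ℝ) : ℂ) • z) (by
      rw [norm_smul, Complex.norm_real, Real.norm_of_nonneg (by positivity),
        inv_mul_cancel₀ hn.ne'])
    rw [map_smul, norm_smul, Complex.norm_real, Real.norm_of_nonneg (by positivity),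
      inv_mul_le_iff₀ hn] at h1
    linarith
  linarith

/-- operator norm event -/
def OpE {N : ℕ} (C0 : ℝ) : Set (TI N → ℂ) :=
  {x | ∀ u : Fin N → ℂ, ∑ i, ‖∑ j, ent x i j * u j‖ ^ 2 ≤ C0 ^ 2 * N * ∑ j, ‖u j‖ ^ 2}

lemma form_tail {N : ℕ} {m : TI N → Measure ℂ} {δ D : ℝ} (hm : GoodM m δ D)
    (hδ : 0 < δ) (hD : 1 ≤ D) (y z : EuclideanSpace ℂ (Fin N)) (hy : ‖y‖ = 1) (hz : ‖z‖ = 1)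
    (s : ℝ) (hs : 0 ≤ s) :
    Measure.pi m {x | 2 * s < (∑ p : Fin N × Fin N,
      ((starRingEnd ℂ) (y p.1) * z p.2) * ent x p.1 p.2).re} ≤
      2 * ENNReal.ofReal (Real.exp (- (δ / (4 * (D + 1))) * s ^ 2)) := by
  have := hm.prob
  set α : Fin N × Fin N → ℂ := fun p => (starRingEnd ℂ) (y p.1) * z p.2 with hα
  have htot : ∑ p, ‖α p‖ ^ 2 = 1 := by
    simp only [hα, norm_mul, RCLike.norm_conj, mul_pow]
    rw [Fintype.sum_prod_type]
    simp only [← Finset.mul_sum, ← Finset.sum_mul]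
    rw [← EuclideanSpace.norm_sq_eq, ← EuclideanSpace.norm_sq_eq, hy, hz]; norm_num
  have hsp := Fintype.sum_subtype_add_sum_subtype (fun p : Fin N × Fin N => p.1 ≤ p.2)
    (fun p => ‖α p‖ ^ 2)
  have hn1 : 0 ≤ ∑ t : {p : Fin N × Fin N // p.1 ≤ p.2}, ‖α t‖ ^ 2 :=
    Finset.sum_nonneg fun _ _ => by positivity
  have hn2 : 0 ≤ ∑ t : {p : Fin N × Fin N // ¬ p.1 ≤ p.2}, ‖α t‖ ^ 2 :=
    Finset.sum_nonneg fun _ _ => by positivity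
  have t1 := lin_tail hδ hD (ι := {p : Fin N × Fin N // p.1 ≤ p.2}) (fun t => hm.sg hδ t.1.1 t.1.2)
    (hm.indep (fun t : {p : Fin N × Fin N // p.1 ≤ p.2} => t.1.1) (fun t => t.1.2) (by
      rintro ⟨⟨a, b⟩, h⟩ ⟨⟨c, d⟩, h'⟩ hh
      simp only at h h'
      rcases tidx_eq hh with e | e
      · simp only at e; simp [e.1, e.2]
      · simp only at e
        obtain ⟨rfl, rfl⟩ := e
        have := le_antisymm h h'
        simp [this])) (fun t => α t) (by linarith) s hs
  have t2 := lin_tail hδ hD (ι := {p : Fin N × Fin N // ¬ p.1 ≤ p.2}) (fun t => hm.sg hδ t.1.1 t.1.2)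
    (hm.indep (fun t : {p : Fin N × Fin N // ¬ p.1 ≤ p.2} => t.1.1) (fun t => t.1.2) (by
      rintro ⟨⟨a, b⟩, h⟩ ⟨⟨c, d⟩, h'⟩ hh
      simp only at h h'
      rcases tidx_eq hh with e | e
      · simp only at e; simp [e.1, e.2]
      · simp only at e
        obtain ⟨rfl, rfl⟩ := e
        exact absurd (le_of_not_ge h) h')) (fun t => α t) (by linarith) s hs
  rw [two_mul (ENNReal.ofReal _)]
  refine le_trans (measure_mono ?_) ((measure_union_le _ _).trans (add_le_add t1 t2))
  intro x hx
  simp only [Set.mem_ofPred_eq] at hx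
  by_contra hc
  simp only [Set.mem_union, Set.mem_ofPred_eq, not_or, not_le] at hc
  rw [← Fintype.sum_subtype_add_sum_subtype (fun p : Fin N × Fin N => p.1 ≤ p.2), Complex.add_re] at hx
  linarith [hc.1, hc.2]

lemma op_bound (δ D : ℝ) (hδ : 0 < δ) (hD : 1 ≤ D) : ∃ C0 : ℝ, 0 < C0 ∧
    ∀ (N : ℕ) (m : TI N → Measure ℂ), GoodM m δ D →
      Measure.pi m (OpE C0)ᶜ ≤ ENNReal.ofReal (2 * Real.exp (-(N : ℝ))) := by
  set b : ℝ := Real.sqrt (160 * (D + 1) / δ) with hb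
  have hb0 : 0 < b := Real.sqrt_pos.mpr (by positivity)
  have hb2 : b ^ 2 = 160 * (D + 1) / δ := Real.sq_sqrt (by positivity)
  refine ⟨2 * b, by positivity, fun N m hm => ?_⟩
  obtain ⟨s, hs1, hs, hcard⟩ := aux_net (F := EuclideanSpace ℂ (Fin N)) (1 / 4) (by norm_num)
  have hfr : Module.finrank ℝ (EuclideanSpace ℂ (Fin N)) = 2 * N := by
    rw [← Module.finrank_mul_finrank ℝ ℂ (EuclideanSpace ℂ (Fin N))]
    simp
  rw [hfr] at hcard
  set sN : ℝ := b * Real.sqrt N / 2 with hsN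
  have hsN0 : 0 ≤ sN := by positivity
  have hsub : (OpE (N := N) (2 * b))ᶜ ⊆ ⋃ q ∈ s ×ˢ s, {x | 2 * sN < (∑ p : Fin N × Fin N,
      ((starRingEnd ℂ) (q.1 p.1) * q.2 p.2) * ent x p.1 p.2).re} := by
    intro x hx
    by_contra hc
    apply hx
    simp only [Set.mem_iUnion, Set.mem_ofPred_eq, not_exists, not_lt] at hc
    set T := Matrix.toEuclideanCLM (𝕜 := ℂ) (n := Fin N) (Matrix.of (ent x)) with hT
    have hTa : ∀ u i, T u i = ∑ j, ent x i j * u j := fun u i => by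
      have h0 := congrFun (Matrix.ofLp_toEuclideanCLM (Matrix.of (ent x)) u) i
      rw [hT, h0]; simp [Matrix.mulVec, dotProduct]
    have hT2 := opnorm_of_net T s hs1 hs (2 * sN) (by positivity) (fun y hy z hz => by
      refine le_trans (le_of_eq ?_) (hc (y, z) (Finset.mk_mem_product hy hz))
      congr 1
      rw [PiLp.inner_apply, Fintype.sum_prod_type]
      refine Finset.sum_congr rfl fun i _ => ?_
      rw [RCLike.inner_apply, hTa, Finset.sum_mul]
      refine Finset.sum_congr rfl fun j _ => ?_
      ring)
    intro u
    have h := T.le_opNorm (WithLp.toLp 2 u)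
    have h3 : ‖T (WithLp.toLp 2 u)‖ ^ 2 ≤ (2 * (2 * sN)) ^ 2 * ‖(WithLp.toLp 2 u : EuclideanSpace ℂ (Fin N))‖ ^ 2 := by
      rw [← mul_pow]
      refine pow_le_pow_left₀ (norm_nonneg _) (h.trans ?_) 2
      gcongr
    rw [EuclideanSpace.norm_sq_eq, EuclideanSpace.norm_sq_eq] at h3
    simp only [hTa] at h3
    refine h3.trans (le_of_eq ?_)
    rw [hsN]
    have : Real.sqrt N ^ 2 = N := Real.sq_sqrt (by positivity)
    have e : (2*(2*(b*Real.sqrt N/2)))^2 = (2*b)^2*(Real.sqrt N^2) := by ring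
    rw [e, this]
  refine (measure_mono hsub).trans ((measure_biUnion_finset_le _ _).trans ?_)
  have hN0 : (0 : ℝ) ≤ N := by positivity
  calc _ ≤ ∑ q ∈ s ×ˢ s, ENNReal.ofReal (2 * Real.exp (- (δ / (4 * (D + 1))) * sN ^ 2)) := by
        refine Finset.sum_le_sum fun q hq => ?_
        rw [Finset.mem_product] at hq
        refine (form_tail hm hδ hD q.1 q.2 (hs1 _ hq.1) (hs1 _ hq.2) sN hsN0).trans (le_of_eq ?_)
        rw [ENNReal.ofReal_mul (by norm_num)]; simp
    _ = ENNReal.ofReal ((s.card : ℝ) ^ 2 * (2 * Real.exp (- (δ / (4 * (D + 1))) * sN ^ 2))) := by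
        rw [Finset.sum_const, Finset.card_product, nsmul_eq_mul,
          ENNReal.ofReal_mul (by positivity : (0 : ℝ) ≤ (s.card : ℝ) ^ 2)]
        congr 1
        rw [ENNReal.ofReal_pow (by positivity), ENNReal.ofReal_natCast]
        push_cast; ring
    _ ≤ _ := by
        refine ENNReal.ofReal_le_ofReal ?_
        have e1 : -(δ / (4 * (D + 1))) * sN ^ 2 = - (10 * N) := by
          rw [hsN, div_pow, mul_pow, hb2, Real.sq_sqrt hN0]; field_simp; ring
        rw [e1]
        have h9 : (1 + 2 / (1 / 4) : ℝ) ^ (2 * N) ≤ Real.exp (9 / 2 * N) := by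
          have : (1 + 2 / (1 / 4) : ℝ) ≤ Real.exp (9 / 4) := by
            have h2 := Real.exp_one_gt_d9
            have : Real.exp (9 / 4) = Real.exp 1 ^ 2 * Real.exp (1 / 4) := by
              rw [← Real.exp_nat_mul, ← Real.exp_add]; norm_num
            rw [this]
            have h3 := Real.quadratic_le_exp_of_nonneg (x := 1 / 4) (by norm_num)
            have h4 : (7.389 : ℝ) ≤ Real.exp 1 ^ 2 := by nlinarith
            nlinarith
          calc _ ≤ Real.exp (9 / 4) ^ (2 * N) := pow_le_pow_left₀ (by norm_num) this _
            _ = _ := by rw [← Real.exp_nat_mul]; congr 1; push_cast; ring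
        have h5 : (s.card : ℝ) ^ 2 ≤ Real.exp (9 * N) := by
          calc _ ≤ Real.exp (9 / 2 * N) ^ 2 := pow_le_pow_left₀ (by positivity) (hcard.trans h9) 2
            _ = _ := by rw [← Real.exp_nat_mul]; congr 1; push_cast; ring
        calc _ ≤ Real.exp (9 * N) * (2 * Real.exp (-(10 * N))) := by gcongr
          _ = 2 * (Real.exp (9 * N) * Real.exp (-(10 * N))) := by ring
          _ = _ := by rw [← Real.exp_add]; congr 2; ring

lemma exp_neg_le_quad {t : ℝ} (ht : 0 ≤ t) : Real.exp (-t) ≤ 1 - t + t ^ 2 / 2 := by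
  have h := Real.quadratic_le_exp_of_nonneg ht
  have hp : 0 < 1 + t + t ^ 2 / 2 := by positivity
  rw [Real.exp_neg]
  have : (Real.exp t)⁻¹ ≤ (1 + t + t ^ 2 / 2)⁻¹ := inv_anti₀ hp h
  refine this.trans ?_
  rw [inv_le_iff_one_le_mul₀ hp]
  nlinarith [sq_nonneg (t ^ 2)]

def lamc (δ D : ℝ) : ℝ := 1 / (2 * ((4 * D / δ ^ 2 + 4) + 1))

lemma lamc_pos {δ D : ℝ} (hδ : 0 < δ) (hD : 1 ≤ D) : 0 < lamc δ D := by
  unfold lamc; positivity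

lemma row_laplace {N : ℕ} {m : TI N → Measure ℂ} {δ D : ℝ} (hm : GoodM m δ D)
    (hδ : 0 < δ) (hD : 1 ≤ D) (G : Finset (Fin N)) (y : Fin N → ℂ)
    (hy : ∑ j ∈ G, ‖y j‖ ^ 2 = 1) (i : Fin N) (hi : i ∉ G) :
    ∫⁻ x, ENNReal.ofReal (Real.exp (-(lamc δ D) * ‖∑ j ∈ G, ent x i j * y j‖ ^ 2)) ∂(Measure.pi m) ≤
      ENNReal.ofReal (Real.exp (-(lamc δ D) / 2)) := by
  have := hm.prob
  have hne : ∀ j ∈ G, i ≠ j := fun j hj h => hi (h ▸ hj)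
  obtain ⟨h1, h2⟩ := quad_var hδ (b := fun j x => ent x i j) (fun j => hm.sg hδ i j)
    (hm.indep_row i) y G (fun j hj => hm.var' (hne j hj))
  have h3 := var_sum hδ (b := fun j x => ent x i j) (fun j => hm.sg hδ i j)
    (hm.indep_row i) G (fun j hj => hm.var' (hne j hj)) y
  simp only [smul_eq_mul, hy] at h1 h2
  have hin : ∑ l ∈ G, ∑ k ∈ G, ‖inner ℂ (y l) (y k)‖ ^ 2 = 1 := by
    have : ∀ l k, ‖inner ℂ (y l) (y k)‖ ^ 2 = ‖y l‖ ^ 2 * ‖y k‖ ^ 2 := by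
      intro l k
      rw [RCLike.inner_apply, norm_mul, RCLike.norm_conj]; ring
    simp only [this, ← Finset.mul_sum, ← Finset.sum_mul, hy]; norm_num
  rw [hin, mul_one] at h2
  rw [hy] at h3
  have hX : ∀ x : TI N → ℂ, ∑ l ∈ G, y l * ent x i l = ∑ l ∈ G, ent x i l * y l := fun x =>
    Finset.sum_congr rfl fun _ _ => mul_comm _ _
  simp only [hX] at h3
  set X : (TI N → ℂ) → ℝ := fun x => ‖∑ j ∈ G, ent x i j * y j‖ ^ 2 with hXd
  set W : (TI N → ℂ) → ℝ := fun x => X x - 1 with hW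
  have hWi : Integrable W (Measure.pi m) := h1.integrable (by norm_num)
  have hW2 : Integrable (fun x => W x ^ 2) (Measure.pi m) := h1.integrable_sq
  have hXi : Integrable X (Measure.pi m) := by
    have : X = fun x => W x + 1 := by ext x; simp [hW]
    rw [this]; exact hWi.add (integrable_const _)
  have hW0 : ∫ x, W x ∂(Measure.pi m) = 0 := by
    rw [hW, integral_sub hXi (integrable_const _)]
    rw [h3]; simp
  set L := lamc δ D with hL
  have hL0 : 0 < L := lamc_pos hδ hD
  have hL1 : L * ((4 * D / δ ^ 2 + 4) + 1) = 1 / 2 := by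
    rw [hL, lamc]; field_simp
  set Z : (TI N → ℂ) → ℝ := fun x => 1 - L - L * W x + L ^ 2 * (1 + W x ^ 2) with hZ
  have hZi : Integrable Z (Measure.pi m) :=
    ((integrable_const _).sub (hWi.const_mul L)).add (((integrable_const _).add hW2).const_mul _)
  have hpt : ∀ x, Real.exp (-L * X x) ≤ Z x := by
    intro x
    have hx0 : 0 ≤ X x := by positivity
    have := exp_neg_le_quad (t := L * X x) (by positivity)
    rw [← neg_mul] at this
    refine this.trans ?_
    have hWx : X x = 1 + W x := by simp [hW]
    rw [hZ]; simp only; rw [hWx]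
    nlinarith [mul_nonneg (sq_nonneg L) (sq_nonneg (1 - W x))]
  have hZint : ∫ x, Z x ∂(Measure.pi m) ≤ Real.exp (-L / 2) := by
    have e : ∫ x, Z x ∂(Measure.pi m) = 1 - L + L ^ 2 * (1 + ∫ x, W x ^ 2 ∂(Measure.pi m)) := by
      have i1 : Integrable (fun x => -L * W x) (Measure.pi m) := hWi.const_mul _
      have i2 : Integrable (fun x => L ^ 2 * W x ^ 2) (Measure.pi m) := hW2.const_mul _
      have i3 : Integrable (fun x => -L * W x + L ^ 2 * W x ^ 2) (Measure.pi m) := i1.add i2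
      have : Z = fun x => (1 - L + L ^ 2) + (-L * W x + L ^ 2 * W x ^ 2) := by
        ext x; simp only [hZ]; ring
      rw [this, integral_add (integrable_const _) i3, integral_add i1 i2,
        integral_const_mul, integral_const_mul, hW0]
      simp; ring
    rw [e]
    have h5 := Real.add_one_le_exp (-L / 2)
    have : L ^ 2 * (1 + ∫ x, W x ^ 2 ∂(Measure.pi m)) ≤ L * (L * ((4 * D / δ ^ 2 + 4) + 1)) := by
      rw [← mul_assoc, ← sq]
      exact mul_le_mul_of_nonneg_left (by linarith) (by positivity)
    rw [hL1] at this
    linarith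
  calc _ ≤ ∫⁻ x, ENNReal.ofReal (Z x) ∂(Measure.pi m) :=
        lintegral_mono fun x => ENNReal.ofReal_le_ofReal (hpt x)
    _ = ENNReal.ofReal (∫ x, Z x ∂(Measure.pi m)) :=
        (ofReal_integral_eq_lintegral_ofReal hZi (.of_forall fun x =>
          (Real.exp_pos _).le.trans (hpt x))).symm
    _ ≤ _ := ENNReal.ofReal_le_ofReal hZint

lemma rows_laplace {N : ℕ} {m : TI N → Measure ℂ} {δ D : ℝ} (hm : GoodM m δ D)
    (hδ : 0 < δ) (hD : 1 ≤ D) (G : Finset (Fin N)) (y : Fin N → ℂ)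
    (hy : ∑ j ∈ G, ‖y j‖ ^ 2 = 1) (R : Finset (Fin N)) (hR : ∀ i ∈ R, i ∉ G) :
    ∫⁻ x, ∏ i ∈ R, ENNReal.ofReal (Real.exp (-(lamc δ D) * ‖∑ j ∈ G, ent x i j * y j‖ ^ 2))
      ∂(Measure.pi m) ≤ ENNReal.ofReal (Real.exp (-(lamc δ D) / 2)) ^ R.card := by
  have := hm.prob
  have hmeas : ∀ i, Measurable fun x : TI N → ℂ =>
      ENNReal.ofReal (Real.exp (-(lamc δ D) * ‖∑ j ∈ G, ent x i j * y j‖ ^ 2)) := fun i => by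
    have : Continuous fun x : TI N → ℂ => (Real.exp (-(lamc δ D) * ‖∑ j ∈ G, ent x i j * y j‖ ^ 2)) := by
      have := fun j => ent_cont (N := N) i j
      fun_prop
    exact this.measurable.ennreal_ofReal
  induction R using Finset.induction_on with
  | empty => simp
  | insert n R hn ih =>
    simp only [Finset.prod_insert hn, Finset.card_insert_of_notMem hn]
    rw [lintegral_mul_dep {t | ∃ j ∈ G, t = tidx n j} m _ _ (hmeas n)
      (Finset.measurable_prod _ fun i _ => hmeas i)]
    · rw [pow_succ, mul_comm]
      exact mul_le_mul' (ih fun i hi => hR i (Finset.mem_insert_of_mem hi))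
        (row_laplace hm hδ hD G y hy n (hR n (Finset.mem_insert_self _ _)))
    · intro x x' h
      have : ∀ j ∈ G, ent x n j * y j = ent x' n j * y j := fun j hj => by
        unfold ent; rw [h _ ⟨j, hj, rfl⟩]
      rw [Finset.sum_congr rfl this]
    · intro x x' h
      refine Finset.prod_congr rfl fun i hi => ?_
      have : ∀ j ∈ G, ent x i j * y j = ent x' i j * y j := fun j hj => by
        unfold ent; rw [h _ ?_]
        rintro ⟨j', hj', he⟩
        rcases tidx_eq he with e | e
        · exact hn (e.1 ▸ hi)
        · exact hR i (Finset.mem_insert_of_mem hi) (e.1 ▸ hj')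
      rw [Finset.sum_congr rfl this]

lemma rows_tail {N : ℕ} {m : TI N → Measure ℂ} {δ D : ℝ} (hm : GoodM m δ D)
    (hδ : 0 < δ) (hD : 1 ≤ D) (G : Finset (Fin N)) (y : Fin N → ℂ)
    (hy : ∑ j ∈ G, ‖y j‖ ^ 2 = 1) (R : Finset (Fin N)) (hR : ∀ i ∈ R, i ∉ G) (s : ℝ) :
    Measure.pi m {x | ∑ i ∈ R, ‖∑ j ∈ G, ent x i j * y j‖ ^ 2 ≤ s} ≤
      ENNReal.ofReal (Real.exp (lamc δ D * s - lamc δ D * R.card / 2)) := by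
  have := hm.prob
  have hL0 : 0 < lamc δ D := lamc_pos hδ hD
  have h := rows_laplace hm hδ hD G y hy R hR
  set f : (TI N → ℂ) → ℝ≥0∞ := fun x => ∏ i ∈ R, ENNReal.ofReal (Real.exp (-(lamc δ D) * ‖∑ j ∈ G, ent x i j * y j‖ ^ 2)) with hf
  have hfe : ∀ x, f x = ENNReal.ofReal (Real.exp (-(lamc δ D) * ∑ i ∈ R, ‖∑ j ∈ G, ent x i j * y j‖ ^ 2)) := by
    intro x
    rw [hf]; simp only
    rw [← ENNReal.ofReal_prod_of_nonneg (fun _ _ => (Real.exp_pos _).le), ← Real.exp_sum, Finset.mul_sum]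
  have hsub : {x : TI N → ℂ | ∑ i ∈ R, ‖∑ j ∈ G, ent x i j * y j‖ ^ 2 ≤ s} ⊆
      {x | ENNReal.ofReal (Real.exp (-(lamc δ D) * s)) ≤ f x} := by
    intro x hx
    simp only [Set.mem_ofPred_eq] at hx ⊢
    rw [hfe]
    refine ENNReal.ofReal_le_ofReal (Real.exp_le_exp.mpr ?_)
    nlinarith
  have hpos : ENNReal.ofReal (Real.exp (-(lamc δ D) * s)) ≠ 0 := by
    simp [Real.exp_pos]
  have hmk := meas_ge_le_lintegral_div (μ := Measure.pi m) (f := f) (by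
    have : f = fun x => ENNReal.ofReal (Real.exp (-(lamc δ D) * ∑ i ∈ R, ‖∑ j ∈ G, ent x i j * y j‖ ^ 2)) := funext hfe
    rw [this]
    have : Continuous fun x : TI N → ℂ => (Real.exp (-(lamc δ D) * ∑ i ∈ R, ‖∑ j ∈ G, ent x i j * y j‖ ^ 2)) := by
      have := fun i j => ent_cont (N := N) i j
      fun_prop
    exact this.measurable.ennreal_ofReal.aemeasurable) hpos ENNReal.ofReal_ne_top
  refine (measure_mono hsub).trans (hmk.trans ((ENNReal.div_le_div_right h _).trans (le_of_eq ?_)))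
  rw [← ENNReal.ofReal_pow (Real.exp_pos _).le, ← ENNReal.ofReal_div_of_pos (Real.exp_pos _),
    ← Real.exp_nat_mul, ← Real.exp_sub]
  congr 2; ring

lemma net_G {N : ℕ} (G : Finset (Fin N)) (e : ℝ) (he : 0 < e) :
    ∃ s : Finset (Fin N → ℂ), (∀ c ∈ s, ∑ j ∈ G, ‖c j‖ ^ 2 = 1 ∧ ∀ j, j ∉ G → c j = 0) ∧
      (∀ v : Fin N → ℂ, (∀ j, j ∉ G → v j = 0) → ∑ j, ‖v j‖ ^ 2 = 1 →
        ∃ c ∈ s, ∑ j, ‖c j - v j‖ ^ 2 ≤ e ^ 2) ∧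
      (s.card : ℝ) ≤ (1 + 2 / e) ^ (2 * G.card) := by
  obtain ⟨s, hs1, hs2, hs3⟩ := aux_net (F := EuclideanSpace ℂ G) e he
  have hfr : Module.finrank ℝ (EuclideanSpace ℂ G) = 2 * G.card := by
    rw [← Module.finrank_mul_finrank ℝ ℂ (EuclideanSpace ℂ G)]
    simp
  rw [hfr] at hs3
  classical
  set ex : EuclideanSpace ℂ G → Fin N → ℂ := fun c j => if h : j ∈ G then c ⟨j, h⟩ else 0 with hex
  have hsum : ∀ f : Fin N → ℝ, ∑ j ∈ G, f j = ∑ j : G, f j := fun f => (Finset.sum_coe_sort G f).symm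
  refine ⟨s.image ex, ?_, ?_, ?_⟩
  · intro c hc
    obtain ⟨c, hc', rfl⟩ := Finset.mem_image.mp hc
    refine ⟨?_, fun j hj => by simp [hex, hj]⟩
    rw [hsum]
    have := hs1 c hc'
    have h2 := EuclideanSpace.norm_sq_eq c
    rw [this] at h2
    rw [show (1 : ℝ) = 1 ^ 2 by norm_num, h2]
    exact Finset.sum_congr rfl fun j _ => by simp [hex]
  · intro v hv hv1
    have hz : ∑ j, ‖v j‖ ^ 2 = ∑ j ∈ G, ‖v j‖ ^ 2 :=
      (Finset.sum_subset (Finset.subset_univ _) fun j _ hj => by simp [hv j hj]).symm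
    set v' : EuclideanSpace ℂ G := WithLp.toLp 2 fun j => v j with hv'
    have hn : ‖v'‖ = 1 := by
      rw [EuclideanSpace.norm_eq]
      have : ∑ i, ‖v' i‖ ^ 2 = 1 := by rw [← hv1, hz, hsum]
      rw [this]; simp
    obtain ⟨c, hc, hce⟩ := hs2 v' hn
    refine ⟨ex c, Finset.mem_image_of_mem _ hc, ?_⟩
    have h3 : ‖v' - c‖ ^ 2 ≤ e ^ 2 := pow_le_pow_left₀ (norm_nonneg _) hce 2
    rw [EuclideanSpace.norm_sq_eq] at h3
    refine le_trans (le_of_eq ?_) h3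
    rw [← Finset.sum_subset (Finset.subset_univ G) (fun j _ hj => by simp [hex, hj, hv j hj]), hsum]
    refine Finset.sum_congr rfl fun j _ => ?_
    rw [norm_sub_rev]; simp [hex, hv']
  · refine le_trans ?_ hs3
    exact_mod_cast Finset.card_image_le

lemma norm_add4_sq (a b c d : ℂ) : ‖a + b + c + d‖ ^ 2 ≤ 4 * (‖a‖ ^ 2 + ‖b‖ ^ 2 + ‖c‖ ^ 2 + ‖d‖ ^ 2) := by
  have h : ‖a + b + c + d‖ ≤ ‖a‖ + ‖b‖ + ‖c‖ + ‖d‖ :=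
    (norm_add_le _ _).trans (add_le_add_left ((norm_add_le _ _).trans (add_le_add_left (norm_add_le _ _) _)) _)
  have h2 := pow_le_pow_left₀ (norm_nonneg _) h 2
  nlinarith [sq_nonneg (‖a‖ - ‖b‖), sq_nonneg (‖a‖ - ‖c‖), sq_nonneg (‖a‖ - ‖d‖),
    sq_nonneg (‖b‖ - ‖c‖), sq_nonneg (‖b‖ - ‖d‖), sq_nonneg (‖c‖ - ‖d‖)]

lemma comp_det {N : ℕ} (hN : 0 < N) {C0 ρ τ E : ℝ} (hC0 : 0 < C0) (hρ : ρ = 1 / (40 * (C0 + 2)))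
    (hτ0 : 0 ≤ τ) (hτ : τ ≤ 1 / 32) (hE : |E| ≤ 2) {x : TI N → ℂ} (hx : x ∈ OpE C0)
    {u : Fin N → ℂ} (hu : ∑ j, ‖u j‖ ^ 2 = 1) {G S : Finset (Fin N)}
    (hG : ∑ j ∈ Gᶜ, ‖u j‖ ^ 2 ≤ ρ ^ 2)
    (hA : ∑ i ∈ S, ‖∑ j, Amat E x i j * u j‖ ^ 2 ≤ τ ^ 2) (s : Finset (Fin N → ℂ))
    (hs0 : ∀ c ∈ s, ∀ j, j ∉ G → c j = 0)
    (hs : ∀ v : Fin N → ℂ, (∀ j, j ∉ G → v j = 0) → ∑ j, ‖v j‖ ^ 2 = 1 →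
        ∃ c ∈ s, ∑ j, ‖c j - v j‖ ^ 2 ≤ ρ ^ 2) :
    ∃ c ∈ s, ∑ i ∈ S \ G, ‖∑ j ∈ G, ent x i j * c j‖ ^ 2 ≤ N / 16 := by
  have hρ0 : 0 < ρ := by rw [hρ]; positivity
  have hρC : ρ * (C0 + 2) = 1 / 40 := by rw [hρ]; field_simp
  have hρ1 : ρ ≤ 1 / 80 := by nlinarith
  have hNp : (0 : ℝ) < N := by exact_mod_cast hN
  set v : Fin N → ℂ := fun j => if j ∈ G then u j else 0 with hv
  have hvG : ∑ j, ‖v j‖ ^ 2 = ∑ j ∈ G, ‖u j‖ ^ 2 := by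
    rw [← Finset.sum_subset (Finset.subset_univ G) (fun j _ hj => by simp [hv, hj])]
    exact Finset.sum_congr rfl fun j hj => by simp [hv, hj]
  have huv : ∑ j, ‖u j - v j‖ ^ 2 ≤ ρ ^ 2 := by
    refine le_trans (le_of_eq ?_) hG
    rw [← Finset.sum_subset (Finset.subset_univ Gᶜ) (fun j _ hj => by
      simp only [Finset.mem_compl, not_not] at hj; simp [hv, hj])]
    exact Finset.sum_congr rfl fun j hj => by
      simp only [Finset.mem_compl] at hj; simp [hv, hj]
  have hspl := Finset.sum_add_sum_compl G (fun j => ‖u j‖ ^ 2)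
  rw [hu, ← hvG] at hspl
  set n2 := ∑ j, ‖v j‖ ^ 2 with hn2
  have hn2' : 1 / 4 ≤ n2 := by nlinarith
  set n := Real.sqrt n2 with hn
  have hnn : n ^ 2 = n2 := Real.sq_sqrt (by linarith)
  have hn0 : 0 < n := Real.sqrt_pos.mpr (by linarith)
  obtain ⟨c, hc, hcv⟩ := hs (fun j => v j / n) (fun j hj => by simp [hv, hj]) (by
    simp only [norm_div, div_pow, ← Finset.sum_div, Complex.norm_real, Real.norm_eq_abs, sq_abs]
    rw [hnn, ← hn2]; exact div_self (by linarith))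
  refine ⟨c, hc, ?_⟩
  set w : Fin N → ℂ := fun j => c j - v j / n with hw
  have hnc : (n : ℂ) ≠ 0 := by exact_mod_cast hn0.ne'
  have hsq0 : (Real.sqrt N : ℂ) ≠ 0 := by
    have := Real.sqrt_pos.mpr hNp
    exact_mod_cast this.ne'
  have hid : ∀ i ∈ S \ G, ∑ j ∈ G, ent x i j * c j =
      (∑ j, ent x i j * w j) + (Real.sqrt N / n) * (∑ j, Amat E x i j * u j)
      + (Real.sqrt N * E / n) * (u i - v i) + (-1 / n) * ∑ j, ent x i j * (u j - v j) := by
    intro i hi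
    have hiG : i ∉ G := (Finset.mem_sdiff.mp hi).2
    have e1 : ∑ j ∈ G, ent x i j * c j = ∑ j, ent x i j * c j :=
      Finset.sum_subset (Finset.subset_univ G) (fun j _ hj => by simp [hs0 c hc j hj])
    have e2 : ∑ j, Amat E x i j * u j = (∑ j, ent x i j * u j) / Real.sqrt N - E * u i := by
      simp only [Amat, sub_mul, Finset.sum_sub_distrib, Finset.sum_div, ite_mul, zero_mul]
      simp [div_mul_eq_mul_div]
    have e3 : v i = 0 := by simp [hv, hiG]
    have e4 : ∑ j, ent x i j * w j = ∑ j, ent x i j * c j - (∑ j, ent x i j * v j) / n := by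
      simp only [hw, mul_sub, Finset.sum_sub_distrib, Finset.sum_div, mul_div_assoc]
    have e5 : ∑ j, ent x i j * (u j - v j) = ∑ j, ent x i j * u j - ∑ j, ent x i j * v j := by
      simp only [mul_sub, Finset.sum_sub_distrib]
    rw [e1, e2, e3, e4, e5]
    field_simp
    ring
  have hop := hx
  have o1 := hop w
  have o2 := hop (fun j => u j - v j)
  have r1 : ∑ i ∈ S \ G, ‖∑ j, ent x i j * w j‖ ^ 2 ≤ C0 ^ 2 * N * ρ ^ 2 :=
    ((Finset.sum_le_sum_of_subset_of_nonneg (Finset.subset_univ _) fun _ _ _ => by positivity).trans o1).trans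
      (mul_le_mul_of_nonneg_left hcv (by positivity))
  have r2 : ∑ i ∈ S \ G, ‖∑ j, ent x i j * (u j - v j)‖ ^ 2 ≤ C0 ^ 2 * N * ρ ^ 2 :=
    ((Finset.sum_le_sum_of_subset_of_nonneg (Finset.subset_univ _) fun _ _ _ => by positivity).trans o2).trans
      (mul_le_mul_of_nonneg_left huv (by positivity))
  have r3 : ∑ i ∈ S \ G, ‖u i - v i‖ ^ 2 ≤ ρ ^ 2 :=
    (Finset.sum_le_sum_of_subset_of_nonneg (Finset.subset_univ _) fun _ _ _ => by positivity).trans huv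
  have r4 : ∑ i ∈ S \ G, ‖∑ j, Amat E x i j * u j‖ ^ 2 ≤ τ ^ 2 :=
    (Finset.sum_le_sum_of_subset_of_nonneg (Finset.sdiff_subset) fun _ _ _ => by positivity).trans hA
  have hninv : 1 / n2 ≤ 4 := by rw [div_le_iff₀ (by linarith)]; linarith
  have hsqN : Real.sqrt N ^ 2 = N := Real.sq_sqrt hNp.le
  have k1 : ‖((Real.sqrt N : ℂ) / n)‖ ^ 2 ≤ 4 * N := by
    rw [norm_div, Complex.norm_real, Complex.norm_real, div_pow, Real.norm_eq_abs, Real.norm_eq_abs, sq_abs, sq_abs, hsqN, hnn]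
    calc (N : ℝ) / n2 = (1 / n2) * N := by ring
      _ ≤ _ := by gcongr
  have hE2 : E ^ 2 ≤ 4 := by have := sq_le_sq' (abs_le.mp hE).1 (abs_le.mp hE).2; linarith
  have k2 : ‖((Real.sqrt N : ℂ) * E / n)‖ ^ 2 ≤ 16 * N := by
    rw [show ((Real.sqrt N : ℂ) * E / n) = ((Real.sqrt N : ℂ) / n) * E by ring, norm_mul, mul_pow,
      Complex.norm_real E, Real.norm_eq_abs, sq_abs]
    calc _ ≤ (4 * (N : ℝ)) * 4 := mul_le_mul k1 hE2 (by positivity) (by positivity)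
      _ = _ := by ring
  have k3 : ‖((-1 : ℂ) / n)‖ ^ 2 ≤ 4 := by
    rw [norm_div, Complex.norm_real, div_pow, Real.norm_eq_abs, sq_abs, hnn]
    simpa using hninv
  calc ∑ i ∈ S \ G, ‖∑ j ∈ G, ent x i j * c j‖ ^ 2
      ≤ ∑ i ∈ S \ G, 4 * (‖∑ j, ent x i j * w j‖ ^ 2 + 4 * N * ‖∑ j, Amat E x i j * u j‖ ^ 2
        + 16 * N * ‖u i - v i‖ ^ 2 + 4 * ‖∑ j, ent x i j * (u j - v j)‖ ^ 2) := by
        refine Finset.sum_le_sum fun i hi => ?_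
        rw [hid i hi]
        refine (norm_add4_sq _ _ _ _).trans ?_
        simp only [norm_mul _ (∑ j, Amat E x i j * u j), norm_mul _ (u i - v i),
          norm_mul _ (∑ j, ent x i j * (u j - v j)), mul_pow]
        gcongr
    _ = 4 * (∑ i ∈ S \ G, ‖∑ j, ent x i j * w j‖ ^ 2 + 4 * N * ∑ i ∈ S \ G, ‖∑ j, Amat E x i j * u j‖ ^ 2
        + 16 * N * ∑ i ∈ S \ G, ‖u i - v i‖ ^ 2 + 4 * ∑ i ∈ S \ G, ‖∑ j, ent x i j * (u j - v j)‖ ^ 2) := by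
        simp only [Finset.mul_sum, Finset.sum_add_distrib, mul_add]
    _ ≤ 4 * (C0 ^ 2 * N * ρ ^ 2 + 4 * N * τ ^ 2 + 16 * N * ρ ^ 2 + 4 * (C0 ^ 2 * N * ρ ^ 2)) := by gcongr
    _ = N * (20 * (ρ * C0) ^ 2 + 16 * τ ^ 2 + 64 * ρ ^ 2) := by ring
    _ ≤ N * (1 / 16) := by
        refine mul_le_mul_of_nonneg_left ?_ hNp.le
        have a1 : ρ * C0 ≤ 1 / 40 := by nlinarith
        have a2 : (ρ * C0) ^ 2 ≤ (1 / 40) ^ 2 := pow_le_pow_left₀ (by positivity) a1 2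
        have a3 : ρ ^ 2 ≤ (1 / 80) ^ 2 := pow_le_pow_left₀ hρ0.le hρ1 2
        have a4 : τ ^ 2 ≤ (1 / 32) ^ 2 := pow_le_pow_left₀ hτ0 hτ 2
        norm_num at a2 a3 a4 ⊢
        linarith
    _ = N / 16 := by ring


lemma sum_card_ofReal {α β : Type*} (A : Finset α) (s : α → Finset β) (y : ℝ) (_hy : 0 ≤ y) :
    ∑ G ∈ A, ∑ _c ∈ s G, ENNReal.ofReal y = ENNReal.ofReal ((∑ G ∈ A, ((s G).card : ℝ)) * y) := by
  simp only [Finset.sum_const, nsmul_eq_mul, ← Finset.sum_mul]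
  rw [ENNReal.ofReal_mul (Finset.sum_nonneg fun _ _ => Nat.cast_nonneg _),
    ENNReal.ofReal_sum_of_nonneg (fun _ _ => Nat.cast_nonneg _)]
  simp only [ENNReal.ofReal_natCast]

set_option maxHeartbeats 400000 in
lemma comp_bound (δ D : ℝ) (hδ : 0 < δ) (hD : 1 ≤ D) : ∃ ρ d c : ℝ, 0 < ρ ∧ 0 < d ∧ 0 < c ∧
    ∀ (N : ℕ) (m : TI N → Measure ℂ), 0 < N → GoodM m δ D → ∀ (E τ : ℝ) (S : Finset (Fin N)),
      |E| ≤ 2 → 0 ≤ τ → τ ≤ 1 / 32 → N ≤ 2 * S.card →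
      Measure.pi m (CompE E τ ρ (d * N) S) ≤ ENNReal.ofReal (3 * Real.exp (-c * N)) := by
  obtain ⟨C0, hC0, hop⟩ := op_bound δ D hδ hD
  set ρ : ℝ := 1 / (40 * (C0 + 2)) with hρ
  have hρ0 : 0 < ρ := by positivity
  set L := lamc δ D with hL
  have hL0 : 0 < L := lamc_pos hδ hD
  have hL1 : L ≤ 1 := by
    rw [hL, lamc, div_le_one (by positivity)]
    have : 0 ≤ 4 * D / δ ^ 2 := by positivity
    linarith
  set a : ℝ := (1 + 2 / ρ) ^ 2 with ha
  have ha1 : 1 ≤ a := by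
    have : 0 ≤ 2 / ρ := by positivity
    rw [ha]; nlinarith
  set t : ℝ := 64 * a / L with ht
  have ht1 : 1 ≤ t := by rw [ht, le_div_iff₀ hL0]; linarith
  have hlog : 0 ≤ Real.log t := Real.log_nonneg ht1
  set d : ℝ := min (1 / 4) (L / (64 * (Real.log t + 1))) with hd
  have hd0 : 0 < d := lt_min (by norm_num) (by positivity)
  have hd4 : d ≤ 1 / 4 := min_le_left _ _
  have hdl : d * Real.log t ≤ L / 64 := by
    calc _ ≤ (L / (64 * (Real.log t + 1))) * (Real.log t + 1) := by
          gcongr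
          · exact min_le_right _ _
          · linarith
      _ = _ := by field_simp
  refine ⟨ρ, d, L / 32, hρ0, hd0, by positivity, fun N m hN hm E τ S hE hτ0 hτ hS => ?_⟩
  have hNp : (0 : ℝ) < N := by exact_mod_cast hN
  have := hm.prob
  choose s hs1 hs2 hs3 using fun G : Finset (Fin N) => net_G G ρ hρ0
  set 𝒢 : Finset (Finset (Fin N)) := Finset.univ.filter fun G => (G.card : ℝ) < d * N with h𝒢
  have hsub : CompE E τ ρ (d * N) S ⊆ (OpE C0)ᶜ ∪ ⋃ G ∈ 𝒢, ⋃ c ∈ s G,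
      {x | ∑ i ∈ S \ G, ‖∑ j ∈ G, ent x i j * c j‖ ^ 2 ≤ N / 16} := by
    intro x hx
    by_cases hxo : x ∈ OpE C0
    · right
      obtain ⟨u, G, h1, h2, h3, h4⟩ := hx
      obtain ⟨c, hc, hh⟩ := comp_det hN hC0 hρ hτ0 hτ hE hxo h1 h3 h4 (s G)
        (fun c hc => (hs1 G c hc).2) (hs2 G)
      simp only [Set.mem_iUnion]
      exact ⟨G, by simp [h𝒢, h2], c, hc, hh⟩
    · left; exact hxo
  have hone : ∀ G ∈ 𝒢, ∀ c ∈ s G, Measure.pi m {x | ∑ i ∈ S \ G, ‖∑ j ∈ G, ent x i j * c j‖ ^ 2 ≤ N / 16}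
      ≤ ENNReal.ofReal (Real.exp (-(L * N / 16))) := by
    intro G hG c hc
    have hG' : (G.card : ℝ) < d * N := by simpa [h𝒢] using hG
    refine (rows_tail hm hδ hD G c (hs1 G c hc).1 (S \ G) (fun i hi => (Finset.mem_sdiff.mp hi).2) _).trans
      (ENNReal.ofReal_le_ofReal (Real.exp_le_exp.mpr ?_))
    rw [← hL]
    have h1 : S.card ≤ (S \ G).card + G.card := by
      have := Finset.le_card_sdiff G S; omega
    have h2 : (S.card : ℝ) ≤ ((S \ G).card : ℝ) + G.card := by exact_mod_cast h1
    have h3 : (N : ℝ) ≤ 2 * S.card := by exact_mod_cast hS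
    have h4 : (N : ℝ) / 4 ≤ ((S \ G).card : ℝ) := by nlinarith
    nlinarith
  have hcount : ∑ G ∈ 𝒢, ((s G).card : ℝ) ≤ Real.exp (L * N / 32) := by
    calc ∑ G ∈ 𝒢, ((s G).card : ℝ) ≤ ∑ G ∈ 𝒢, t ^ (d * N) * ((a / t) ^ G.card * 1 ^ (Fintype.card (Fin N) - G.card)) := by
          refine Finset.sum_le_sum fun G hG => ?_
          have hG' : (G.card : ℝ) < d * N := by simpa [h𝒢] using hG
          refine (hs3 G).trans ?_
          rw [pow_mul, ← ha, one_pow, mul_one, div_pow, mul_div_assoc', le_div_iff₀ (by positivity), mul_comm]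
          gcongr
          rw [← Real.rpow_natCast]
          exact Real.rpow_le_rpow_of_exponent_le ht1 hG'.le
      _ ≤ ∑ G : Finset (Fin N), t ^ (d * N) * ((a / t) ^ G.card * 1 ^ (Fintype.card (Fin N) - G.card)) :=
          Finset.sum_le_sum_of_subset_of_nonneg (Finset.subset_univ _) fun _ _ _ => by positivity
      _ = t ^ (d * N) * (a / t + 1) ^ N := by
          rw [← Finset.mul_sum, Fintype.sum_pow_mul_eq_add_pow, Fintype.card_fin]
      _ ≤ Real.exp (L / 64 * N) * Real.exp (L / 64) ^ N := by
          have hat : a / t = L / 64 := by rw [ht]; field_simp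
          rw [hat]
          have e1 : t ^ (d * N) ≤ Real.exp (L / 64 * N) := by
            rw [Real.rpow_def_of_pos (by linarith)]
            refine Real.exp_le_exp.mpr ?_
            calc _ = (d * Real.log t) * N := by ring
              _ ≤ _ := by gcongr
          have e2 := Real.add_one_le_exp (L / 64)
          gcongr
      _ = _ := by rw [← Real.exp_nat_mul, ← Real.exp_add]; congr 1; ring
  calc _ ≤ Measure.pi m (OpE C0)ᶜ + ∑ G ∈ 𝒢, ∑ c ∈ s G, ENNReal.ofReal (Real.exp (-(L * N / 16))) := by
        refine (measure_mono hsub).trans ((measure_union_le _ _).trans (add_le_add le_rfl ?_))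
        refine (measure_biUnion_finset_le _ _).trans (Finset.sum_le_sum fun G hG => ?_)
        exact (measure_biUnion_finset_le _ _).trans (Finset.sum_le_sum fun c hc => hone G hG c hc)
    _ = Measure.pi m (OpE C0)ᶜ + ENNReal.ofReal ((∑ G ∈ 𝒢, ((s G).card : ℝ)) * Real.exp (-(L * N / 16))) := by
        rw [sum_card_ofReal 𝒢 s _ (Real.exp_pos _).le]
    _ ≤ ENNReal.ofReal (2 * Real.exp (-(N : ℝ))) + ENNReal.ofReal (Real.exp (-(L / 32) * N)) := by
        refine add_le_add (hop N m hm) (ENNReal.ofReal_le_ofReal ?_)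
        calc _ ≤ Real.exp (L * N / 32) * Real.exp (-(L * N / 16)) := by gcongr
          _ = _ := by rw [← Real.exp_add]; congr 1; ring
    _ ≤ _ := by
        rw [← ENNReal.ofReal_add (by positivity) (by positivity)]
        refine ENNReal.ofReal_le_ofReal ?_
        have : Real.exp (-(N : ℝ)) ≤ Real.exp (-(L / 32) * N) := Real.exp_le_exp.mpr (by nlinarith)
        linarith

lemma quarter_facts {K r : ℕ} (hK : 8 ≤ K) (hr : K / 4 ≤ r) :
    0 < r ∧ (K : ℝ) / 8 ≤ r ∧ 3 * (K : ℝ) / 4 ≤ ((K - K / 4 : ℕ) : ℝ) := by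
  refine ⟨by omega, ?_, ?_⟩
  · rw [div_le_iff₀ (by norm_num)]; exact_mod_cast (by omega : K ≤ r * 8)
  · rw [div_le_iff₀ (by norm_num)]; exact_mod_cast (by omega : 3 * K ≤ (K - K / 4) * 4)

lemma tail_r1 (δ D : ℝ) (hδ : 0 < δ) (hD : 1 ≤ D) : ∃ A c : ℝ, 0 < A ∧ 0 < c ∧
    ∀ (N : ℕ) (m : TI N → Measure ℂ), 0 < N → GoodM m δ D → ∀ (E τ : ℝ) (K : ℕ),
      |E| ≤ 2 → 0 ≤ τ → A ≤ K → A * (N * τ) ≤ K → K ^ 4 ≤ N ^ 3 →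
      Measure.pi m (Bad E τ (Finset.univ : Finset (Fin N)) K) ≤
        ENNReal.ofReal ((A / K) ^ ((K : ℝ) / 2)) + ENNReal.ofReal (3 * K * Real.exp (-c * N)) := by
  obtain ⟨ρ, d, c, hρ, hd, hc, hcomp⟩ := comp_bound δ D hδ hD
  set C := 4 * D / δ ^ 2 + 4 with hC
  have hC0 : 0 < C := by positivity
  set A : ℝ := 32 + 32 / ρ + 32 * C / d with hA
  have hA1 : 32 ≤ A := by
    have : 0 ≤ 32 / ρ := by positivity
    have : 0 ≤ 32 * C / d := by positivity
    linarith
  have hA2 : 32 / ρ ≤ A := by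
    have : 0 ≤ 32 * C / d := by positivity
    linarith
  have hA3 : 32 * C / d ≤ A := by
    have : 0 ≤ 32 / ρ := by positivity
    linarith
  refine ⟨A, c, by linarith, hc, fun N m hN hm E τ K hE hτ hAK hAτ hreg => ?_⟩
  have hNp : (0 : ℝ) < N := by exact_mod_cast hN
  have hK8' : (32 : ℝ) ≤ K := by linarith
  have hK8 : 32 ≤ K := by exact_mod_cast hK8'
  have hKp : (0 : ℝ) < K := by linarith
  have h2K : 2 * K ≤ N := by
    by_contra h
    push Not at h
    have h1 : N ^ 3 < (2 * K) ^ 3 := Nat.pow_lt_pow_left h (by norm_num)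
    have h2 : (2 * K) ^ 3 ≤ K ^ 4 := by
      calc (2 * K) ^ 3 = 8 * K ^ 3 := by ring
        _ ≤ K * K ^ 3 := Nat.mul_le_mul_right _ (by omega)
        _ = _ := by ring
    omega
  have h2K' : 2 * (K : ℝ) ≤ N := by exact_mod_cast h2K
  have hτ1 : τ ≤ 1 / 32 := by
    by_contra h
    push Not at h
    have : 32 * (N * (1 / 32 : ℝ)) ≤ A * (N * τ) := by gcongr
    linarith
  have := hm.prob
  set f : ℝ := A / K with hf
  have hf1 : f ≤ 1 := (div_le_one hKp).mpr hAK
  have hf0 : 0 < f := by positivity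
  have hrec := rec_bound (m := m) (E := E) (τ := τ) K (K / 4) (Nat.div_le_self _ _)
    (ENNReal.ofReal (3 * Real.exp (-c * N))) (ENNReal.ofReal f) (by simpa using hf1) (by
      intro S r B hr0 hrK hS hB
      obtain ⟨hr, hr8, -⟩ := quarter_facts (by omega) hr0
      have hrp : (0 : ℝ) < r := by exact_mod_cast hr
      have hθ : 0 < ρ ^ 2 * ((r + 1 : ℕ) : ℝ) / N := by positivity
      have hms := markov_step hr hm hδ (E := E) (τ := τ) hθ (S := S) hN (by
        rw [div_le_iff₀ hθ]
        have h1 : N * τ ≤ K / A := by rw [le_div_iff₀ (by linarith)]; linarith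
        have h2 : (K : ℝ) / A ≤ ρ * K / 32 := by
          rw [div_le_div_iff₀ (by linarith) (by norm_num)]
          have : 32 ≤ A * ρ := by rwa [div_le_iff₀ hρ] at hA2
          nlinarith
        have h3 : N * τ ≤ ρ * r / 4 := by
          refine (h1.trans h2).trans ?_
          nlinarith
        have h4 : (N * τ) ^ 2 ≤ (ρ * r / 4) ^ 2 := pow_le_pow_left₀ (by positivity) h3 2
        have h5 : 4 * N * τ ^ 2 = 4 * (N * τ) ^ 2 / N := by field_simp
        rw [h5, mul_div_assoc', div_le_div_iff_of_pos_right hNp]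
        push_cast
        nlinarith [mul_pos (pow_pos hρ 2) hrp, mul_pos (mul_pos (pow_pos hρ 2) hrp) hrp])
        (CompE E τ ρ (d * N) S) (g := d * N) (by positivity)
        (fun x w hw hx => good_count1 (Nat.succ_pos r) hN hw hx) B hB
      refine hms.trans (add_le_add (hcomp N m hN hm E τ S hE hτ hτ1 (by omega)) ?_)
      refine mul_le_mul' (ENNReal.ofReal_le_ofReal ?_) le_rfl
      rw [← hC, hf]
      calc N * (4 * C / r) / (d * N) = 4 * C / d / r := by field_simp
        _ ≤ 4 * C / d / (K / 8) := by gcongr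
        _ = 32 * C / d / K := by field_simp; ring
        _ ≤ _ := by gcongr)
  refine hrec.trans (add_le_add ?_ ?_)
  · rw [← ENNReal.ofReal_pow hf0.le]
    refine ENNReal.ofReal_le_ofReal ?_
    rw [← Real.rpow_natCast]
    refine Real.rpow_le_rpow_of_exponent_ge hf0 hf1 ?_
    have := (quarter_facts (K := K) (by omega) le_rfl).2.2
    linarith
  · rw [show (3 * K * Real.exp (-c * N)) = (K : ℝ) * (3 * Real.exp (-c * N)) by ring,
      ENNReal.ofReal_mul hKp.le, ENNReal.ofReal_natCast]
    refine mul_le_mul' ?_ le_rfl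
    exact_mod_cast Nat.sub_le _ _

lemma tail_r2 (δ D : ℝ) (hδ : 0 < δ) (hD : 1 ≤ D) : ∃ A : ℝ, 0 < A ∧
    ∀ (N : ℕ) (m : TI N → Measure ℂ), 0 < N → GoodM m δ D → ∀ (E τ : ℝ) (K : ℕ),
      0 ≤ τ → A ≤ K → A * (N * τ) ≤ K → N ^ 3 ≤ K ^ 4 →
      Measure.pi m (Bad E τ (Finset.univ : Finset (Fin N)) K) ≤
        ENNReal.ofReal ((A / K) ^ ((K : ℝ) / 2)) := by
  set C := 4 * D / δ ^ 2 + 4 with hC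
  have hC0 : 4 ≤ C := by
    have : 0 ≤ 4 * D / δ ^ 2 := by positivity
    linarith
  set C5 : ℝ := 512 * C with hC5
  set A : ℝ := C5 ^ 2 with hA
  have hC51 : 1 ≤ C5 := by linarith
  have hA1 : 32 ≤ A := by rw [hA]; nlinarith
  refine ⟨A, by linarith, fun N m hN hm E τ K hτ hAK hAτ hreg => ?_⟩
  have hNp : (0 : ℝ) < N := by exact_mod_cast hN
  have hK8' : (32 : ℝ) ≤ K := by linarith
  have hK8 : 32 ≤ K := by exact_mod_cast hK8'
  have hKp : (0 : ℝ) < K := by linarith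
  have := hm.prob
  have hNK : (N : ℝ) ≤ (K : ℝ) ^ (4 / 3 : ℝ) := by
    have h1 : (N : ℝ) ^ 3 ≤ (K : ℝ) ^ 4 := by exact_mod_cast hreg
    have h2 : ((K : ℝ) ^ (4 / 3 : ℝ)) ^ 3 = (K : ℝ) ^ 4 := by
      rw [← Real.rpow_natCast, ← Real.rpow_mul hKp.le]; norm_num
    rw [← h2] at h1
    exact le_of_pow_le_pow_left₀ (by norm_num) (by positivity) h1
  set f : ℝ := C5 * (K : ℝ) ^ (-(2 / 3) : ℝ) with hf
  have hf0 : 0 < f := by positivity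
  have hfeq : f ≤ (A / K) ^ (2 / 3 : ℝ) := by
    rw [hf, Real.div_rpow (by positivity) hKp.le, Real.rpow_neg hKp.le, ← div_eq_mul_inv]
    gcongr
    rw [hA, ← Real.rpow_natCast, ← Real.rpow_mul (by linarith)]
    calc C5 = C5 ^ (1 : ℝ) := by simp
      _ ≤ _ := Real.rpow_le_rpow_of_exponent_le hC51 (by norm_num)
  have hAK0 : 0 < A / K := by positivity
  have hAK1 : A / K ≤ 1 := (div_le_one hKp).mpr hAK
  have hf1 : f ≤ 1 := hfeq.trans (Real.rpow_le_one hAK0.le hAK1 (by norm_num))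
  have hrec := rec_bound (m := m) (E := E) (τ := τ) K (K / 4) (Nat.div_le_self _ _)
    0 (ENNReal.ofReal f) (by simpa using hf1) (by
      intro S r B hr0 hrK hS hB
      obtain ⟨hr, hr8, -⟩ := quarter_facts (by omega) hr0
      have hrp : (0 : ℝ) < r := by exact_mod_cast hr
      have hθ : 0 < ((r + 1 : ℕ) : ℝ) / (2 * N) := by positivity
      have hms := markov_step hr hm hδ (E := E) (τ := τ) hθ (S := S) hN (by
        rw [div_le_iff₀ hθ]
        have h1 : 32 * (N * τ) ≤ K := le_trans (by gcongr) hAτ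
        have h3 : N * τ ≤ r / 4 := by linarith
        have h4 : (N * τ) ^ 2 ≤ (r / 4) ^ 2 := pow_le_pow_left₀ (by positivity) h3 2
        have h5 : 4 * N * τ ^ 2 = 8 * (N * τ) ^ 2 / (2 * N) := by field_simp; ring
        rw [h5, mul_div_assoc', div_le_div_iff_of_pos_right (by positivity)]
        push_cast
        nlinarith)
        ∅ (g := ((r + 1 : ℕ) : ℝ) / 2) (by positivity)
        (fun x w hw hx => good_count2 hN hw) B hB
      refine hms.trans (add_le_add (by simp) ?_)
      refine mul_le_mul' (ENNReal.ofReal_le_ofReal ?_) le_rfl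
      rw [← hC, hf]
      calc N * (4 * C / r) / (((r + 1 : ℕ) : ℝ) / 2) = 8 * C * N / (r * (r + 1 : ℝ)) := by
            push_cast; field_simp; ring
        _ ≤ 8 * C * (K : ℝ) ^ (4 / 3 : ℝ) / (K / 8 * (K / 8)) := by
            gcongr; linarith
        _ = C5 * ((K : ℝ) ^ (4 / 3 : ℝ) / (K : ℝ) ^ (2 : ℝ)) := by
            rw [show ((2 : ℝ)) = ((2 : ℕ) : ℝ) by norm_num, Real.rpow_natCast, hC5]; field_simp; norm_num
        _ = _ := by rw [← Real.rpow_sub hKp]; norm_num)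
  refine hrec.trans ?_
  rw [mul_zero, add_zero, ← ENNReal.ofReal_pow hf0.le]
  refine ENNReal.ofReal_le_ofReal ?_
  refine (pow_le_pow_left₀ hf0.le hfeq _).trans ?_
  rw [← Real.rpow_natCast, ← Real.rpow_mul hAK0.le]
  refine Real.rpow_le_rpow_of_exponent_ge hAK0 hAK1 ?_
  have := (quarter_facts (K := K) (by omega) le_rfl).2.2
  linarith

lemma eps_bound {c : ℝ} (hc : 0 < c) {K N : ℕ} (hK : 1 ≤ K) (h : K ^ 4 ≤ N ^ 3) :
    3 * K * Real.exp (-c * N) ≤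
      (Real.exp (4 + 3 * Real.log (3 / (2 * c))) / K) ^ ((K : ℝ) / 2) := by
  have hK1 : (1 : ℝ) ≤ K := by exact_mod_cast hK
  have hKp : (0 : ℝ) < K := by linarith
  set z : ℝ := (K : ℝ) ^ (1 / 3 : ℝ) with hz
  have hz0 : 0 < z := by positivity
  have hz3 : z ^ 3 = K := by
    rw [hz, ← Real.rpow_natCast, ← Real.rpow_mul hKp.le]; norm_num
  have hN : z ^ 4 ≤ N := by
    have h1 : (K : ℝ) ^ 4 ≤ (N : ℝ) ^ 3 := by exact_mod_cast h
    have h2 : (z ^ 4) ^ 3 = (K : ℝ) ^ 4 := by rw [← hz3]; ring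
    rw [← h2] at h1
    exact le_of_pow_le_pow_left₀ (by norm_num) (by positivity) h1
  have hlogK : Real.log K = 3 * Real.log z := by
    rw [← hz3, Real.log_pow]; norm_num
  have hl : Real.log z ≤ 2 * c * z / 3 + Real.log (3 / (2 * c)) := by
    have e : z = (2 * c * z / 3) * (3 / (2 * c)) := by field_simp
    have := Real.log_mul (x := 2 * c * z / 3) (y := 3 / (2 * c)) (by positivity) (by positivity)
    rw [← e] at this
    have h3 := Real.log_le_sub_one_of_pos (x := 2 * c * z / 3) (by positivity)
    linarith
  have h3K : 3 * (K : ℝ) ≤ Real.exp (2 * K) := by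
    have := Real.quadratic_le_exp_of_nonneg (x := 2 * K) (by positivity)
    nlinarith
  rw [Real.rpow_def_of_pos (by positivity), Real.log_div (Real.exp_pos _).ne' hKp.ne', Real.log_exp, hlogK]
  calc _ ≤ Real.exp (2 * K) * Real.exp (-c * z ^ 4) := by
        gcongr ?_ * Real.exp ?_
        nlinarith
    _ = Real.exp (2 * K - c * z ^ 4) := by rw [← Real.exp_add]; congr 1; ring
    _ ≤ _ := by
        refine Real.exp_le_exp.mpr ?_
        have : z ^ 4 = K * z := by rw [← hz3]; ring
        rw [this]
        nlinarith

lemma tail_K (δ D : ℝ) (hδ : 0 < δ) (hD : 1 ≤ D) : ∃ A : ℝ, 1 ≤ A ∧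
    ∀ (N : ℕ) (m : TI N → Measure ℂ), 0 < N → GoodM m δ D → ∀ (E τ : ℝ) (K : ℕ),
      |E| ≤ 2 → 0 ≤ τ → A ≤ K → A * (N * τ) ≤ K →
      Measure.pi m (Bad E τ (Finset.univ : Finset (Fin N)) K) ≤
        ENNReal.ofReal ((A / K) ^ ((K : ℝ) / 2)) := by
  obtain ⟨A1, c, hA1, hc, h1⟩ := tail_r1 δ D hδ hD
  obtain ⟨A2, hA2, h2⟩ := tail_r2 δ D hδ hD
  set B := Real.exp (4 + 3 * Real.log (3 / (2 * c))) with hB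
  have hB0 : 0 < B := Real.exp_pos _
  set A' := A1 + A2 + B + 1 with hA'
  refine ⟨4 * A', by linarith, fun N m hN hm E τ K hE hτ hAK hAτ => ?_⟩
  have hNτ : 0 ≤ N * τ := by positivity
  have hKp : (0 : ℝ) < K := by linarith
  have hK1 : 1 ≤ K := by exact_mod_cast hKp
  have hbig : 2 * (A' / K) ^ ((K : ℝ) / 2) ≤ (4 * A' / K) ^ ((K : ℝ) / 2) := by
    rw [mul_div_assoc, Real.mul_rpow (by norm_num) (by positivity)]
    gcongr
    rw [show (4 : ℝ) = 2 ^ (2 : ℝ) by norm_num, ← Real.rpow_mul (by norm_num)]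
    rw [mul_div_cancel₀ _ (by norm_num)]
    calc (2 : ℝ) = 2 ^ (1 : ℝ) := by simp
      _ ≤ _ := Real.rpow_le_rpow_of_exponent_le (by norm_num) (by exact_mod_cast hK1)
  rcases le_total (K ^ 4) (N ^ 3) with hreg | hreg
  · refine (h1 N m hN hm E τ K hE hτ (by linarith) (by nlinarith) hreg).trans ?_
    rw [← ENNReal.ofReal_add (by positivity) (by positivity)]
    refine ENNReal.ofReal_le_ofReal (le_trans ?_ hbig)
    have e1 : (A1 / K) ^ ((K : ℝ) / 2) ≤ (A' / K) ^ ((K : ℝ) / 2) := by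
      gcongr; linarith
    have e2 : (B / K) ^ ((K : ℝ) / 2) ≤ (A' / K) ^ ((K : ℝ) / 2) := by
      gcongr; linarith
    have e3 := eps_bound hc hK1 hreg
    linarith
  · refine (h2 N m hN hm E τ K hτ (by linarith) (by nlinarith) hreg).trans ?_
    refine ENNReal.ofReal_le_ofReal ?_
    gcongr; linarith

lemma abs_tail {Ω : Type*} [MeasurableSpace Ω] {P : Measure Ω} [IsProbabilityMeasure P] (n : Ω → ℕ)
    {A T : ℝ} (hA : 1 ≤ A) (hT : 1 ≤ T)
    (h : ∀ K : ℕ, A * T ≤ K → P {ω | K ≤ n ω} ≤ ENNReal.ofReal ((A / K) ^ ((K : ℝ) / 2)))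
    {C M nu : ℝ} (hC : A ≤ C) (hM : 2 ≤ M) (hnu : 0 < nu) (hnu2 : nu ≤ 1 / 2) :
    P {ω | M ≤ (n ω : ℝ) / T} ≤ ENNReal.ofReal ((C / M) ^ (nu * M * T)) := by
  rcases le_total M A with hMA | hMA
  · refine prob_le_one.trans ?_
    rw [ENNReal.one_le_ofReal]
    exact Real.one_le_rpow ((one_le_div (by linarith)).mpr (by linarith)) (by positivity)
  · set K := ⌈M * T⌉₊ with hK
    have hMK : M * T ≤ K := Nat.le_ceil _
    have hMK' : M ≤ K := le_trans (by nlinarith) hMK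
    refine le_trans (measure_mono ?_) ((h K (le_trans (by gcongr) hMK)).trans (ENNReal.ofReal_le_ofReal ?_))
    · intro ω hω
      simp only [Set.mem_ofPred_eq] at hω ⊢
      rw [le_div_iff₀ (by linarith)] at hω
      exact Nat.ceil_le.mpr hω
    · have hKp : (0 : ℝ) < K := by linarith
      calc (A / K) ^ ((K : ℝ) / 2) ≤ (A / K) ^ (nu * M * T) := by
            refine Real.rpow_le_rpow_of_exponent_ge (by positivity) ((div_le_one hKp).mpr (by linarith)) ?_
            have : nu * M * T = nu * (M * T) := by ring
            rw [this]
            calc nu * (M * T) ≤ 1 / 2 * K := by gcongr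
              _ = _ := by ring
        _ ≤ _ := by gcongr; linarith

lemma add_rpow_le_two {a b p : ℝ} (ha : 0 ≤ a) (hb : 0 ≤ b) (hp : 0 ≤ p) :
    (a + b) ^ p ≤ 2 ^ p * (a ^ p + b ^ p) := by
  rw [mul_add, ← Real.mul_rpow (by norm_num) ha, ← Real.mul_rpow (by norm_num) hb]
  have ha' : 0 ≤ (2 * a) ^ p := by positivity
  have hb' : 0 ≤ (2 * b) ^ p := by positivity
  rcases le_total a b with h | h
  · have : (a + b) ^ p ≤ (2 * b) ^ p := by gcongr; linarith
    linarith
  · have : (a + b) ^ p ≤ (2 * a) ^ p := by gcongr; linarith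
    linarith

lemma rpow_le_exp {y p : ℝ} (hy : 0 ≤ y) (hp : 1 ≤ p) : y ^ p ≤ p ^ p * Real.exp y := by
  have h : y / p ≤ Real.exp (y / p) := by linarith [Real.add_one_le_exp (y / p)]
  have h2 := Real.rpow_le_rpow (by positivity) h (by linarith : 0 ≤ p)
  rw [Real.div_rpow hy (by linarith), ← Real.exp_mul, div_mul_cancel₀ _ (by linarith), div_le_iff₀ (by positivity)] at h2
  linarith

lemma abs_exp {Ω : Type*} [MeasurableSpace Ω] {P : Measure Ω} [IsProbabilityMeasure P] (n : Ω → ℕ)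
    (K0 : ℕ) (h : ∀ K : ℕ, K0 ≤ K → P {ω | K ≤ n ω} ≤ ENNReal.ofReal (Real.exp (-2 * K))) :
    ∫⁻ ω, ENNReal.ofReal (Real.exp ((n ω - K0 : ℕ) : ℝ)) ∂P ≤ 2 := by
  set s : ℕ → Set Ω := fun j => toMeasurable P {ω | K0 + (j + 1) ≤ n ω} with hs
  have hpt : ∀ ω, ENNReal.ofReal (Real.exp ((n ω - K0 : ℕ) : ℝ)) ≤
      1 + ∑' j : ℕ, ENNReal.ofReal (Real.exp ((j + 1 : ℕ) : ℝ)) * (s j).indicator 1 ω := by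
    intro ω
    rcases Nat.eq_zero_or_pos (n ω - K0) with h0 | h0
    · rw [h0]; simp
    · obtain ⟨j, hj⟩ : ∃ j, n ω - K0 = j + 1 := ⟨n ω - K0 - 1, by omega⟩
      refine le_trans ?_ ((ENNReal.le_tsum j).trans le_add_self)
      have : ω ∈ s j := subset_toMeasurable _ _ (by
        simp only [Set.mem_ofPred_eq]; omega)
      rw [hj, Set.indicator_of_mem this]; simp
  have hmeas : ∀ j, Measurable fun ω => ENNReal.ofReal (Real.exp ((j + 1 : ℕ) : ℝ)) * (s j).indicator 1 ω := fun j =>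
    (measurable_one.indicator (measurableSet_toMeasurable _ _)).const_mul _
  refine (lintegral_mono hpt).trans ?_
  rw [lintegral_add_left measurable_const, lintegral_tsum fun j => (hmeas j).aemeasurable]
  have hterm : ∀ j, ∫⁻ ω, ENNReal.ofReal (Real.exp ((j + 1 : ℕ) : ℝ)) * (s j).indicator 1 ω ∂P ≤ (1 / 2) ^ (j + 1) := by
    intro j
    rw [lintegral_const_mul _ (measurable_one.indicator (measurableSet_toMeasurable _ _)),
      lintegral_indicator_one (measurableSet_toMeasurable _ _), measure_toMeasurable]
    calc _ ≤ ENNReal.ofReal (Real.exp ((j + 1 : ℕ) : ℝ)) * ENNReal.ofReal (Real.exp (-2 * (K0 + (j + 1) : ℕ))) :=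
          mul_le_mul' le_rfl (h _ (by omega))
      _ = ENNReal.ofReal (Real.exp ((j + 1 : ℕ) : ℝ) * Real.exp (-2 * (K0 + (j + 1) : ℕ))) :=
          (ENNReal.ofReal_mul (Real.exp_pos _).le).symm
      _ ≤ ENNReal.ofReal ((1 / 2) ^ (j + 1)) := by
          refine ENNReal.ofReal_le_ofReal ?_
          have e1 : Real.exp (-1) ≤ 1 / 2 := by
            rw [Real.exp_neg, one_div]
            exact inv_anti₀ (by norm_num) (by linarith [Real.add_one_le_exp 1])
          calc _ ≤ Real.exp (-1) ^ (j + 1) := by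
                rw [← Real.exp_add, ← Real.exp_nat_mul]
                refine Real.exp_le_exp.mpr ?_
                have : (0 : ℝ) ≤ K0 := by positivity
                push_cast; linarith
            _ ≤ _ := pow_le_pow_left₀ (Real.exp_pos _).le e1 _
      _ = _ := by
          rw [ENNReal.ofReal_pow (by norm_num)]
          congr 1
          rw [ENNReal.ofReal_div_of_pos (by norm_num)]; simp
  refine (add_le_add le_rfl (ENNReal.tsum_le_tsum hterm)).trans ?_
  rw [ENNReal.tsum_geometric_add_one]
  simp
  rw [ENNReal.inv_mul_cancel (by norm_num) (by norm_num)]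
  norm_num

lemma abs_mom {Ω : Type*} [MeasurableSpace Ω] {P : Measure Ω} [IsProbabilityMeasure P] (n : Ω → ℕ)
    {A T : ℝ} (hA : 1 ≤ A) (hT : 1 ≤ T)
    (h : ∀ K : ℕ, A * T ≤ K → P {ω | K ≤ n ω} ≤ ENNReal.ofReal ((A / K) ^ ((K : ℝ) / 2)))
    {C p : ℝ} (hC : 6 * (A * Real.exp 4 + 1) ≤ C) (hp : 1 ≤ p) :
    ∫⁻ ω, ENNReal.ofReal (((n ω : ℝ) / T) ^ p) ∂P ≤ ENNReal.ofReal (C ^ p * (1 + p / T) ^ p) := by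
  set K0 := ⌈A * Real.exp 4 * T⌉₊ with hK0
  have he4 : (1 : ℝ) ≤ Real.exp 4 := Real.one_le_exp (by norm_num)
  have hTp : 0 < T := by linarith
  have hpp : 0 < p := by linarith
  have hK0l : A * Real.exp 4 * T ≤ K0 := Nat.le_ceil _
  have hK0u : (K0 : ℝ) ≤ (A * Real.exp 4 + 1) * T := by
    have := (Nat.ceil_lt_add_one (a := A * Real.exp 4 * T) (by positivity)).le
    rw [← hK0] at this
    nlinarith
  have hexp := abs_exp (P := P) n K0 (fun K hK => by
    have hK' : (K0 : ℝ) ≤ K := by exact_mod_cast hK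
    have hAe : A * Real.exp 4 ≤ K := by nlinarith [Real.exp_pos 4]
    have hAK : A * T ≤ K := by
      refine le_trans ?_ (hK0l.trans hK')
      gcongr; nlinarith
    refine (h K hAK).trans (ENNReal.ofReal_le_ofReal ?_)
    have hKp : (0 : ℝ) < K := by nlinarith
    have : A / K ≤ Real.exp (-4) := by
      rw [div_le_iff₀ hKp, Real.exp_neg]
      rw [← div_eq_inv_mul, le_div_iff₀ (Real.exp_pos _)]; exact hAe
    calc _ ≤ Real.exp (-4) ^ ((K : ℝ) / 2) := by gcongr
      _ = _ := by rw [← Real.exp_mul]; congr 1; ring)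
  have hpt : ∀ ω, ENNReal.ofReal (((n ω : ℝ) / T) ^ p) ≤ ENNReal.ofReal ((2 / T) ^ p * K0 ^ p) +
      ENNReal.ofReal ((2 / T) ^ p * p ^ p) * ENNReal.ofReal (Real.exp ((n ω - K0 : ℕ) : ℝ)) := by
    intro ω
    rw [← ENNReal.ofReal_mul (by positivity), ← ENNReal.ofReal_add (by positivity) (by positivity)]
    refine ENNReal.ofReal_le_ofReal ?_
    have h1 : (n ω : ℝ) ≤ K0 + ((n ω - K0 : ℕ) : ℝ) := by exact_mod_cast (by omega : n ω ≤ K0 + (n ω - K0))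
    have h2 := add_rpow_le_two (a := K0) (b := ((n ω - K0 : ℕ) : ℝ)) (by positivity) (by positivity) hpp.le
    have h3 := rpow_le_exp (y := ((n ω - K0 : ℕ) : ℝ)) (by positivity) hp
    calc ((n ω : ℝ) / T) ^ p = (n ω : ℝ) ^ p / T ^ p := Real.div_rpow (by positivity) hTp.le _
      _ ≤ (2 ^ p * (K0 ^ p + p ^ p * Real.exp ((n ω - K0 : ℕ) : ℝ))) / T ^ p := by
          gcongr
          calc _ ≤ ((K0 : ℝ) + ((n ω - K0 : ℕ) : ℝ)) ^ p := by gcongr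
            _ ≤ _ := h2.trans (by gcongr)
      _ = _ := by rw [Real.div_rpow (by norm_num) hTp.le]; ring
  refine (lintegral_mono hpt).trans ?_
  rw [lintegral_add_left measurable_const, lintegral_const_mul' _ _ ENNReal.ofReal_ne_top, lintegral_const,
    measure_univ, mul_one]
  calc _ ≤ ENNReal.ofReal ((2 / T) ^ p * K0 ^ p) + ENNReal.ofReal ((2 / T) ^ p * p ^ p) * ENNReal.ofReal 2 := by
        gcongr; simpa using hexp
    _ = ENNReal.ofReal ((2 / T) ^ p * K0 ^ p + (2 / T) ^ p * p ^ p * 2) := by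
        rw [← ENNReal.ofReal_mul (by positivity), ← ENNReal.ofReal_add (by positivity) (by positivity)]
    _ ≤ _ := by
        refine ENNReal.ofReal_le_ofReal ?_
        have a1 : (K0 : ℝ) ^ p ≤ (K0 + p) ^ p := by gcongr; linarith
        have a2 : p ^ p ≤ ((K0 : ℝ) + p) ^ p := by gcongr; linarith [(Nat.cast_nonneg K0 : (0 : ℝ) ≤ K0)]
        have a3 : (3 : ℝ) ≤ 3 ^ p := by
          calc (3 : ℝ) = 3 ^ (1 : ℝ) := by simp
            _ ≤ _ := Real.rpow_le_rpow_of_exponent_le (by norm_num) hp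
        have hC0 : 0 ≤ C := le_trans (by positivity) hC
        calc _ ≤ (2 / T) ^ p * (K0 + p) ^ p + (2 / T) ^ p * (K0 + p) ^ p * 2 := by gcongr
          _ = 3 * ((2 / T) ^ p * (K0 + p) ^ p) := by ring
          _ ≤ 3 ^ p * ((2 / T) ^ p * (K0 + p) ^ p) := by gcongr
          _ = (3 * ((2 / T) * (K0 + p))) ^ p := by
              rw [Real.mul_rpow (by norm_num) (by positivity), Real.mul_rpow (by positivity) (by positivity)]
          _ ≤ (C * (1 + p / T)) ^ p := by
              refine Real.rpow_le_rpow (by positivity) ?_ hpp.le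
              calc 3 * ((2 / T) * (K0 + p)) ≤ 3 * ((2 / T) * ((A * Real.exp 4 + 1) * T + (A * Real.exp 4 + 1) * p)) := by
                    gcongr
                    nlinarith [Real.exp_pos 4, mul_pos (lt_of_lt_of_le one_pos hA) (Real.exp_pos 4)]
                _ = 6 * (A * Real.exp 4 + 1) * (1 + p / T) := by field_simp; ring
                _ ≤ _ := by gcongr
          _ = _ := Real.mul_rpow hC0 (by positivity)

lemma ent_of_herm {N : ℕ} {A : Matrix (Fin N) (Fin N) ℂ} (hA : A.IsHermitian) (q : ℝ) (i j : Fin N) :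
    ent (fun t : TI N => (q : ℂ) * A t.1.1 t.1.2) i j = q * A i j := by
  unfold ent ephi tidx
  have hc : ∀ a b, (starRingEnd ℂ) (A a b) = A b a := fun a b => hA.apply b a
  rcases lt_trichotomy i j with h | h | h
  · simp [h, h.le]
  · subst h
    have : (A i i).im = 0 := by
      have := hc i i
      exact Complex.conj_eq_iff_im.mp this
    simp only [lt_irrefl, if_false, le_refl, dif_pos]
    apply Complex.ext <;> simp [this]
  · simp [h, h.not_gt, h.not_ge, hc]

lemma eig_bad {N : ℕ} (hN : 0 < N) {A : Matrix (Fin N) (Fin N) ℂ} (hA : A.IsHermitian) {E η : ℝ}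
    (_hη : 0 < η) {K : ℕ} (hK : K ≤ eigCount hA (Set.Icc (E - η / 2) (E + η / 2))) :
    (fun t : TI N => (Real.sqrt N : ℂ) * A t.1.1 t.1.2) ∈ Bad E (η / 2) (Finset.univ : Finset (Fin N)) K := by
  classical
  have hNp : (0 : ℝ) < N := by exact_mod_cast hN
  have hsq0 : (Real.sqrt N : ℂ) ≠ 0 := by
    have := Real.sqrt_pos.mpr hNp
    exact_mod_cast this.ne'
  unfold eigCount at hK
  obtain ⟨F, hF, hFc⟩ := Finset.exists_subset_card_eq hK
  set σ : Fin K → Fin N := fun a => F.equivFinOfCardEq hFc |>.symm a with hσ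
  have hσi : Function.Injective σ := fun a b h => by
    have := Subtype.ext h
    exact (F.equivFinOfCardEq hFc).symm.injective this
  have hσm : ∀ a, hA.eigenvalues (σ a) ∈ Set.Icc (E - η / 2) (E + η / 2) := fun a => by
    have := hF ((F.equivFinOfCardEq hFc).symm a).2
    simpa using this
  set w : Fin K → Fin N → ℂ := fun a i => hA.eigenvectorBasis (σ a) i with hw
  have hON : ON w := by
    intro a b
    have := orthonormal_iff_ite.mp hA.eigenvectorBasis.orthonormal (σ b) (σ a)
    rw [PiLp.inner_apply] at this
    simp only [RCLike.inner_apply] at this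
    rw [hw]; simp only
    rw [this]
    by_cases h : a = b
    · simp [h]
    · have hne : ¬ σ b = σ a := fun hh => h (hσi hh).symm
      rw [if_neg hne, if_neg h]
  refine ⟨w, hON, by simp, fun c => ?_⟩
  have hAm : ∀ i j, Amat E (fun t : TI N => (Real.sqrt N : ℂ) * A t.1.1 t.1.2) i j =
      A i j - if i = j then (E : ℂ) else 0 := by
    intro i j
    unfold Amat
    rw [ent_of_herm hA, mul_div_cancel_left₀ _ hsq0]
  have hev : ∀ a i, ∑ j, A i j * w a j = hA.eigenvalues (σ a) * w a i := by
    intro a i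
    have := congrFun (hA.mulVec_eigenvectorBasis (σ a)) i
    simpa [Matrix.mulVec, dotProduct] using this
  have hrow : ∀ i, ∑ j, Amat E (fun t : TI N => (Real.sqrt N : ℂ) * A t.1.1 t.1.2) i j * ∑ a, c a * w a j =
      ∑ a, (c a * ((hA.eigenvalues (σ a) - E : ℝ) : ℂ)) * w a i := by
    intro i
    simp only [hAm, Finset.mul_sum]
    rw [Finset.sum_comm]
    refine Finset.sum_congr rfl fun a _ => ?_
    have : ∑ j, (A i j - if i = j then (E : ℂ) else 0) * (c a * w a j) =
        c a * (∑ j, A i j * w a j) - c a * E * w a i := by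
      simp only [sub_mul, Finset.sum_sub_distrib, Finset.mul_sum, ite_mul, zero_mul, Finset.sum_ite_eq,
        Finset.mem_univ, if_true]
      congr 1
      · exact Finset.sum_congr rfl fun j _ => by ring
      · ring
    rw [this, hev]; push_cast; ring
  simp only [hrow]
  rw [hON.norm_comb, Finset.mul_sum]
  refine Finset.sum_le_sum fun a _ => ?_
  rw [norm_mul, mul_pow, mul_comm, Complex.norm_real, Real.norm_eq_abs, sq_abs]
  gcongr ?_ * _
  obtain ⟨h1, h2⟩ := hσm a
  exact sq_le_sq' (by linarith) (by linarith)

lemma int_of_lint {m : Measure ℂ} {δ D : ℝ} (hD : 0 ≤ D)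
    (h : ∫⁻ z, ENNReal.ofReal (Real.exp (δ * ‖z‖ ^ 2)) ∂m ≤ ENNReal.ofReal D) :
    Integrable (fun z => Real.exp (δ * ‖z‖ ^ 2)) m ∧ ∫ z, Real.exp (δ * ‖z‖ ^ 2) ∂m ≤ D := by
  have hc : Continuous fun z : ℂ => Real.exp (δ * ‖z‖ ^ 2) := by fun_prop
  have hi : Integrable (fun z : ℂ => Real.exp (δ * ‖z‖ ^ 2)) m := by
    refine ⟨hc.aestronglyMeasurable, ?_⟩
    rw [hasFiniteIntegral_iff_ofReal (.of_forall fun z => (Real.exp_pos _).le)]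
    exact h.trans_lt ENNReal.ofReal_lt_top
  refine ⟨hi, ?_⟩
  rw [integral_eq_lintegral_of_nonneg_ae (.of_forall fun z => (Real.exp_pos _).le) hc.aestronglyMeasurable]
  exact ENNReal.toReal_le_of_le_ofReal hD h

lemma transfer {N : ℕ} {Ω : Type} [MeasurableSpace Ω] {P : Measure Ω}
    {H : Ω → Matrix (Fin N) (Fin N) ℂ} {ν : Measure ℂ} {ν' : Measure ℝ}
    (hW : IsWignerMatrix P N H ν ν') {δ₀ D D' D1 : ℝ} (hC : CondC1 ν ν' δ₀ D D')
    (hD : D ≤ D1) (hD' : D' ≤ D1) (h1 : 1 ≤ D1) :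
    ∃ m : TI N → Measure ℂ, GoodM m δ₀ D1 ∧
      ∀ B : Set (TI N → ℂ), P {ω | (fun t : TI N => (Real.sqrt N : ℂ) * H ω t.1.1 t.1.2) ∈ B} ≤ Measure.pi m B := by
  have i1 := hW.prob
  have i2 := hW.probν
  have i3 := hW.probν'
  obtain ⟨hδ, hC1, hC2⟩ := hC
  set Y : TI N → Ω → ℂ := fun t ω => (Real.sqrt N : ℂ) * H ω t.1.1 t.1.2 with hY
  have hdY : ∀ t : TI N, t.1.1 = t.1.2 → Y t = fun ω => ((Real.sqrt N * (H ω t.1.1 t.1.1).re : ℝ) : ℂ) := by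
    intro t ht
    ext ω
    simp only [hY, ← ht]
    have := hW.diag_real ω t.1.1
    apply Complex.ext <;> simp [this]
  have hdm : ∀ i : Fin N, AEMeasurable (fun ω => Real.sqrt N * (H ω i i).re) P := fun i => by
    refine AEMeasurable.of_map_ne_zero ?_
    rw [hW.diag i]; exact IsProbabilityMeasure.ne_zero _
  have hYm : ∀ t, AEMeasurable (Y t) P := by
    intro t
    by_cases ht : t.1.1 = t.1.2
    · rw [hdY t ht]
      exact Complex.measurable_ofReal.comp_aemeasurable (hdm _)
    · refine AEMeasurable.of_map_ne_zero ?_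
      have := hW.offdiag t.1.1 t.1.2 (lt_of_le_of_ne t.2 ht)
      rw [hY]; simp only
      rw [this]; exact IsProbabilityMeasure.ne_zero _
  have hoff : ∀ t : TI N, t.1.1 ≠ t.1.2 → P.map (Y t) = ν := fun t ht =>
    hW.offdiag t.1.1 t.1.2 (lt_of_le_of_ne t.2 ht)
  have hdia : ∀ t : TI N, t.1.1 = t.1.2 → P.map (Y t) = ν'.map (fun x : ℝ => (x : ℂ)) := fun t ht => by
    rw [hdY t ht, ← hW.diag t.1.1, AEMeasurable.map_map_of_aemeasurable Complex.measurable_ofReal.aemeasurable (hdm _)]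
    rfl
  have hlint : ∀ t, ∫⁻ z, ENNReal.ofReal (Real.exp (δ₀ * ‖z‖ ^ 2)) ∂(P.map (Y t)) ≤ ENNReal.ofReal D1 := by
    intro t
    by_cases ht : t.1.1 = t.1.2
    · rw [hdia t ht, lintegral_map (by
        have : Continuous fun z : ℂ => Real.exp (δ₀ * ‖z‖ ^ 2) := by fun_prop
        exact this.measurable.ennreal_ofReal) Complex.measurable_ofReal]
      simp only [Complex.norm_real, Real.norm_eq_abs, sq_abs]
      exact hC2.trans (ENNReal.ofReal_le_ofReal hD')
    · rw [hoff t ht]; exact hC1.trans (ENNReal.ofReal_le_ofReal hD)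
  refine ⟨fun t => P.map (Y t), ⟨fun t => Measure.isProbabilityMeasure_map (hYm t),
    fun t => (int_of_lint (by linarith) (hlint t)).1, fun t => (int_of_lint (by linarith) (hlint t)).2,
    fun t => ?_, fun t ht => ?_⟩, fun B => ?_⟩
  · by_cases ht : t.1.1 = t.1.2
    · rw [hdia t ht, integral_map Complex.measurable_ofReal.aemeasurable (by fun_prop),
        integral_complex_ofReal, hW.mean']; simp
    · rw [hoff t ht]; exact hW.mean
  · rw [hoff t ht]; exact hW.var
  · have hind : iIndepFun Y P := hW.indep.comp (fun _ z => (Real.sqrt N : ℂ) * z)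
      (fun _ => measurable_const_mul _)
    rw [← hind.map_fun_eq_pi_map hYm]
    exact Measure.le_map_apply (aemeasurable_pi_lambda _ hYm) B

/-- **Upper bound for the density of states on short scales (Theorem `thm:upp`).** -/
theorem stmt_18 :
    ∀ κ nu β δ₀ D D' : ℝ, 0 < κ → 0 < nu → 0 < β → nu + 4 * β < 1 / 2 →
    ∃ C : ℝ, 0 < C ∧
    ∀ (N : ℕ) (Ω : Type) (_ : MeasurableSpace Ω) (P : Measure Ω)
      (H : Ω → Matrix (Fin N) (Fin N) ℂ) (ν : Measure ℂ) (ν' : Measure ℝ),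
      ∀ (hW : IsWignerMatrix P N H ν ν'),
      CondC1 ν ν' δ₀ D D' →
      ∀ E : ℝ, E ∈ Set.Icc (-2 + κ) (2 - κ) →
      ∀ η : ℝ, 0 < η → 1 ≤ N * η → N * η ≤ C * (N : ℝ) ^ β →
      (∀ M : ℝ, 2 ≤ M → M ≤ C * (N : ℝ) ^ β / (N * η) →
        P {ω | M ≤ (eigCount (hW.herm ω) (Set.Icc (E - η / 2) (E + η / 2)) : ℝ) / (N * η)}
          ≤ ENNReal.ofReal ((C / M) ^ (nu * M * N * η))) ∧
      (∀ p : ℝ, 1 ≤ p → p ≤ C * (N : ℝ) ^ (β / 2) →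
        ∫⁻ ω, ENNReal.ofReal
            (((eigCount (hW.herm ω) (Set.Icc (E - η / 2) (E + η / 2)) : ℝ) / (N * η)) ^ p) ∂P
          ≤ ENNReal.ofReal (C ^ p * (1 + p / (N * η)) ^ p)) := by
  intro κ nu β δ₀ D D' hκ hnu hβ hsum
  rcases le_or_gt δ₀ 0 with hδ | hδ
  · refine ⟨1, one_pos, ?_⟩
    intro N Ω _ P H ν ν' hW hC
    exact absurd hC.1 (not_lt.mpr hδ)
  set D1 : ℝ := max 1 (max D D') with hD1
  have h1 : 1 ≤ D1 := le_max_left _ _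
  have h2 : D ≤ D1 := (le_max_left _ _).trans (le_max_right _ _)
  have h3 : D' ≤ D1 := (le_max_right _ _).trans (le_max_right _ _)
  obtain ⟨A, hA, htail⟩ := tail_K δ₀ D1 hδ h1
  have he4 : (1 : ℝ) ≤ Real.exp 4 := Real.one_le_exp (by norm_num)
  refine ⟨6 * (A * Real.exp 4 + 1), by positivity, ?_⟩
  intro N Ω _ P H ν ν' hW hC E hE η hη hNη _
  have i1 := hW.prob
  have hN : 0 < N := by
    rcases Nat.eq_zero_or_pos N with h | h
    · subst h; norm_num at hNη
    · exact h
  have hE2 : |E| ≤ 2 := abs_le.mpr ⟨by linarith [hE.1], by linarith [hE.2]⟩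
  obtain ⟨m, hm, hP⟩ := transfer hW hC h2 h3 h1
  set n : Ω → ℕ := fun ω => eigCount (hW.herm ω) (Set.Icc (E - η / 2) (E + η / 2)) with hn
  have hT : ∀ K : ℕ, A * (N * η) ≤ K → P {ω | K ≤ n ω} ≤ ENNReal.ofReal ((A / K) ^ ((K : ℝ) / 2)) := by
    intro K hK
    have hNη0 : 0 < N * η := by linarith
    refine le_trans ((measure_mono ?_).trans (hP (Bad E (η / 2) Finset.univ K)))
      (htail N m hN hm E (η / 2) K hE2 (by linarith) (by nlinarith) (by nlinarith))
    intro ω hω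
    exact eig_bad hN (hW.herm ω) hη hω
  refine ⟨fun M hM _ => ?_, fun p hp _ => ?_⟩
  · have := abs_tail n hA hNη hT (C := 6 * (A * Real.exp 4 + 1)) (M := M) (nu := nu)
      (by nlinarith) hM hnu (by linarith)
    rw [show nu * M * N * η = nu * M * (N * η) by ring]
    exact this
  · exact abs_mom n hA hNη hT le_rfl hp

end
end

section
/- There exists a universal constant C such that for every κ > 0, every δ > 0, every z ∈ ℂ with |Re z| ≤ 2 − κ and 0 < Im z ≤ 1, and every m ∈ ℂ with Im m > 0: if |m + 1/(m + z)| ≤ δ, then |m − m_sc(z)| ≤ C κ^{−1/2} δ, where m_sc(z) is the Stieltjes transform of the semicircle law. Moreover, there is a universal constant c₁ > 0 such that if in addition δ ≤ c₁ κ, then Im m ≥ (2/5) π ρ_sc(Re z). -/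
open MeasureTheory ProbabilityTheory
open scoped ENNReal NNReal

noncomputable section

lemma aux_root (z : ℂ) (hz : 0 < z.im) :
    ∃ M : ℂ, M ^ 2 + z * M + 1 = 0 ∧ ‖M‖ < 1 ∧ 0 < M.im := by
  have key : ∀ M : ℂ, M ^ 2 + z * M + 1 = 0 → ‖M‖ < 1 → 0 < M.im := by
    intro M hM hn
    have h0 : M ≠ 0 := by rintro rfl; simp at hM
    have hq : 0 < Complex.normSq M := Complex.normSq_pos.2 h0
    have hq1 : Complex.normSq M < 1 := by
      rw [Complex.normSq_eq_norm_sq]; nlinarith [norm_nonneg M]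
    have h2 : z * (Complex.normSq M : ℂ) = -(M * (Complex.normSq M : ℂ)) - (starRingEnd ℂ) M := by
      rw [Complex.normSq_eq_conj_mul_self]
      linear_combination (starRingEnd ℂ) M * hM
    have h3 := congrArg Complex.im h2
    simp at h3
    have h4 : 0 < z.im * Complex.normSq M := by positivity
    have h5 : 0 < M.im * (1 - Complex.normSq M) := by nlinarith
    by_contra hc
    nlinarith
  obtain ⟨w, hw⟩ := IsAlgClosed.exists_pow_nat_eq (z ^ 2 - 4) (n := 2) (by norm_num)
  have e1 : ((-z + w) / 2) ^ 2 + z * ((-z + w) / 2) + 1 = 0 := by linear_combination hw / 4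
  have e2 : ((-z - w) / 2) ^ 2 + z * ((-z - w) / 2) + 1 = 0 := by linear_combination hw / 4
  have e3 : ((-z + w) / 2) * ((-z - w) / 2) = 1 := by linear_combination -hw / 4
  have e4 : ((-z + w) / 2) + ((-z - w) / 2) = -z := by ring
  generalize (-z + w) / 2 = A at *
  generalize (-z - w) / 2 = B at *
  have e5 : ‖A‖ * ‖B‖ = 1 := by rw [← norm_mul, e3]; simp
  rcases lt_trichotomy ‖A‖ 1 with h | h | h
  · exact ⟨A, e1, h, key A e1 h⟩
  · exfalso
    have hc : B = (starRingEnd ℂ) A := by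
      have : A * (starRingEnd ℂ) A = 1 := by rw [Complex.mul_conj, Complex.normSq_eq_norm_sq, h]; simp
      have h0 : A ≠ 0 := by rintro rfl; simp at h
      exact mul_left_cancel₀ h0 (by rw [e3, this])
    have := congrArg Complex.im e4
    rw [hc] at this
    simp at this
    linarith
  · have hB : ‖B‖ < 1 := by
      by_contra hc
      nlinarith
    exact ⟨B, e2, hB, key B e2 hB⟩

lemma aux_hasDeriv (M : ℂ) (hM : ‖M‖ < 1) (c : ℂ) (hc : c ^ 2 = -1) (hn : ∀ θ : ℝ, ‖Complex.exp (c * θ)‖ = 1) (θ : ℝ) :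
    1 + M * Complex.exp (c * θ) ∈ Complex.slitPlane ∧
    HasDerivAt (fun t : ℝ => Complex.log (1 + M * Complex.exp (c * t)))
      (M * (Complex.exp (c * θ) * c) / (1 + M * Complex.exp (c * θ))) θ := by
  have hs : 1 + M * Complex.exp (c * θ) ∈ Complex.slitPlane := by
    left
    have h1 : |(M * Complex.exp (c * θ)).re| ≤ ‖M * Complex.exp (c * θ)‖ := Complex.abs_re_le_norm _
    rw [norm_mul, hn, mul_one] at h1
    have := (abs_le.1 h1).1
    simp only [Complex.add_re, Complex.one_re]
    linarith
  refine ⟨hs, ?_⟩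
  have h0 : HasDerivAt (fun t : ℝ => c * (t : ℂ)) c θ := by
    simpa using (Complex.ofRealCLM.hasDerivAt (x := θ)).const_mul c
  exact (((h0.cexp).const_mul M).const_add 1).clog_real hs

lemma aux_int (z M : ℂ) (hz : 0 < z.im) (hM : M ^ 2 + z * M + 1 = 0) (hn : ‖M‖ < 1) :
    ∫ θ in (0:ℝ)..Real.pi, (4 * (Real.sin θ : ℂ) ^ 2) / (2 * (Real.cos θ : ℂ) - z)
      = 2 * Real.pi * M := by
  have h0 : M ≠ 0 := by rintro rfl; simp at hM
  have hM2 : 1 - M ^ 2 ≠ 0 := by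
    intro h
    have : ‖M ^ 2‖ = 1 := by rw [← sub_eq_zero.1 h]; simp
    rw [norm_pow] at this
    nlinarith [norm_nonneg M]
  have hzx : ∀ x : ℝ, 2 * (x : ℂ) - z ≠ 0 := by
    intro x h
    have := congrArg Complex.im h
    simp at this
    linarith
  have hzM : z = -(M + M⁻¹) := by field_simp; linear_combination hM
  have n1 : ∀ θ : ℝ, ‖Complex.exp (Complex.I * θ)‖ = 1 := fun θ => by
    rw [mul_comm]; exact Complex.norm_exp_ofReal_mul_I θ
  have n2 : ∀ θ : ℝ, ‖Complex.exp (-Complex.I * θ)‖ = 1 := fun θ => by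
    have := Complex.norm_exp_ofReal_mul_I (-θ)
    rw [← this]; congr 2; push_cast; ring
  have d : ∀ θ : ℝ, HasDerivAt (fun t : ℝ => -2 * (Real.sin t : ℂ) - z * t +
      (4 - z ^ 2) * M / (1 - M ^ 2) * ((t : ℂ) +
        Complex.I * Complex.log (1 + M * Complex.exp (Complex.I * t))
        - Complex.I * Complex.log (1 + M * Complex.exp (-Complex.I * t))))
      ((4 * (Real.sin θ : ℂ) ^ 2) / (2 * (Real.cos θ : ℂ) - z)) θ := by
    intro θ
    obtain ⟨s1, d1⟩ := aux_hasDeriv M hn Complex.I (by simp) n1 θ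
    obtain ⟨s2, d2⟩ := aux_hasDeriv M hn (-Complex.I) (by simp) n2 θ
    have dt : HasDerivAt (fun t : ℝ => (t : ℂ)) 1 θ := by
      simpa using (hasDerivAt_id θ).ofReal_comp
    have ds : HasDerivAt (fun t : ℝ => (Real.sin t : ℂ)) (Real.cos θ : ℂ) θ :=
      (Real.hasDerivAt_sin θ).ofReal_comp
    have D := ((ds.const_mul (-2)).sub (dt.const_mul z)).add
      (((dt.add (d1.const_mul Complex.I)).sub (d2.const_mul Complex.I)).const_mul
        ((4 - z ^ 2) * M / (1 - M ^ 2)))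
    refine D.congr_deriv ?_
    have p1 := Complex.slitPlane_ne_zero s1
    have p2 := Complex.slitPlane_ne_zero s2
    have hp : Complex.exp (-Complex.I * θ) * Complex.exp (Complex.I * θ) = 1 := by
      rw [← Complex.exp_add]; simp
    have hcos : 2 * (Real.cos θ : ℂ) = Complex.exp (Complex.I * θ) + Complex.exp (-Complex.I * θ) := by
      rw [Complex.ofReal_cos, Complex.two_cos]; congr 2 <;> ring
    have hsin : (Real.sin θ : ℂ) ^ 2 = 1 - (Real.cos θ : ℂ) ^ 2 := by
      have := Real.sin_sq_add_cos_sq θ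
      have h : (Real.sin θ : ℂ) ^ 2 + (Real.cos θ : ℂ) ^ 2 = 1 := by exact_mod_cast this
      linear_combination h
    have hx := hzx (Real.cos θ)
    rw [hsin]
    generalize (Real.cos θ : ℂ) = c at *
    generalize Complex.exp (Complex.I * θ) = u at *
    generalize Complex.exp (-Complex.I * θ) = v at *
    have hI : Complex.I ^ 2 = -1 := by simp
    have hprod : (1 + M * u) * (1 + M * v) = M * (2 * c - z) := by
      linear_combination hM * (1) + M ^ 2 * hp - M * hcos
    have e1 : Complex.I * (M * (u * Complex.I) / (1 + M * u)) = 1 / (1 + M * u) - 1 := by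
      field_simp; linear_combination M * u * hI
    have e2 : Complex.I * (M * (v * -Complex.I) / (1 + M * v)) = 1 - 1 / (1 + M * v) := by
      field_simp; linear_combination -M * v * hI
    rw [e1, e2]
    have e3 : (1:ℂ) + (1 / (1 + M * u) - 1) - (1 - 1 / (1 + M * v)) = (1 - M ^ 2) / (M * (2 * c - z)) := by
      rw [← hprod]; field_simp; linear_combination -M ^ 2 * hp
    rw [e3]
    field_simp
    ring
  have cont : Continuous fun θ : ℝ => (4 * (Real.sin θ : ℂ) ^ 2) / (2 * (Real.cos θ : ℂ) - z) := by
    refine Continuous.div (by fun_prop) (by fun_prop) fun θ => hzx _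
  rw [intervalIntegral.integral_eq_sub_of_hasDerivAt (fun θ _ => d θ) (cont.intervalIntegrable _ _)]
  have q1 : Complex.exp (Complex.I * Real.pi) = -1 := by rw [mul_comm, Complex.exp_pi_mul_I]
  have q2 : Complex.exp (-Complex.I * Real.pi) = -1 := by
    rw [neg_mul, Complex.exp_neg, q1]; norm_num
  rw [q1, q2]
  simp only [Real.sin_pi, Real.sin_zero, Complex.ofReal_zero, mul_zero, Complex.exp_zero]
  have : (4 - z ^ 2) * M / (1 - M ^ 2) = -(1 - M ^ 2) / M := by
    rw [hzM]; field_simp; ring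
  rw [this, hzM]
  field_simp
  ring

lemma aux_mSC (z M : ℂ) (hz : 0 < z.im) (hM : M ^ 2 + z * M + 1 = 0) (hn : ‖M‖ < 1) :
    mSC z = M := by
  have hzx : ∀ x : ℝ, (x : ℂ) - z ≠ 0 := by
    intro x h
    have := congrArg Complex.im h
    simp at this
    linarith
  set g : ℝ → ℂ := fun x => ((Real.sqrt (4 - x ^ 2) / (2 * Real.pi) : ℝ) : ℂ) / ((x : ℂ) - z) with hg
  have gc : Continuous g := by
    refine Continuous.div (by fun_prop) (by fun_prop) fun x => hzx _
  have h1 : mSC z = ∫ x in (-2:ℝ)..2, g x := by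
    rw [intervalIntegral.integral_of_le (by norm_num), ← integral_Icc_eq_integral_Ioc,
      ← integral_indicator measurableSet_Icc]
    unfold mSC
    congr 1
    ext1 x
    by_cases hx : |x| ≤ 2
    · have : x ∈ Set.Icc (-2:ℝ) 2 := abs_le.1 hx
      simp only [rhoSC, if_pos hx, Set.indicator_of_mem this, hg]
    · have : x ∉ Set.Icc (-2:ℝ) 2 := fun h => hx (abs_le.2 h)
      simp [rhoSC, if_neg hx, Set.indicator_of_notMem this]
  have h2 := intervalIntegral.integral_comp_smul_deriv (a := Real.pi) (b := 0)
    (f := fun θ => 2 * Real.cos θ) (f' := fun θ => 2 * (-Real.sin θ)) (g := g)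
    (fun θ _ => (Real.hasDerivAt_cos θ).const_mul 2) (by fun_prop) gc
  simp only [Real.cos_pi, Real.cos_zero, mul_one, mul_neg_one] at h2
  rw [h1, ← h2, intervalIntegral.integral_symm, ← intervalIntegral.integral_neg]
  have h3 : ∫ θ in (0:ℝ)..Real.pi, -((2 * (-Real.sin θ)) • (g ∘ fun θ => 2 * Real.cos θ) θ)
      = ∫ θ in (0:ℝ)..Real.pi, (2 * Real.pi : ℂ)⁻¹ * ((4 * (Real.sin θ : ℂ) ^ 2) / (2 * (Real.cos θ : ℂ) - z)) := by
    refine intervalIntegral.integral_congr fun θ hθ => ?_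
    rw [Set.uIcc_of_le Real.pi_pos.le] at hθ
    have hs := Real.sin_nonneg_of_mem_Icc hθ
    have hsq : Real.sqrt (4 - (2 * Real.cos θ) ^ 2) = 2 * Real.sin θ := by
      rw [show 4 - (2 * Real.cos θ) ^ 2 = (2 * Real.sin θ) ^ 2 by
        nlinarith [Real.sin_sq_add_cos_sq θ]]
      exact Real.sqrt_sq (by positivity)
    simp only [hg, Function.comp, hsq, Complex.real_smul]
    push_cast
    ring
  rw [h3, intervalIntegral.integral_const_mul, aux_int z M hz hM hn]
  have : (Real.pi : ℂ) ≠ 0 := by exact_mod_cast Real.pi_ne_zero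
  field_simp

lemma aux_bound (z M : ℂ) (hM : M ^ 2 + z * M + 1 = 0) (hn : ‖M‖ < 1) (hi : 0 < M.im)
    (hE : |z.re| ≤ 2) (h0 : 0 < z.im) (h1 : z.im ≤ 1) :
    0.225 * Real.sqrt (4 - z.re ^ 2) ≤ M.im := by
  have hE2 : z.re ^ 2 ≤ 4 := by nlinarith [abs_nonneg z.re, sq_abs z.re]
  have hr := congrArg Complex.re hM
  have him := congrArg Complex.im hM
  simp [pow_two] at hr him
  have hq1 : M.re ^ 2 + M.im ^ 2 < 1 := by
    have : Complex.normSq M < 1 := by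
      rw [Complex.normSq_eq_norm_sq]; nlinarith [norm_nonneg M]
    rw [Complex.normSq_apply] at this; nlinarith
  generalize M.re = a at *
  generalize M.im = b at *
  generalize z.re = E at *
  generalize z.im = y at *
  obtain ⟨q, hq⟩ : ∃ q, q = a ^ 2 + b ^ 2 := ⟨_, rfl⟩
  have hq0 : 0 < q := by rw [hq]; positivity
  rw [← hq] at hq1
  have f1 : E * q = -a * (1 + q) := by rw [hq]; linear_combination a * hr + b * him
  have f2 : y * q = b * (1 - q) := by rw [hq]; linear_combination a * him - b * hr
  have g1 : E ^ 2 * q ^ 2 = a ^ 2 * (1 + q) ^ 2 := by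
    rw [← mul_pow, f1]; ring
  have g2 : y ^ 2 * q ^ 2 = b ^ 2 * (1 - q) ^ 2 := by
    rw [← mul_pow, f2]; ring
  have hy2 : y ^ 2 ≤ 1 := by nlinarith
  -- lower bound on q
  have hql : 0.2025 ≤ q := by
    by_contra hc
    push Not at hc
    have k1 : a ^ 2 ≤ 0.57 * q := by
      have : 4 * q ≤ 0.57 * (1 + q) ^ 2 := by nlinarith
      have h3 : a ^ 2 * (1 + q) ^ 2 ≤ 4 * q ^ 2 := by rw [← g1]; gcongr
      have : a ^ 2 * (1 + q) ^ 2 ≤ (0.57 * q) * (1 + q) ^ 2 := by nlinarith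
      exact le_of_mul_le_mul_right this (by positivity)
    have k2 : b ^ 2 ≤ 0.33 * q := by
      have hp : 0 < 1 - q := by linarith
      have : q ≤ 0.33 * (1 - q) ^ 2 := by nlinarith
      have h3 : b ^ 2 * (1 - q) ^ 2 ≤ 1 * q ^ 2 := by rw [← g2]; gcongr
      have : b ^ 2 * (1 - q) ^ 2 ≤ (0.33 * q) * (1 - q) ^ 2 := by nlinarith
      exact le_of_mul_le_mul_right this (by positivity)
    nlinarith
  have k3 : a ^ 2 ≤ E ^ 2 * q / 4 := by
    have h4 : 4 * q ≤ (1 + q) ^ 2 := by nlinarith [sq_nonneg (1 - q)]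
    have h5 : a ^ 2 * (4 * q) ≤ a ^ 2 * (1 + q) ^ 2 := by gcongr
    have h6 : a ^ 2 * (4 * q) ≤ (E ^ 2 * q) * q := by linarith
    linarith [le_of_mul_le_mul_right (show (4 * a ^ 2) * q ≤ (E ^ 2 * q) * q by linarith) hq0]
  have k4 : 0.2025 * (4 - E ^ 2) / 4 ≤ b ^ 2 := by
    have h7 : 0.2025 * (4 - E ^ 2) ≤ q * (4 - E ^ 2) :=
      mul_le_mul_of_nonneg_right hql (by linarith)
    linarith
  refine (sq_le_sq₀ (by positivity) hi.le).1 ?_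
  rw [mul_pow, Real.sq_sqrt (by linarith)]
  linarith

/-- **Stability of the self-consistent equation for the semicircle law.** -/
theorem stmt_19 :
    ∃ C c₁ : ℝ, 0 < C ∧ 0 < c₁ ∧
    ∀ (κ δ : ℝ) (z m : ℂ), 0 < κ → 0 < δ →
      |z.re| ≤ 2 - κ → 0 < z.im → z.im ≤ 1 → 0 < m.im →
      ‖m + 1 / (m + z)‖ ≤ δ →
      ‖m - mSC z‖ ≤ C / Real.sqrt κ * δ ∧
      (δ ≤ c₁ * κ → 2 / 5 * (Real.pi * rhoSC z.re) ≤ m.im) := by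
  refine ⟨7, 0.003, by norm_num, by norm_num, ?_⟩
  intro κ δ z m hκ hδ hE h0 h1 hm hd
  obtain ⟨M, hM, hn, hi⟩ := aux_root z h0
  rw [aux_mSC z M h0 hM hn]
  have hE' : |z.re| ≤ 2 := by linarith
  have hb := aux_bound z M hM hn hi hE' h0 h1
  have hκ2 : κ ≤ 2 := by linarith [abs_nonneg z.re]
  set s := Real.sqrt (4 - z.re ^ 2) with hs
  set k := Real.sqrt κ with hk
  have hk0 : 0 < k := Real.sqrt_pos.2 hκ
  have hkk : k ^ 2 = κ := Real.sq_sqrt hκ.le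
  have hsk : k ≤ s := by
    apply Real.sqrt_le_sqrt
    nlinarith [abs_nonneg z.re, sq_abs z.re]
  have hk2 : k ≤ 2 := by nlinarith
  have hmz : m + z ≠ 0 := by
    intro h
    have := congrArg Complex.im h
    simp at this; linarith
  have him : M.im ≤ ‖m + z + M‖ := by
    refine le_trans ?_ ((le_abs_self _).trans (Complex.abs_im_le_norm _))
    simp; linarith
  have hP : 0 < ‖m + z + M‖ := by linarith
  have hid : (m - M) * (m + z + M) = (m + 1 / (m + z)) * (m + z) := by
    field_simp
    linear_combination -hM
  have hid2 : ‖m - M‖ * ‖m + z + M‖ = ‖m + 1 / (m + z)‖ * ‖m + z‖ := by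
    rw [← norm_mul, hid, norm_mul]
  have htri : ‖m + z‖ ≤ ‖m + z + M‖ + 1 := by
    have := norm_sub_le (m + z + M) M
    rw [add_sub_cancel_right] at this
    linarith
  have hmain : ‖m - M‖ ≤ 7 / k * δ := by
    have hP2 : 0.225 * k ≤ ‖m + z + M‖ := by linarith
    have h7 : ‖m + z‖ ≤ 7 / k * ‖m + z + M‖ := by
      rw [div_mul_eq_mul_div, le_div_iff₀ hk0]
      nlinarith
    have : ‖m - M‖ * ‖m + z + M‖ ≤ (7 / k * δ) * ‖m + z + M‖ := by
      rw [hid2]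
      calc _ ≤ δ * (7 / k * ‖m + z + M‖) := by gcongr
        _ = _ := by ring
    exact le_of_mul_le_mul_right this hP
  refine ⟨hmain, fun hc => ?_⟩
  have h8 : ‖m - M‖ ≤ 0.021 * k := by
    refine hmain.trans ?_
    rw [div_mul_eq_mul_div, div_le_iff₀ hk0]
    nlinarith
  have h9 : M.im - m.im ≤ ‖m - M‖ := by
    have := (abs_le.1 (Complex.abs_im_le_norm (m - M))).1
    simp at this; linarith
  have h10 : Real.pi * rhoSC z.re = s / 2 := by
    rw [rhoSC, if_pos hE', ← hs]
    field_simp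
  rw [h10]
  linarith

end
end
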